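/- (Filling Theorem′) Let Γ^t, t ∈ [0,∞), be a smooth family of graphical tori. Then there exists a function g : Δ̄ × S¹ × [0,∞) → ℂ such that for each t the map g(·,·,t) defines a holomorphic transverse foliation of Γ^t, the holomorphic disks associated to Γ^{t₁} are disjoint from those associated to Γ^{t₂} whenever t₁ ≠ t₂, and the foliation is unique in the strong sense: any continuous h : Δ̄ → ℂ, holomorphic on Δ, nonvanishing on Δ, whose trace lies in some Γ^t, coincides with g(·, ξ, t) for some ξ ∈ S¹. -/

import Mathlib

open Set Metric Complex

noncomputable section

/-- The closed curve `c` (periodic of period `2π`) has winding number `1` around `0`: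
there is a continuous lift of the argument increasing by `2π` over one period. -/
def WindingOne (c : ℝ → ℂ) : Prop :=
  ∃ θ : ℝ → ℝ, Continuous θ ∧
    (∀ t, c t = (‖c t‖ : ℂ) * Complex.exp ((θ t : ℂ) * Complex.I)) ∧
    θ (2 * Real.pi) = θ 0 + 2 * Real.pi

/-- `c : ℝ → ℂ` is a smooth simple closed curve (parametrized with period `2π`). -/
def IsSCC (c : ℝ → ℂ) : Prop :=
  ContDiff ℝ (⊤ : ℕ∞) c ∧ (∀ t, c (t + 2 * Real.pi) = c t) ∧
    Set.InjOn c (Ico 0 (2 * Real.pi)) ∧ ∀ t, deriv c t ≠ 0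

/-- `Γ ⊆ S¹ × ℂ` is a graphical torus: every vertical slice `C_λ` is a smooth simple
closed curve in `ℂ ∖ {0}` with winding number `1` around `0`. -/
def IsGraphicalTorus (Γ : Set (ℂ × ℂ)) : Prop :=
  (∀ p ∈ Γ, p.1 ∈ sphere (0 : ℂ) 1) ∧
  ∀ l ∈ sphere (0 : ℂ) 1, ∃ c : ℝ → ℂ,
    IsSCC c ∧ (∀ t, c t ≠ 0) ∧ WindingOne c ∧ Set.range c = {w : ℂ | (l, w) ∈ Γ}

/-- `g` is continuous on the closed unit disk and holomorphic on the open unit disk,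
hence defines a holomorphic disk `{(λ, g λ) : λ ∈ Δ}`. -/
def HolDisk (g : ℂ → ℂ) : Prop :=
  ContinuousOn g (closedBall (0 : ℂ) 1) ∧ DifferentiableOn ℂ g (ball (0 : ℂ) 1)

/-- The trace `{(λ, g λ) : λ ∈ S¹}` of the disk defined by `g` lies in `Γ`. -/
def DiskTraceIn (g : ℂ → ℂ) (Γ : Set (ℂ × ℂ)) : Prop :=
  ∀ l ∈ sphere (0 : ℂ) 1, (l, g l) ∈ Γ

/-- `f` is Hölder continuous with exponent `α` on `s`. -/
def HolderOn (f : ℂ → ℂ) (s : Set ℂ) (α : ℝ) : Prop :=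
  ∃ A : ℝ, ∀ x ∈ s, ∀ y ∈ s, ‖f x - f y‖ ≤ A * ‖x - y‖ ^ α

/-- `g ∈ C^{1,α}(Δ̄)`: the derivative of `g` extends to the closed unit disk as an
`α`-Hölder continuous function. -/
def C1AlphaOnDisk (g : ℂ → ℂ) (α : ℝ) : Prop :=
  ∃ g' : ℂ → ℂ, (∀ z ∈ ball (0 : ℂ) 1, HasDerivAt g (g' z) z) ∧
    ContinuousOn g' (closedBall (0 : ℂ) 1) ∧ HolderOn g' (closedBall (0 : ℂ) 1) α

/-- `g : Δ̄ × S¹ → ℂ` defines a holomorphic transverse foliation of the graphical torus `Γ`: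
`g` is continuous, each `g_ξ = g(·,ξ)` is holomorphic on `Δ`, of class `C^{1,α}(Δ̄)`, with
trace in `Γ`, nonvanishing on `Δ`, the leaves are pairwise disjoint over `Δ`, and the traces
`γ_ξ` are simple, pairwise disjoint and foliate `Γ` (each point of `Γ` lies on exactly one). -/
def IsHolTransFoliation (Γ : Set (ℂ × ℂ)) (g : ℂ → ℂ → ℂ) : Prop :=
  ContinuousOn (fun q : ℂ × ℂ => g q.1 q.2) (closedBall (0 : ℂ) 1 ×ˢ sphere (0 : ℂ) 1) ∧
  (∃ α : ℝ, 0 < α ∧ α < 1 ∧ ∀ ξ ∈ sphere (0 : ℂ) 1, C1AlphaOnDisk (fun l => g l ξ) α) ∧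
  (∀ ξ ∈ sphere (0 : ℂ) 1, HolDisk (fun l => g l ξ)) ∧
  (∀ ξ ∈ sphere (0 : ℂ) 1, DiskTraceIn (fun l => g l ξ) Γ) ∧
  (∀ ξ ∈ sphere (0 : ℂ) 1, ∀ l ∈ ball (0 : ℂ) 1, g l ξ ≠ 0) ∧
  (∀ ξ ∈ sphere (0 : ℂ) 1, ∀ η ∈ sphere (0 : ℂ) 1, ξ ≠ η →
    ∀ l ∈ ball (0 : ℂ) 1, g l ξ ≠ g l η) ∧
  (∀ p ∈ Γ, ∃! ξ : ℂ, ξ ∈ sphere (0 : ℂ) 1 ∧ g p.1 ξ = p.2)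

/-- The Wirtinger derivative `∂f/∂w = ½(∂f/∂x − i ∂f/∂y)` of `f : ℂ → ℝ`, as a complex number. -/
def wirt (f : ℂ → ℝ) (w : ℂ) : ℂ :=
  (((fderiv ℝ f w 1 : ℝ) : ℂ) - Complex.I * ((fderiv ℝ f w Complex.I : ℝ) : ℂ)) / 2

/-- The torus `Γ^t = {(λ, w) : λ ∈ S¹, F(λ,w) = t}` cut out by the defining function `F`. -/
def TorusOf (F : ℂ → ℂ → ℝ) (t : ℝ) : Set (ℂ × ℂ) :=
  {p : ℂ × ℂ | p.1 ∈ sphere (0 : ℂ) 1 ∧ F p.1 p.2 = t}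

/-- `F : S¹ × ℂ → ℝ` is a smooth defining function of a smooth family of graphical tori
`Γ^t = F⁻¹(t)`, `t > 0`: each slice level set is a smooth simple closed curve of winding
number `1` around `0`, the level sets foliate `ℂ ∖ {0}` for each fixed `λ ∈ S¹`,
`F(λ,w) = |w|²` near `w = 0`, and `∂F/∂w ≠ 0` for `w ≠ 0`. -/
def IsSmoothTorusFamily (F : ℂ → ℂ → ℝ) : Prop :=
  ContDiffOn ℝ (⊤ : ℕ∞) (fun p : ℂ × ℂ => F p.1 p.2) (sphere (0 : ℂ) 1 ×ˢ univ) ∧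
  (∀ l ∈ sphere (0 : ℂ) 1, ContDiff ℝ (⊤ : ℕ∞) (F l)) ∧
  (∃ ε : ℝ, 0 < ε ∧ ∀ l ∈ sphere (0 : ℂ) 1, ∀ w : ℂ,
      Complex.normSq w < ε → F l w = Complex.normSq w) ∧
  (∀ l ∈ sphere (0 : ℂ) 1, ∀ w : ℂ, w ≠ 0 → 0 < F l w) ∧
  (∀ l ∈ sphere (0 : ℂ) 1, ∀ w : ℂ, w ≠ 0 → wirt (F l) w ≠ 0) ∧
  (∀ l ∈ sphere (0 : ℂ) 1, ∀ t : ℝ, 0 < t → ∃ c : ℝ → ℂ,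
      IsSCC c ∧ (∀ s, c s ≠ 0) ∧ WindingOne c ∧ Set.range c = {w : ℂ | F l w = t})

section

open scoped ENNReal

/-- Lower bound for the distance from a point of the unit circle to a point of a radius. -/
theorem dist_circle_radius_ge {r φ : ℝ} (hr0 : 0 ≤ r) (hr : r ≤ 1) (hφ : |φ| ≤ Real.pi) :
    ((1 - r) + |φ|) / (2 * Real.pi) ≤ ‖exp (φ * I) - r‖ := by
  have hpi := Real.pi_pos
  have hpi3 := Real.pi_gt_three
  have h1 : 1 - r ≤ ‖exp (φ * I) - r‖ := by
    have := norm_sub_norm_le (exp (φ * I)) (r : ℂ)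
    rw [norm_exp_ofReal_mul_I, norm_real, Real.norm_eq_abs, abs_of_nonneg hr0] at this
    exact this
  have h2 : 2 * |φ| / Real.pi ≤ ‖exp (φ * I) - 1‖ := by
    rw [mul_comm (φ : ℂ), norm_exp_I_mul_ofReal_sub_one, norm_mul, Real.norm_eq_abs,
        Real.norm_eq_abs]
    have h3 := Real.mul_le_sin (x := |φ| / 2) (by positivity) (by linarith)
    have h4 : |Real.sin (φ / 2)| = |Real.sin (|φ| / 2)| := by
      rcases abs_cases φ with ⟨h, _⟩ | ⟨h, _⟩ <;> rw [h]
      rw [neg_div, Real.sin_neg, abs_neg]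
    rw [h4]
    have := le_abs_self (Real.sin (|φ| / 2))
    have e : 2 * |φ| / Real.pi = 2 * (2 / Real.pi * (|φ| / 2)) := by field_simp
    rw [e, abs_of_pos (by norm_num : (0:ℝ) < 2)]
    linarith
  have h3 : ‖exp (φ * I) - 1‖ ≤ ‖exp (φ * I) - r‖ + (1 - r) := by
    have := norm_add_le (exp (φ * I) - r) ((r : ℂ) - 1)
    have e : ‖(r : ℂ) - 1‖ = 1 - r := by
      rw [← ofReal_one, ← ofReal_sub, norm_real, Real.norm_eq_abs, abs_of_nonpos (by linarith)]
      ring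
    rw [e] at this; simpa using this
  have h5 : |φ| / Real.pi ≤ ‖exp (φ * I) - r‖ := by
    have : 2 * |φ| / Real.pi = 2 * (|φ| / Real.pi) := by ring
    linarith
  have h6 : (1 - r) / Real.pi ≤ ‖exp (φ * I) - r‖ :=
    (div_le_self (by linarith) (by linarith)).trans h1
  have : ((1 - r) + |φ|) / (2 * Real.pi) = ((1 - r) / Real.pi + |φ| / Real.pi) / 2 := by
    field_simp
  rw [this]; linarith

theorem integral_shift_rpow_le {κ d : ℝ} (hκ1 : κ < 1) (hd : 0 < d) :
    ∫ θ in (0:ℝ)..(2 * Real.pi), (θ + d) ^ (κ - 2) ≤ d ^ (κ - 1) / (1 - κ) := by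
  have hpi := Real.pi_pos
  rw [intervalIntegral.integral_comp_add_right (fun x => x ^ (κ - 2)), integral_rpow]
  · have : κ - 2 + 1 = -(1 - κ) := by ring
    rw [this, div_neg, ← neg_div]
    have h1 : 0 < 1 - κ := by linarith
    gcongr
    have := Real.rpow_nonneg (show 0 ≤ 2 * Real.pi + d by positivity) (-(1 - κ))
    rw [show κ - 1 = -(1 - κ) by ring, zero_add]
    linarith
  · right
    refine ⟨by linarith, ?_⟩
    rw [uIcc_of_le (by linarith)]
    simp only [mem_Icc, zero_add, not_and, not_le]
    intro h; linarith

theorem exists_circleAverage_rpow_le {κ : ℝ} (hκ1 : κ < 1) :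
    ∃ K : ℝ, 0 ≤ K ∧ ∀ w ∈ ball (0 : ℂ) 1,
      Real.circleAverage (fun ζ => ‖ζ - w‖ ^ (κ - 2)) 0 1 ≤ K * (1 - ‖w‖) ^ (κ - 1) := by
  have hpi := Real.pi_pos
  refine ⟨(2 * Real.pi)⁻¹ * ((2 * Real.pi)⁻¹ ^ (κ - 2) * (2 / (1 - κ))), ?_, ?_⟩
  · have : 0 < 1 - κ := by linarith
    positivity
  intro w hw
  have hw' : ‖w‖ < 1 := by simpa using hw
  set d := 1 - ‖w‖ with hd
  have hd0 : 0 < d := by rw [hd]; linarith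
  rw [Real.circleAverage_eq_integral_add w.arg, smul_eq_mul, mul_assoc]
  gcongr
  have key : ∀ θ ∈ Icc (0:ℝ) (2 * Real.pi), ‖circleMap 0 1 (θ + w.arg) - w‖ ^ (κ - 2) ≤
      (2 * Real.pi)⁻¹ ^ (κ - 2) * ((θ + d) ^ (κ - 2) + ((2 * Real.pi - θ) + d) ^ (κ - 2)) := by
    intro θ hθ
    have e1 : ‖circleMap 0 1 (θ + w.arg) - w‖ = ‖exp (θ * I) - ‖w‖‖ := by
      have e0 : circleMap 0 1 (θ + w.arg) - w = (exp (θ * I) - ‖w‖) * exp (w.arg * I) := by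
        rw [sub_mul, norm_mul_exp_arg_mul_I, circleMap]
        push_cast
        rw [add_mul, Complex.exp_add, zero_add, one_mul]
      rw [e0, norm_mul, norm_exp_ofReal_mul_I, mul_one]
    have h0 : κ - 2 ≤ 0 := by linarith
    have hp : 0 ≤ (2 * Real.pi)⁻¹ := by positivity
    rw [e1, mul_add]
    rcases le_total θ Real.pi with h | h
    · have := dist_circle_radius_ge (norm_nonneg w) hw'.le (φ := θ)
        (by rw [abs_of_nonneg hθ.1]; exact h)
      rw [abs_of_nonneg hθ.1] at this
      have h2 : 0 < (1 - ‖w‖ + θ) / (2 * Real.pi) := by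
        have := hθ.1; positivity
      have := Real.rpow_le_rpow_of_nonpos h2 this h0
      refine this.trans ?_
      rw [div_eq_mul_inv, Real.mul_rpow (by linarith [hθ.1]) hp, mul_comm, ← hd, add_comm d]
      have : 0 ≤ 2 * Real.pi - θ + d := by linarith [hθ.2]
      have : 0 ≤ (2 * Real.pi)⁻¹ ^ (κ - 2) * (2 * Real.pi - θ + d) ^ (κ - 2) := by positivity
      linarith
    · have hab : |θ - 2 * Real.pi| = 2 * Real.pi - θ := by
        rw [abs_of_nonpos (by linarith [hθ.2])]; ring
      have := dist_circle_radius_ge (norm_nonneg w) hw'.le (φ := θ - 2 * Real.pi)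
        (by rw [hab]; linarith)
      rw [hab] at this
      have e2 : exp (((θ - 2 * Real.pi : ℝ) : ℂ) * I) = exp (θ * I) := by
        rw [Complex.exp_eq_exp_iff_exists_int]
        exact ⟨-1, by push_cast; ring⟩
      rw [e2] at this
      have h2 : 0 < (1 - ‖w‖ + (2 * Real.pi - θ)) / (2 * Real.pi) := by
        have := hθ.2; 
        have : 0 ≤ 2 * Real.pi - θ := by linarith
        positivity
      have := Real.rpow_le_rpow_of_nonpos h2 this h0
      refine this.trans ?_
      rw [div_eq_mul_inv, Real.mul_rpow (by linarith [hθ.2]) hp, mul_comm, ← hd, add_comm d]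
      have : 0 ≤ θ + d := by linarith [hθ.1]
      have : 0 ≤ (2 * Real.pi)⁻¹ ^ (κ - 2) * (θ + d) ^ (κ - 2) := by positivity
      linarith
  have c1 : ContinuousOn (fun θ : ℝ => (θ + d) ^ (κ - 2)) (uIcc 0 (2 * Real.pi)) := by
    rw [uIcc_of_le (by linarith)]
    apply ContinuousOn.rpow_const (by fun_prop)
    intro x hx; left; linarith [hx.1]
  have c2 : ContinuousOn (fun θ : ℝ => ((2 * Real.pi - θ) +
      d) ^ (κ - 2)) (uIcc 0 (2 * Real.pi)) := by
    rw [uIcc_of_le (by linarith)]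
    apply ContinuousOn.rpow_const (by fun_prop)
    intro x hx; left; linarith [hx.2]
  have c3 : ContinuousOn (fun θ : ℝ => ‖circleMap 0 1 (θ + w.arg) - w‖ ^ (κ - 2))
      (uIcc 0 (2 * Real.pi)) := by
    apply ContinuousOn.rpow_const
    · exact Continuous.continuousOn (by fun_prop)
    intro x hx; left
    rw [norm_ne_zero_iff, sub_ne_zero]
    intro h
    have : ‖w‖ = 1 := by rw [← h, circleMap, zero_add, ofReal_one, one_mul, norm_exp_ofReal_mul_I]
    linarith
  have := intervalIntegral.integral_mono_on (μ := MeasureTheory.volume) (by linarith)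
    c3.intervalIntegrable (continuousOn_const.mul (c1.add c2)).intervalIntegrable key
  refine this.trans ?_
  simp only [Pi.mul_apply, Pi.add_apply]
  rw [intervalIntegral.integral_const_mul, mul_assoc]
  refine mul_le_mul_of_nonneg_left ?_ (by positivity)
  rw [intervalIntegral.integral_add c1.intervalIntegrable c2.intervalIntegrable]
  have i1 := integral_shift_rpow_le hκ1 hd0
  have i2 : ∫ θ in (0:ℝ)..(2 * Real.pi), ((2 * Real.pi - θ) + d) ^ (κ - 2) =
      ∫ θ in (0:ℝ)..(2 * Real.pi), (θ + d) ^ (κ - 2) := by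
    rw [intervalIntegral.integral_comp_sub_left (fun x => (x + d) ^ (κ - 2))]
    simp
  rw [i2]
  have : 2 / (1 - κ) * d ^ (κ - 1) = d ^ (κ - 1) / (1 - κ) + d ^ (κ - 1) / (1 - κ) := by ring
  linarith

/-- `f` is Hölder continuous on `s` with exponent `κ` and constant `C`. -/
def HolBd {V : Type*} [NormedAddCommGroup V] (κ C : ℝ) (f : ℂ → V) (s : Set ℂ) : Prop :=
  ∀ x ∈ s, ∀ y ∈ s, ‖f x - f y‖ ≤ C * ‖x - y‖ ^ κ

theorem HolBd.mono {V : Type*} [NormedAddCommGroup V] {κ C C' : ℝ} {f : ℂ → V} {s : Set ℂ}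
    (h : HolBd κ C f s) (hC : C ≤ C') : HolBd κ C' f s := fun x hx y hy =>
  (h x hx y hy).trans (by gcongr)

theorem HolBd.continuousOn {V : Type*} [NormedAddCommGroup V] {κ C : ℝ} {f : ℂ → V} {s : Set ℂ}
    (hκ : 0 < κ) (h : HolBd κ C f s) : ContinuousOn f s := by
  intro x hx
  rw [ContinuousWithinAt, tendsto_iff_norm_sub_tendsto_zero]
  have h1 : Filter.Tendsto (fun y : ℂ => C * ‖y - x‖ ^ κ) (nhdsWithin x s) (nhds 0) := by
    have : ContinuousAt (fun y : ℂ => C * ‖y - x‖ ^ κ) x :=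
      ContinuousAt.mul continuousAt_const (ContinuousAt.rpow_const (by fun_prop) (Or.inr hκ.le))
    have := this.tendsto
    simp only [sub_self, norm_zero, Real.zero_rpow hκ.ne', mul_zero] at this
    exact this.mono_left nhdsWithin_le_nhds
  refine squeeze_zero' (Filter.Eventually.of_forall fun _ => norm_nonneg _) ?_ h1
  filter_upwards [self_mem_nhdsWithin] with y hy using h y hy x hx

theorem radial_estimate {f f' : ℂ → ℂ} {κ C : ℝ} (hκ : 0 < κ) (hκ1 : κ ≤ 1) (hC : 0 ≤ C)
    (hf : ∀ z ∈ ball (0 : ℂ) 1, HasDerivAt f (f' z) z)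
    (hb : ∀ z ∈ ball (0 : ℂ) 1, ‖f' z‖ ≤ C * (1 - ‖z‖) ^ (κ - 1))
    {z : ℂ} (hz : z ∈ ball (0 : ℂ) 1) {δ : ℝ} (hδ0 : 0 ≤ δ) (hδ : δ ≤ 1) :
    ‖f ((1 - δ : ℝ) * z) - f z‖ ≤ C * (2 ^ (1 - κ) / κ) * δ ^ κ := by
  have hz' : ‖z‖ < 1 := by simpa using hz
  set d := 1 - ‖z‖ with hd
  have hd0 : 0 < d := by rw [hd]; linarith
  have hmem : ∀ τ ∈ Icc 0 δ, ((1 - τ : ℝ) : ℂ) * z ∈ ball (0 : ℂ) 1 := by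
    intro τ hτ
    rw [mem_ball_zero_iff, norm_mul, norm_real, Real.norm_eq_abs,
      abs_of_nonneg (by linarith [hτ.2])]
    nlinarith [hτ.1, norm_nonneg z]
  have hder : ∀ τ ∈ Icc 0 δ, HasDerivAt (fun τ : ℝ => f ((1 - τ : ℝ) * z) - f z)
      (f' ((1 - τ : ℝ) * z) * (-z)) τ := by
    intro τ hτ
    have h1 : HasDerivAt (fun τ : ℝ => ((1 - τ : ℝ) : ℂ) * z) (-z) τ := by
      have := (((hasDerivAt_id τ).const_sub 1).ofReal_comp).mul_const z
      simpa using this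
    exact ((hf _ (hmem τ hτ)).comp τ h1).sub_const _
  have hdd : ∀ τ ∈ Icc 0 δ, 0 < d + τ := fun τ hτ => by linarith [hτ.1]
  have hB : ∀ τ ∈ Icc 0 δ, HasDerivAt
      (fun τ : ℝ => C * (2 ^ (1 - κ) / κ) * ((d + τ) ^ κ - d ^ κ))
      (C * 2 ^ (1 - κ) * (d + τ) ^ (κ - 1)) τ := by
    intro τ hτ
    have h1 := ((((hasDerivAt_id τ).const_add d).rpow_const (p := κ)
      (Or.inl (hdd τ hτ).ne')).sub_const (d ^ κ)).const_mul (C * (2 ^ (1 - κ) / κ))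
    refine h1.congr_deriv ?_
    simp only [id]
    field_simp
  have hbound : ∀ τ ∈ Ico 0 δ, ‖f' ((1 - τ : ℝ) * z) * (-z)‖ ≤
      C * 2 ^ (1 - κ) * (d + τ) ^ (κ - 1) := by
    intro τ hτ
    have hτ' := Ico_subset_Icc_self hτ
    have h1 := hb _ (hmem τ hτ')
    rw [norm_mul, norm_neg]
    have h2 : ‖f' ((1 - τ : ℝ) * z)‖ * ‖z‖ ≤ ‖f' ((1 - τ : ℝ) * z)‖ :=
      mul_le_of_le_one_right (norm_nonneg _) hz'.le
    refine (h2.trans h1).trans ?_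
    rw [mul_assoc]
    gcongr
    have e : 2 ^ (1 - κ) * (d + τ) ^ (κ - 1) = ((d + τ) / 2) ^ (κ - 1) := by
      rw [Real.div_rpow (hdd τ hτ').le (by norm_num), show 1 - κ = -(κ - 1) by ring,
        Real.rpow_neg (by norm_num)]
      field_simp
    rw [e]
    apply Real.rpow_le_rpow_of_nonpos (by linarith [hdd τ hτ']) _ (by linarith)
    rw [norm_mul, norm_real, Real.norm_eq_abs, abs_of_nonneg (by linarith [hτ.2])]
    have : ‖z‖ = 1 - d := by rw [hd]; ring
    have hd1 : 0 ≤ 1 - d := this ▸ norm_nonneg z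
    rw [this]
    nlinarith [mul_nonneg hτ.1 hd1, mul_nonneg hd0.le (show 0 ≤ 1 - τ by linarith [hτ.2])]
  have := image_norm_le_of_norm_deriv_right_le_deriv_boundary'
    (fun τ hτ => (hder τ hτ).continuousAt.continuousWithinAt)
    (fun τ hτ => (hder τ (Ico_subset_Icc_self hτ)).hasDerivWithinAt)
    (by simp)
    (fun τ hτ => (hB τ hτ).continuousAt.continuousWithinAt)
    (fun τ hτ => (hB τ (Ico_subset_Icc_self hτ)).hasDerivWithinAt) hbound
    (right_mem_Icc.2 hδ0)
  refine this.trans ?_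
  gcongr
  have := Real.rpow_add_le_add_rpow hd0.le hδ0 hκ.le hκ1
  linarith

/-- **Hardy–Littlewood**: growth of the derivative implies Hölder continuity. -/
theorem HolBd.of_deriv {f f' : ℂ → ℂ} {κ C : ℝ} (hκ : 0 < κ) (hκ1 : κ ≤ 1) (hC : 0 ≤ C)
    (hf : ∀ z ∈ ball (0 : ℂ) 1, HasDerivAt f (f' z) z)
    (hb : ∀ z ∈ ball (0 : ℂ) 1, ‖f' z‖ ≤ C * (1 - ‖z‖) ^ (κ - 1)) :
    HolBd κ (C * (2 * (2 ^ (1 - κ) / κ) + 1)) f (ball (0 : ℂ) 1) := by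
  intro x hx y hy
  rcases eq_or_ne x y with rfl | hxy
  · simp [Real.zero_rpow hκ.ne']
  have hxy0 : 0 < ‖x - y‖ := norm_pos_iff.2 (sub_ne_zero.2 hxy)
  have hx' : ‖x‖ < 1 := by simpa using hx
  have hy' : ‖y‖ < 1 := by simpa using hy
  set δ := min ‖x - y‖ 1 with hδ
  have hδ0 : 0 < δ := lt_min hxy0 one_pos
  have hδ1 : δ ≤ 1 := min_le_right _ _
  have h1 := radial_estimate hκ hκ1 hC hf hb hx hδ0.le hδ1
  have h2 := radial_estimate hκ hκ1 hC hf hb hy hδ0.le hδ1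
  have hsub : ∀ z ∈ closedBall (0 : ℂ) (1 - δ), z ∈ ball (0 : ℂ) 1 := by
    intro z hz
    rw [mem_closedBall_zero_iff] at hz
    rw [mem_ball_zero_iff]; linarith
  have hmem : ∀ z ∈ ball (0 : ℂ) 1, ((1 - δ : ℝ) : ℂ) * z ∈ closedBall (0 : ℂ) (1 - δ) := by
    intro z hz
    rw [mem_ball_zero_iff] at hz
    rw [mem_closedBall_zero_iff, norm_mul, norm_real, Real.norm_eq_abs,
      abs_of_nonneg (by linarith)]
    exact mul_le_of_le_one_right (by linarith) hz.le
  have h3 : ‖f ((1 - δ : ℝ) * x) - f ((1 - δ : ℝ) * y)‖ ≤ C * δ ^ κ := by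
    have := (convex_closedBall (0 : ℂ) (1 - δ)).norm_image_sub_le_of_norm_hasDerivWithin_le
      (f := f) (f' := f') (C := C * δ ^ (κ - 1))
      (fun z hz => (hf z (hsub z hz)).hasDerivWithinAt)
      (fun z hz => (hb z (hsub z hz)).trans ?_) (hmem y hy) (hmem x hx)
    · refine this.trans ?_
      rw [mul_assoc]
      gcongr
      rw [← mul_sub, norm_mul, norm_real, Real.norm_eq_abs, abs_of_nonneg (by linarith)]
      have h4 : (1 - δ) * ‖x - y‖ ≤ δ := by
        rcases le_total ‖x - y‖ 1 with h | h
        · rw [hδ, min_eq_left h]; nlinarith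
        · rw [hδ, min_eq_right h]; simp
      calc δ ^ (κ - 1) * ((1 - δ) * ‖x - y‖) ≤ δ ^ (κ - 1) * δ := by gcongr
        _ = δ ^ κ := by rw [Real.rpow_sub_one hδ0.ne']; field_simp
    · gcongr 1
      apply Real.rpow_le_rpow_of_nonpos hδ0 _ (by linarith)
      rw [mem_closedBall_zero_iff] at hz; linarith
  have h5 : δ ^ κ ≤ ‖x - y‖ ^ κ := Real.rpow_le_rpow hδ0.le (min_le_left _ _) hκ.le
  have h6 : ‖f x - f y‖ ≤ ‖f ((1 - δ : ℝ) * x) - f x‖ +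
      ‖f ((1 - δ : ℝ) * x) - f ((1 - δ : ℝ) * y)‖ +
      ‖f ((1 - δ : ℝ) * y) - f y‖ := by
    have e : f x - f y = -(f ((1 - δ : ℝ) * x) - f x) +
        (f ((1 - δ : ℝ) * x) - f ((1 - δ : ℝ) * y)) +
      (f ((1 - δ : ℝ) * y) - f y) := by ring
    rw [e]
    refine (norm_add₃_le).trans ?_
    rw [norm_neg]
  calc ‖f x - f y‖ ≤ C * (2 * (2 ^ (1 - κ) / κ) + 1) * δ ^ κ := by
        refine h6.trans ?_
        calc _ ≤ C * (2 ^ (1 - κ) / κ) * δ ^ κ + C * δ ^ κ + C * (2 ^ (1 - κ) / κ) * δ ^ κ := by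
              gcongr
          _ = _ := by ring
    _ ≤ _ := by gcongr

/-- The sequence of radii used to approach the boundary. -/
theorem tendsto_radius_mul (z : ℂ) : Filter.Tendsto (fun n : ℕ => ((1 - 1 / ((n : ℝ) +
    1) : ℝ) : ℂ) * z)
    Filter.atTop (nhds z) := by
  have h := (tendsto_one_div_add_atTop_nhds_zero_nat (𝕜 := ℝ)).const_sub 1
  have h2 := ((continuous_ofReal.tendsto _).comp h).mul_const z
  simpa using h2

theorem radius_mul_mem {z : ℂ} (hz : z ∈ closedBall (0 : ℂ) 1) (n : ℕ) :
    ((1 - 1 / ((n : ℝ) + 1) : ℝ) : ℂ) * z ∈ ball (0 : ℂ) 1 := by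
  rw [mem_closedBall_zero_iff] at hz
  have h1 : 0 < 1 / ((n : ℝ) + 1) := by positivity
  have h2 : 1 / ((n : ℝ) + 1) ≤ 1 := by
    rw [div_le_one (by positivity)]; linarith [Nat.cast_nonneg (α := ℝ) n]
  rw [mem_ball_zero_iff, norm_mul, norm_real, Real.norm_eq_abs, abs_of_nonneg (by linarith)]
  nlinarith [norm_nonneg z]

theorem HolBd.closedBall {V : Type*} [NormedAddCommGroup V] {κ C : ℝ} {f : ℂ → V} (hκ : 0 < κ)
    (h : HolBd κ C f (ball (0 : ℂ) 1)) (hf : ContinuousOn f (closedBall (0 : ℂ) 1)) :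
    HolBd κ C f (closedBall (0 : ℂ) 1) := by
  intro x hx y hy
  have hl : ∀ z ∈ Metric.closedBall (0 : ℂ) 1, Filter.Tendsto
      (fun n : ℕ => f (((1 - 1 / ((n : ℝ) + 1) : ℝ) : ℂ) * z)) Filter.atTop (nhds (f z)) := by
    intro z hz
    refine (hf z hz).tendsto.comp (tendsto_nhdsWithin_iff.2 ⟨tendsto_radius_mul z, ?_⟩)
    exact Filter.Eventually.of_forall fun n => ball_subset_closedBall (radius_mul_mem hz n)
  have h1 := ((hl x hx).sub (hl y hy)).norm
  have h2 := (((tendsto_radius_mul x).sub (tendsto_radius_mul y)).norm.rpow_const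
    (p := κ) (Or.inr hκ.le)).const_mul C
  exact le_of_tendsto_of_tendsto' h1 h2
    fun n => h _ (radius_mul_mem hx n) _ (radius_mul_mem hy n)

theorem HolBd.exists_extension {κ C : ℝ} {f : ℂ → ℂ} (hκ : 0 < κ)
    (h : HolBd κ C f (ball (0 : ℂ) 1)) :
    ∃ g : ℂ → ℂ, EqOn g f (ball (0 : ℂ) 1) ∧ HolBd κ C g (Metric.closedBall (0 : ℂ) 1) := by
  have hlim : ∀ z ∈ Metric.closedBall (0 : ℂ) 1, ∃ l, Filter.Tendsto
      (fun n : ℕ => f (((1 - 1 / ((n : ℝ) + 1) : ℝ) : ℂ) * z)) Filter.atTop (nhds l) := by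
    intro z hz
    apply cauchySeq_tendsto_of_complete
    rw [Metric.cauchySeq_iff']
    intro ε hε
    have hc := (tendsto_radius_mul z).cauchySeq
    have h3 : Filter.Tendsto (fun x : ℝ => C * x ^ κ) (nhdsWithin 0 (Ici 0)) (nhds 0) := by
      have : ContinuousAt (fun x : ℝ => C * x ^ κ) 0 :=
        ContinuousAt.mul continuousAt_const (ContinuousAt.rpow_const (by fun_prop) (Or.inr hκ.le))
      have := this.tendsto
      simp only [Real.zero_rpow hκ.ne', mul_zero] at this
      exact this.mono_left nhdsWithin_le_nhds
    obtain ⟨δ, hδ, hδ'⟩ := Metric.mem_nhdsWithin_iff.1 (h3 (gt_mem_nhds hε))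
    obtain ⟨N, hN⟩ := (Metric.cauchySeq_iff'.1 hc) δ hδ
    refine ⟨N, fun n hn => ?_⟩
    have h4 := hN n hn
    rw [dist_eq_norm] at h4 ⊢
    refine (h _ (radius_mul_mem hz n) _ (radius_mul_mem hz N)).trans_lt ?_
    apply hδ'
    refine ⟨?_, norm_nonneg _⟩
    rw [mem_ball_zero_iff, norm_norm]; exact h4
  choose! g hg using hlim
  have hgf : EqOn g f (ball (0 : ℂ) 1) := by
    intro z hz
    refine tendsto_nhds_unique (hg z (ball_subset_closedBall hz)) ?_
    exact ((h.continuousOn hκ).continuousAt (isOpen_ball.mem_nhds hz)).tendsto.comp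
      (tendsto_radius_mul z)
  refine ⟨g, hgf, ?_⟩
  intro x hx y hy
  have h1 := ((hg x hx).sub (hg y hy)).norm
  have h2 := (((tendsto_radius_mul x).sub (tendsto_radius_mul y)).norm.rpow_const
    (p := κ) (Or.inr hκ.le)).const_mul C
  exact le_of_tendsto_of_tendsto' h1 h2
    fun n => h _ (radius_mul_mem hx n) _ (radius_mul_mem hy n)

theorem norm_circleAverage_le_of_le {V : Type*} [NormedAddCommGroup V] [NormedSpace ℝ V]
    {g : ℂ → V} {h : ℂ → ℝ} (hg : ContinuousOn g (sphere (0 : ℂ) 1))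
    (hh : ContinuousOn h (sphere (0 : ℂ) 1)) (hle : ∀ ζ ∈ sphere (0 : ℂ) 1, ‖g ζ‖ ≤ h ζ) :
    ‖Real.circleAverage g 0 1‖ ≤ Real.circleAverage h 0 1 := by
  have hm : ∀ θ : ℝ, circleMap 0 1 θ ∈ sphere (0 : ℂ) 1 := fun θ =>
    circleMap_mem_sphere 0 zero_le_one θ
  have hgc : Continuous fun θ : ℝ => g (circleMap 0 1 θ) :=
    hg.comp_continuous (continuous_circleMap 0 1) hm
  have hhc : Continuous fun θ : ℝ => h (circleMap 0 1 θ) :=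
    hh.comp_continuous (continuous_circleMap 0 1) hm
  rw [Real.circleAverage_def, Real.circleAverage_def, norm_smul, smul_eq_mul]
  have hpi := Real.pi_pos
  rw [Real.norm_eq_abs, abs_of_pos (by positivity)]
  gcongr
  refine (intervalIntegral.norm_integral_le_integral_norm (by linarith)).trans ?_
  exact intervalIntegral.integral_mono_on (by linarith) (hgc.norm.intervalIntegrable _ _)
    (hhc.intervalIntegrable _ _) fun θ _ => hle _ (hm θ)

theorem sub_ne_zero_of_sphere_ball {w ζ : ℂ} (hw : w ∈ ball (0 : ℂ) 1) (hζ : ζ ∈ sphere (0 : ℂ) 1) :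
    ζ - w ≠ 0 := by
  rw [mem_ball_zero_iff] at hw
  rw [mem_sphere_zero_iff_norm] at hζ
  intro h
  rw [sub_eq_zero] at h
  rw [h] at hζ; linarith

theorem circleAverage_herglotz_const {v : ℂ} (hv : v ∈ ball (0 : ℂ) 1) (a : ℂ) :
    Real.circleAverage (fun ζ => herglotzRieszKernel 0 v ζ • a) 0 1 = a := by
  have h1 : CircleIntegrable (fun _ : ℂ => a) 0 1 := circleIntegrable_const _ _ _
  have h3 : Real.circleAverage (fun ζ : ℂ => ((ζ - 0) / (ζ - v)) • a) 0 1 = a :=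
    circleAverage_sub_sub_inv_smul_of_differentiable_on_off_countable (f := fun _ => a)
      countable_empty continuousOn_const (fun _ _ => differentiableAt_const _) (by simpa using hv)
  have hc : ContinuousOn (fun ζ : ℂ => ((ζ - 0) / (ζ - v)) • a) (sphere (0 : ℂ) |1|) := by
    rw [abs_one]
    refine ContinuousOn.smul (ContinuousOn.div (by fun_prop) (by fun_prop)
      fun ζ hζ => sub_ne_zero_of_sphere_ball hv hζ) continuousOn_const
  have h4 : Real.circleAverage (fun ζ => herglotzRieszKernel 0 v ζ • a) 0 1 =
      Real.circleAverage (fun ζ : ℂ => (2 : ℝ) • (((ζ - 0) / (ζ - v)) • a) - a) 0 1 := by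
    apply Real.circleAverage_congr_sphere
    intro ζ hζ
    rw [abs_one] at hζ
    have := sub_ne_zero_of_sphere_ball hv hζ
    simp only [herglotzRieszKernel, sub_zero, smul_eq_mul, real_smul]
    field_simp
    push_cast
    ring
  rw [h4, Real.circleAverage_fun_sub _ h1, Real.circleAverage_fun_smul, h3,
      Real.circleAverage_const]
  · rw [real_smul]; push_cast; ring
  · refine ContinuousOn.circleIntegrable' (hc.const_smul (2 : ℝ))

theorem circleAverage_herglotz_deriv_const {w : ℂ} (hw : w ∈ ball (0 : ℂ) 1) (a : ℂ) :
    Real.circleAverage (fun ζ => (2 * ζ / (ζ - w) ^ 2) • a) 0 1 = 0 := by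
  have h2 := hasDerivAt_circleAverage_herglotzRieszKernel_smul
    (circleIntegrable_const a 0 1) hw
  refine h2.unique ((hasDerivAt_const w a).congr_of_eventuallyEq ?_)
  filter_upwards [isOpen_ball.mem_nhds hw] with v hv using circleAverage_herglotz_const hv a

/-- The Schwarz (Herglotz) transform of Hölder boundary data is Hölder on the closed disk. -/
theorem exists_schwarz {κ C : ℝ} (hκ : 0 < κ) (hκ1 : κ < 1) {u : ℂ → ℝ}
    (hu : HolBd κ C u (sphere (0 : ℂ) 1)) :
    ∃ (f : ℂ → ℂ) (C' : ℝ), DifferentiableOn ℂ f (ball (0 : ℂ) 1) ∧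
      HolBd κ C' f (closedBall (0 : ℂ) 1) ∧ ∀ l ∈ sphere (0 : ℂ) 1, (f l).re = u l := by
  replace hu := hu.mono (le_abs_self C)
  set B := |C| with hB
  have hB0 : 0 ≤ B := abs_nonneg _
  obtain ⟨K, hK0, hK⟩ := exists_circleAverage_rpow_le hκ1
  have huc : ContinuousOn u (sphere (0 : ℂ) 1) := hu.continuousOn hκ
  have hui : CircleIntegrable u 0 1 := huc.circleIntegrable zero_le_one
  have hucc : ContinuousOn (fun ζ => (u ζ : ℂ)) (sphere (0 : ℂ) 1) :=
    continuous_ofReal.comp_continuousOn huc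
  have huci : CircleIntegrable (fun ζ => (u ζ : ℂ)) 0 1 := hucc.circleIntegrable zero_le_one
  set f : ℂ → ℂ := fun w => Real.circleAverage (fun ζ => herglotzRieszKernel 0 w ζ • (u ζ : ℂ)) 0 1
    with hf
  set f' : ℂ → ℂ := fun w => Real.circleAverage (fun ζ => (2 * ζ / (ζ - w) ^ 2) • (u ζ : ℂ)) 0 1
    with hf'
  have hder : ∀ w ∈ ball (0 : ℂ) 1, HasDerivAt f (f' w) w := fun w hw =>
    hasDerivAt_circleAverage_herglotzRieszKernel_smul huci hw
  have hrp : ∀ w ∈ ball (0 : ℂ) 1, ∀ p : ℝ,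
      ContinuousOn (fun ζ : ℂ => ‖ζ - w‖ ^ p) (sphere (0 : ℂ) 1) := fun w hw p =>
    ContinuousOn.rpow_const (by fun_prop) fun ζ hζ =>
      Or.inl (norm_ne_zero_iff.2 (sub_ne_zero_of_sphere_ball hw hζ))
  have hdist : ∀ w ∈ ball (0 : ℂ) 1, ∀ v ∈ sphere (0 : ℂ) 1, w = ‖w‖ * v → ‖w - v‖ = 1 - ‖w‖ := by
    intro w hw v hv hwv
    rw [mem_ball_zero_iff] at hw
    rw [mem_sphere_zero_iff_norm] at hv
    have : w - v = ((‖w‖ - 1 : ℝ) : ℂ) * v := by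
      push_cast
      rw [sub_mul, one_mul, ← hwv]
    rw [this, norm_mul, hv, norm_real, Real.norm_eq_abs, abs_of_nonpos (by linarith)]
    ring
  have hcmp : ∀ w ∈ ball (0 : ℂ) 1, ∀ v ∈ sphere (0 : ℂ) 1, w = ‖w‖ * v →
      ∀ ζ ∈ sphere (0 : ℂ) 1, |u ζ - u v| ≤ B * (2 : ℝ) ^ κ * ‖ζ - w‖ ^ κ := by
    intro w hw v hv hwv ζ hζ
    have hd := hdist w hw v hv hwv
    refine (hu ζ hζ _ hv).trans ?_
    rw [mul_assoc, ← Real.mul_rpow (by norm_num) (norm_nonneg _)]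
    gcongr
    have h1 := norm_add_le (ζ - w) (w - v)
    rw [hd, sub_add_sub_cancel] at h1
    have h2 := norm_sub_norm_le ζ w
    rw [mem_sphere_zero_iff_norm] at hζ
    linarith
  have hbd : ∀ w ∈ ball (0 : ℂ) 1, ‖f' w‖ ≤ (2 * B * 2 ^ κ * K) * (1 - ‖w‖) ^ (κ - 1) := by
    intro w hw
    obtain ⟨v, hv, hwv⟩ : ∃ v ∈ sphere (0 : ℂ) 1, w = ‖w‖ * v :=
      ⟨exp (w.arg * I), by rw [mem_sphere_zero_iff_norm, norm_exp_ofReal_mul_I],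
        (norm_mul_exp_arg_mul_I w).symm⟩
    have huv := hcmp w hw v hv hwv
    have hkc : ∀ g : ℂ → ℂ, ContinuousOn g (sphere (0 : ℂ) 1) →
        ContinuousOn (fun ζ : ℂ => (2 * ζ / (ζ - w) ^ 2) • g ζ) (sphere (0 : ℂ) 1) := by
      intro g hg
      refine ContinuousOn.smul (ContinuousOn.div (f := fun ζ => 2 * ζ) (g := fun ζ => (ζ - w) ^ 2)
        (by fun_prop) (by fun_prop) fun ζ hζ => ?_) hg
      exact pow_ne_zero 2 (sub_ne_zero_of_sphere_ball hw hζ)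
    have e1 : f' w = Real.circleAverage
        (fun ζ => (2 * ζ / (ζ - w) ^ 2) • ((u ζ : ℂ) - (u v : ℂ))) 0 1 := by
      simp only [smul_sub]
      rw [Real.circleAverage_fun_sub, circleAverage_herglotz_deriv_const hw, sub_zero]
      · exact (hkc _ hucc).circleIntegrable zero_le_one
      · exact (hkc _ continuousOn_const).circleIntegrable zero_le_one
    have e2 := norm_circleAverage_le_of_le (h := fun ζ => (2 * B * 2 ^ κ) • ‖ζ - w‖ ^ (κ - 2))
      (hkc (fun ζ => (u ζ : ℂ) - (u v : ℂ)) (hucc.sub continuousOn_const))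
      (ContinuousOn.const_smul (hrp w hw _) (2 * B * 2 ^ κ)) (by
        intro ζ hζ
        have h0 := norm_pos_iff.2 (sub_ne_zero_of_sphere_ball hw hζ)
        have h1 := huv ζ hζ
        rw [← ofReal_sub, norm_smul, norm_real, norm_div, norm_mul, norm_pow, Real.norm_eq_abs]
        rw [mem_sphere_zero_iff_norm.1 hζ, smul_eq_mul, Real.rpow_sub h0, Real.rpow_two]
        calc _ ≤ ‖(2 : ℂ)‖ * 1 / ‖ζ - w‖ ^ 2 * (B * (2 : ℝ) ^ κ * ‖ζ - w‖ ^ κ) := by gcongr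
          _ = _ := by simp only [Complex.norm_ofNat]; ring)
    rw [Real.circleAverage_fun_smul, smul_eq_mul] at e2
    rw [e1]
    refine e2.trans ?_
    rw [mul_assoc _ K]
    exact mul_le_mul_of_nonneg_left (hK w hw) (by positivity)
  have hH := HolBd.of_deriv hκ hκ1.le (by positivity) hder hbd
  obtain ⟨g, hgf, hg⟩ := hH.exists_extension hκ
  refine ⟨g, _, ?_, hg, ?_⟩
  · exact DifferentiableOn.congr
      (fun w hw => (hder w hw).differentiableAt.differentiableWithinAt) hgf
  have hre : ∀ w ∈ ball (0 : ℂ) 1, ∀ v ∈ sphere (0 : ℂ) 1, w = ‖w‖ * v →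
      |(f w).re - u v| ≤ (2 * B * 2 ^ κ * K) * (1 - ‖w‖) ^ κ := by
    intro w hw v hv hwv
    have huv := hcmp w hw v hv hwv
    have hkc : ContinuousOn (fun ζ => herglotzRieszKernel 0 w ζ) (sphere (0 : ℂ) 1) := by
      simpa only [abs_one] using continuousOn_herglotzRieszKernel_sphere hw
    have e1 : f w - u v = Real.circleAverage
        (fun ζ => herglotzRieszKernel 0 w ζ • ((u ζ - u v : ℝ) : ℂ)) 0 1 := by
      simp only [ofReal_sub, smul_sub]
      rw [Real.circleAverage_fun_sub, circleAverage_herglotz_const hw]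
      · exact (hkc.smul hucc).circleIntegrable zero_le_one
      · exact (hkc.smul continuousOn_const).circleIntegrable zero_le_one
    have e2 := re_circleAverage_herglotzRieszKernel_smul
      (g := fun ζ => u ζ - u v) ((huc.sub continuousOn_const).circleIntegrable zero_le_one) hw
    rw [← e1, ← poissonKernel_eq_re_herglotzRieszKernel, sub_re, ofReal_re] at e2
    rw [e2, ← Real.norm_eq_abs]
    have hw1 : ‖w‖ < 1 := by simpa using hw
    have e3 := norm_circleAverage_le_of_le
      (h := fun ζ => ((1 - ‖w‖ ^ 2) * (B * 2 ^ κ)) • ‖ζ - w‖ ^ (κ - 2))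
      (g := poissonKernel 0 w • fun ζ => u ζ - u v) (by
        rw [poissonKernel_eq_re_herglotzRieszKernel]
        exact (continuous_re.comp_continuousOn hkc).smul (huc.sub continuousOn_const))
      (ContinuousOn.const_smul (hrp w hw _) ((1 - ‖w‖ ^ 2) * (B * 2 ^ κ))) (by
        intro ζ hζ
        have h0 := norm_pos_iff.2 (sub_ne_zero_of_sphere_ball hw hζ)
        have h1 := huv ζ hζ
        have h2 : 0 ≤ 1 - ‖w‖ ^ 2 := by nlinarith [norm_nonneg w]
        rw [Pi.smul_apply', norm_smul, poissonKernel, sub_zero, sub_zero,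
            mem_sphere_zero_iff_norm.1 hζ,
          Real.norm_eq_abs, Real.norm_eq_abs, one_pow, abs_of_nonneg (by positivity), smul_eq_mul,
          Real.rpow_sub h0, Real.rpow_two]
        calc _ ≤ (1 - ‖w‖ ^ 2) / ‖ζ - w‖ ^ 2 * (B * (2 : ℝ) ^ κ * ‖ζ - w‖ ^ κ) := by gcongr
          _ = _ := by ring)
    refine e3.trans ?_
    rw [Real.circleAverage_fun_smul, smul_eq_mul]
    have hd0 : 0 < 1 - ‖w‖ := by linarith
    calc (1 - ‖w‖ ^ 2) * (B * 2 ^ κ) * Real.circleAverage (fun ζ => ‖ζ - w‖ ^ (κ - 2)) 0 1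
        ≤ (2 * (1 - ‖w‖)) * (B * 2 ^ κ) * (K * (1 - ‖w‖) ^ (κ - 1)) := by
          have h2 : 1 - ‖w‖ ^ 2 ≤ 2 * (1 - ‖w‖) := by nlinarith [norm_nonneg w]
          have h3 := hK w hw
          have h4 : 0 ≤ K * (1 - ‖w‖) ^ (κ - 1) := by positivity
          have h5 : 0 ≤ 1 - ‖w‖ ^ 2 := by nlinarith [norm_nonneg w]
          calc _ ≤ (1 - ‖w‖ ^ 2) * (B * 2 ^ κ) * (K * (1 - ‖w‖) ^ (κ - 1)) := by gcongr
            _ ≤ _ := by gcongr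
      _ = _ := by rw [Real.rpow_sub_one hd0.ne']; field_simp
  intro l hl
  have hl' := sphere_subset_closedBall hl
  have h1 : Filter.Tendsto (fun n : ℕ => (g (((1 - 1 / ((n : ℝ) + 1) : ℝ) : ℂ) * l)).re)
      Filter.atTop (nhds (g l).re) := by
    refine (continuous_re.tendsto _).comp ?_
    refine ((hg.continuousOn hκ) l hl').tendsto.comp
      (tendsto_nhdsWithin_iff.2 ⟨tendsto_radius_mul l, ?_⟩)
    exact Filter.Eventually.of_forall fun n => ball_subset_closedBall (radius_mul_mem hl' n)
  refine tendsto_nhds_unique h1 ?_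
  rw [tendsto_iff_norm_sub_tendsto_zero]
  have h2 : Filter.Tendsto (fun n : ℕ => (2 * B * 2 ^ κ * K) *
      (1 - ‖((1 - 1 / ((n : ℝ) + 1) : ℝ) : ℂ) * l‖) ^ κ) Filter.atTop (nhds 0) := by
    have := ((((tendsto_radius_mul l).norm.const_sub 1).rpow_const
      (p := κ) (Or.inr hκ.le)).const_mul (2 * B * 2 ^ κ * K))
    rw [mem_sphere_zero_iff_norm.1 hl, sub_self, Real.zero_rpow hκ.ne', mul_zero] at this
    exact this
  refine squeeze_zero (fun _ => norm_nonneg _) (fun n => ?_) h2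
  have hm := radius_mul_mem hl' n
  rw [hgf hm]
  refine hre _ hm l hl ?_
  have h3 : 1 / ((n : ℝ) + 1) ≤ 1 := by
    rw [div_le_one (by positivity)]; linarith [Nat.cast_nonneg (α := ℝ) n]
  rw [norm_mul, mem_sphere_zero_iff_norm.1 hl, mul_one, norm_real, Real.norm_eq_abs,
    abs_of_nonneg (by linarith)]

/-- Twice the Wirtinger derivative of `R` in the second variable. -/
def gradN (R : ℂ × ℂ → ℝ) (p : ℂ × ℂ) : ℂ :=
  (fderiv ℝ R p (0, 1) : ℂ) - I * (fderiv ℝ R p (0, I) : ℂ)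

theorem fderiv_snd_eq (R : ℂ × ℂ → ℝ) (p : ℂ × ℂ) (h : ℂ) :
    fderiv ℝ R p (0, h) = (gradN R p * h).re := by
  have e : ((0 : ℂ), h) = h.re • ((0 : ℂ), (1 : ℂ)) + h.im • ((0 : ℂ), I) := by
    ext <;> simp
  conv_lhs => rw [e, map_add, map_smul, map_smul]
  simp [gradN]
  ring

/-- A defining function in logarithmic coordinates. -/
structure LogData (R : ℂ × ℂ → ℝ) : Prop where
  smooth : ContDiff ℝ 3 R
  periodic : ∀ l ζ, R (l, ζ + 2 * Real.pi * I) = R (l, ζ)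
  grad : ∀ l ∈ sphere (0 : ℂ) 1, ∀ ζ, gradN R (l, ζ) ≠ 0
  top : ∀ T, ∃ M, ∀ l ∈ sphere (0 : ℂ) 1, ∀ ζ : ℂ, M ≤ ζ.re → T < R (l, ζ)
  bot : ∀ T, ∃ M, ∀ l ∈ sphere (0 : ℂ) 1, ∀ ζ : ℂ, ζ.re ≤ -M → R (l, ζ) < T

/-- `f` is a holomorphic disk with boundary on the level `t` of `R`. -/
def Sol (R : ℂ × ℂ → ℝ) (t : ℝ) (f : ℂ → ℂ) : Prop :=
  (ContinuousOn f (closedBall (0 : ℂ) 1) ∧ DifferentiableOn ℂ f (ball (0 : ℂ) 1)) ∧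
    ∀ l ∈ sphere (0 : ℂ) 1, R (l, f l) = t

variable {R : ℂ × ℂ → ℝ}

theorem contDiff_gradN (hR : LogData R) : ContDiff ℝ 2 (gradN R) := by
  have h1 : ContDiff ℝ 2 (fderiv ℝ R) := hR.smooth.fderiv_right (by norm_num)
  unfold gradN
  have h2 : ∀ v : ℂ × ℂ, ContDiff ℝ 2 (fun p => ((fderiv ℝ R p v : ℝ) : ℂ)) := fun v =>
    ofRealCLM.contDiff.comp (h1.clm_apply contDiff_const)
  exact (h2 _).sub (contDiff_const.mul (h2 _))

theorem LogData.hasFDerivAt (hR : LogData R) (p : ℂ × ℂ) : HasFDerivAt R (fderiv ℝ R p) p :=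
  (hR.smooth.differentiable (by norm_num) p).hasFDerivAt

theorem gradN_periodic (hR : LogData R) (l ζ : ℂ) :
    gradN R (l, ζ + 2 * Real.pi * I) = gradN R (l, ζ) := by
  have h : (fun p : ℂ × ℂ => R (p + (0, 2 * Real.pi * I))) = R := by
    ext ⟨a, b⟩; simpa using hR.periodic a b
  have h2 : fderiv ℝ R ((l, ζ) + (0, 2 * Real.pi * I)) = fderiv ℝ R (l, ζ) := by
    rw [← fderiv_comp_add_right, h]
  unfold gradN
  rw [Prod.mk_add_mk, add_zero] at h2
  rw [h2]

theorem periodic_int {X : Type*} {g : ℂ → X} (hg : ∀ ζ, g (ζ + 2 * Real.pi * I) = g ζ) (k : ℤ)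
    (ζ : ℂ) : g (ζ + k * (2 * Real.pi * I)) = g ζ := by
  have : Function.Periodic g (2 * Real.pi * I) := hg
  exact this.int_mul k ζ

/-- Translating by a period, one can arrange the imaginary part to be in `[-π, π]`. -/
theorem exists_period_shift (ζ : ℂ) : ∃ k : ℤ, |(ζ + k * (2 * Real.pi * I)).im| ≤ Real.pi := by
  have hpi := Real.pi_pos
  refine ⟨-round (ζ.im / (2 * Real.pi)), ?_⟩
  have h := abs_sub_round (ζ.im / (2 * Real.pi))
  have e : (ζ + ((-round (ζ.im / (2 * Real.pi)) : ℤ) : ℂ) * (2 * Real.pi * I)).im =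
      (2 * Real.pi) * (ζ.im / (2 * Real.pi) - round (ζ.im / (2 * Real.pi))) := by
    simp
    field_simp
    ring
  rw [e, abs_mul, abs_of_pos (by positivity)]
  nlinarith

theorem exists_period_shift_re (ζ : ℂ) (k : ℤ) : (ζ + k * (2 * Real.pi * I)).re = ζ.re := by
  simp

/-- The compact rectangle. -/
def rect (M L : ℝ) : Set ℂ := Icc (-M) M ×ℂ Icc (-L) L

theorem isCompact_rect (M L : ℝ) : IsCompact (rect M L) := isCompact_Icc.reProdIm isCompact_Icc

theorem mem_rect {M L : ℝ} {z : ℂ} : z ∈ rect M L ↔ |z.re| ≤ M ∧ |z.im| ≤ L := by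
  rw [rect, mem_reProdIm, mem_Icc, mem_Icc, abs_le, abs_le]

/-- Projection to a vertical band. -/
def clampRe (M : ℝ) (ζ : ℂ) : ℂ := (max (-M) (min M ζ.re) : ℝ) + ζ.im * I

theorem clampRe_re (M : ℝ) (ζ : ℂ) : (clampRe M ζ).re = max (-M) (min M ζ.re) := by simp [clampRe]

theorem clampRe_im (M : ℝ) (ζ : ℂ) : (clampRe M ζ).im = ζ.im := by simp [clampRe]

theorem clampRe_of_abs_le {M : ℝ} {ζ : ℂ} (h : |ζ.re| ≤ M) : clampRe M ζ = ζ := by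
  rw [abs_le] at h
  apply Complex.ext
  · rw [clampRe_re, min_eq_right h.2, max_eq_right h.1]
  · rw [clampRe_im]

theorem abs_clampRe_re_le {M : ℝ} (hM : 0 ≤ M) (ζ : ℂ) : |(clampRe M ζ).re| ≤ M := by
  rw [clampRe_re, abs_le]
  exact ⟨le_max_left _ _, max_le (by linarith) (min_le_left _ _)⟩

theorem lipschitzWith_clampRe (M : ℝ) : LipschitzWith 1 (clampRe M) := by
  refine LipschitzWith.of_dist_le_mul fun x y => ?_
  rw [NNReal.coe_one, one_mul, dist_eq_norm, dist_eq_norm, Complex.norm_eq_sqrt_sq_add_sq,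
    Complex.norm_eq_sqrt_sq_add_sq]
  apply Real.sqrt_le_sqrt
  rw [sub_im, sub_im, clampRe_im, clampRe_im, sub_re, sub_re, clampRe_re, clampRe_re]
  gcongr 1
  apply sq_le_sq.2
  calc _ ≤ |min M x.re - min M y.re| := by
        have := abs_max_sub_max_le_max (-M) (min M x.re) (-M) (min M y.re)
        simpa using this
    _ ≤ _ := by
        have := abs_min_sub_min_le_max M x.re M y.re
        simpa using this

/-- The clamped flow field is bounded and globally Lipschitz. -/
theorem clamped_field (hR : LogData R) {l : ℂ} (hl : l ∈ sphere (0 : ℂ) 1) {M : ℝ} (hM : 0 ≤ M) :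
    ∃ K L : NNReal, LipschitzWith K (fun ζ => (gradN R (l, clampRe M ζ))⁻¹) ∧
      ∀ ζ, ‖(gradN R (l, clampRe M ζ))⁻¹‖ ≤ L := by
  set V : ℂ → ℂ := fun ζ => (gradN R (l, ζ))⁻¹ with hV
  have hVc : ContDiff ℝ 1 V := by
    have : ContDiff ℝ 1 fun ζ : ℂ => gradN R (l, ζ) :=
      ((contDiff_gradN hR).of_le (by norm_num)).comp (contDiff_const.prodMk contDiff_id)
    exact this.inv fun ζ => hR.grad l hl ζ
  have hVp : ∀ ζ, V (ζ + 2 * Real.pi * I) = V ζ := fun ζ => by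
    simp only [hV, gradN_periodic hR]
  have hVp' : ∀ ζ, fderiv ℝ V (ζ + 2 * Real.pi * I) = fderiv ℝ V ζ := fun ζ => by
    rw [← fderiv_comp_add_right]; simp_rw [hVp]
  have hcV := hVc.continuous
  have hcV' : Continuous (fderiv ℝ V) := hVc.continuous_fderiv (by norm_num)
  obtain ⟨L, hL⟩ := (isCompact_rect M Real.pi).exists_bound_of_continuousOn hcV.continuousOn
  obtain ⟨K, hK⟩ := (isCompact_rect M Real.pi).exists_bound_of_continuousOn hcV'.continuousOn
  have hL' : ∀ ζ : ℂ, |ζ.re| ≤ M → ‖V ζ‖ ≤ L := by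
    intro ζ h
    obtain ⟨k, hk⟩ := exists_period_shift ζ
    have := hL _ (mem_rect.2 ⟨by rwa [exists_period_shift_re], hk⟩)
    rwa [periodic_int hVp] at this
  have hK' : ∀ ζ : ℂ, |ζ.re| ≤ M → ‖fderiv ℝ V ζ‖ ≤ K := by
    intro ζ h
    obtain ⟨k, hk⟩ := exists_period_shift ζ
    have := hK _ (mem_rect.2 ⟨by rwa [exists_period_shift_re], hk⟩)
    rwa [periodic_int hVp'] at this
  have hconv : Convex ℝ {ζ : ℂ | |ζ.re| ≤ M} := by
    have : {ζ : ℂ | |ζ.re| ≤ M} = reCLM ⁻¹' (Icc (-M) M) := by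
      ext ζ; simp [abs_le]
    rw [this]
    exact (convex_Icc _ _).is_linear_preimage reLm.isLinear
  have hlip : LipschitzOnWith K.toNNReal V {ζ : ℂ | |ζ.re| ≤ M} := by
    refine hconv.lipschitzOnWith_of_nnnorm_fderiv_le (𝕜 := ℝ)
      (fun ζ _ => hVc.differentiable (by norm_num) ζ) fun ζ hζ => ?_
    rw [← NNReal.coe_le_coe, coe_nnnorm]
    exact (hK' ζ hζ).trans (Real.le_coe_toNNReal _)
  refine ⟨K.toNNReal, L.toNNReal, ?_, fun ζ => ?_⟩
  · have := hlip.comp ((lipschitzWith_clampRe M).lipschitzOnWith (s := univ))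
      (fun ζ _ => abs_clampRe_re_le hM ζ)
    rw [mul_one] at this
    exact lipschitzOnWith_univ.1 this
  · exact (hL' _ (abs_clampRe_re_le hM ζ)).trans (Real.le_coe_toNNReal _)

theorem exists_band (hR : LogData R) (T : ℝ) :
    ∃ M, 0 ≤ M ∧ ∀ l ∈ sphere (0 : ℂ) 1, ∀ ζ : ℂ, |R (l, ζ)| ≤ T → |ζ.re| < M := by
  obtain ⟨M1, h1⟩ := hR.top T
  obtain ⟨M2, h2⟩ := hR.bot (-T)
  refine ⟨max 0 (max M1 M2), le_max_left _ _, fun l hl ζ h => ?_⟩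
  rw [abs_le] at h
  rw [abs_lt]
  constructor
  · by_contra! h3
    have := h2 l hl ζ (h3.trans (by simp))
    linarith
  · by_contra! h3
    have := h1 l hl ζ (le_trans (by simp) h3)
    linarith

/-- A trajectory of `1 / gradN R` normalised so that `R` is the time. -/
def IsFlowLine (R : ℂ × ℂ → ℝ) (l : ℂ) (s : Set ℝ) (γ : ℝ → ℂ) : Prop :=
  ∀ x ∈ s, HasDerivAt γ (gradN R (l, γ x))⁻¹ x ∧ R (l, γ x) = x

theorem IsFlowLine.mono {l : ℂ} {s t : Set ℝ} {γ : ℝ → ℂ} (h : IsFlowLine R l t γ) (hst : s ⊆ t) :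
    IsFlowLine R l s γ := fun x hx => h x (hst hx)

theorem abs_lt_of_mem_Ioo {n x : ℝ} (h : x ∈ Ioo (-n) n) : |x| < n := abs_lt.2 ⟨h.1, h.2⟩

theorem IsFlowLine.eqOn (hR : LogData R) {l : ℂ} (hl : l ∈ sphere (0 : ℂ) 1) {n t : ℝ}
    {γ₁ γ₂ : ℝ → ℂ} (h1 : IsFlowLine R l (Ioo (-n) n) γ₁) (h2 : IsFlowLine R l (Ioo (-n) n) γ₂)
    (ht : t ∈ Ioo (-n) n) (h : γ₁ t = γ₂ t) : EqOn γ₁ γ₂ (Ioo (-n) n) := by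
  obtain ⟨M, hM, hb⟩ := exists_band hR n
  obtain ⟨K, L, hK, -⟩ := clamped_field hR hl hM
  have key : ∀ γ, IsFlowLine R l (Ioo (-n) n) γ → ∀ x ∈ Ioo (-n) n,
      HasDerivAt γ ((fun (_ : ℝ) ζ => (gradN R (l, clampRe M ζ))⁻¹) x (γ x)) x ∧ γ x ∈ univ := by
    intro γ hγ x hx
    have h3 := hb l hl (γ x) (by rw [(hγ x hx).2]; exact (abs_lt_of_mem_Ioo hx).le)
    refine ⟨?_, mem_univ _⟩
    simp only
    rw [clampRe_of_abs_le h3.le]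
    exact (hγ x hx).1
  exact ODE_solution_unique_of_mem_Ioo (s := fun _ => univ) (fun _ _ => hK.lipschitzOnWith) ht
    (key _ h1) (key _ h2) h

theorem LogData.hasDerivAt_comp (hR : LogData R) {l : ℂ} {γ : ℝ → ℂ} {v : ℂ} {x : ℝ}
    (h : HasDerivAt γ v x) :
    HasDerivAt (fun x => R (l, γ x)) (gradN R (l, γ x) * v).re x := by
  have := (hR.hasFDerivAt (l, γ x)).comp_hasDerivAt x ((hasDerivAt_const x l).prodMk h)
  rwa [fderiv_snd_eq] at this

theorem exists_local_flow (hR : LogData R) {l : ℂ} (hl : l ∈ sphere (0 : ℂ) 1) (n : ℝ) :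
    ∃ ψ : ℂ → ℝ → ℂ,
      ContinuousOn (fun p : ℂ × ℝ => ψ p.1 p.2) {p | ‖p.1‖ < n ∧ |R (l, p.1)| < n ∧ |p.2| < n} ∧
      ∀ ζ, ‖ζ‖ < n → |R (l, ζ)| < n →
        ψ ζ (R (l, ζ)) = ζ ∧ IsFlowLine R l (Ioo (-n) n) (ψ ζ) := by
  rcases le_or_gt n 0 with hn | hn
  · refine ⟨fun _ _ => 0, continuousOn_const, fun ζ h => ?_⟩
    exact absurd (h.trans_le hn) (not_lt.2 (norm_nonneg _))
  obtain ⟨M, hM, hb⟩ := exists_band hR n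
  obtain ⟨K, L, hK, hL⟩ := clamped_field hR hl hM
  set V : ℂ → ℂ := fun ζ => (gradN R (l, clampRe M ζ))⁻¹ with hV
  have h0 : (0 : ℝ) ∈ Icc (-(2 * n)) (2 * n) := ⟨by linarith, by linarith⟩
  have hPL : IsPicardLindelof (fun _ => V) (⟨0, h0⟩ : Icc (-(2 * n)) (2 * n)) 0
      (n.toNNReal + L * (2 * n).toNNReal) n.toNNReal L K := by
    refine ⟨fun _ _ => hK.lipschitzOnWith, fun _ _ => continuousOn_const, fun _ _ x _ => hL x, ?_⟩
    simp only [sub_zero, zero_sub, neg_neg, max_self, NNReal.coe_add, NNReal.coe_mul]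
    rw [Real.coe_toNNReal _ hn.le, Real.coe_toNNReal _ (by linarith : (0:ℝ) ≤ 2 * n)]
    linarith
  obtain ⟨φ, hφ, hφc⟩ :=
    hPL.exists_forall_mem_closedBall_eq_hasDerivWithinAt_continuousOn
  rw [Real.coe_toNNReal _ hn.le] at hφ hφc
  have hRc := hR.smooth.continuous
  refine ⟨fun ζ s => φ (ζ, s - R (l, ζ)), ?_, fun ζ h1 h2 => ?_⟩
  · refine hφc.comp (f := fun p : ℂ × ℝ => (p.1, p.2 - R (l, p.1))) ?_ ?_
    · exact Continuous.continuousOn (by fun_prop)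
    · rintro ⟨ζ, s⟩ ⟨h1, h2, h3⟩
      simp only [abs_lt] at h1 h2 h3
      exact ⟨by simpa using h1.le, ⟨by linarith, by linarith⟩⟩
  obtain ⟨ha, hd⟩ := hφ ζ (by simpa using h1.le)
  have h2' := abs_lt.1 h2
  have hd' : ∀ s ∈ Ioo (-n) n, HasDerivAt (fun s => φ (ζ, s - R (l, ζ)))
      (V (φ (ζ, s - R (l, ζ)))) s := by
    intro s hs
    have h3 : s - R (l, ζ) ∈ Icc (-(2 * n)) (2 * n) := ⟨by linarith [hs.1], by linarith [hs.2]⟩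
    have h4 := (hd _ h3).hasDerivAt (Icc_mem_nhds (by linarith [hs.1]) (by linarith [hs.2]))
    exact h4.comp_sub_const s (R (l, ζ))
  have hR0 : φ (ζ, R (l, ζ) - R (l, ζ)) = ζ := by rw [sub_self]; exact ha
  refine ⟨hR0, ?_⟩
  set γ : ℝ → ℂ := fun s => φ (ζ, s - R (l, ζ)) with hγ
  have hγc : ContinuousOn γ (Ioo (-n) n) := fun s hs => (hd' s hs).continuousAt.continuousWithinAt
  have hfield : ∀ s ∈ Ioo (-n) n, |(γ s).re| < M → HasDerivAt γ (gradN R (l, γ s))⁻¹ s := by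
    intro s hs h
    have := hd' s hs
    simp only [hV] at this
    rwa [clampRe_of_abs_le h.le] at this
  set U : Set ℝ := {s | s ∈ Ioo (-n) n ∧ R (l, γ s) = s} with hU
  have hUo : IsOpen U := by
    rw [isOpen_iff_mem_nhds]
    rintro s ⟨hs, hs2⟩
    have h3 : |(γ s).re| < M := hb l hl (γ s) (by rw [hs2]; exact (abs_lt_of_mem_Ioo hs).le)
    have h4 : ∀ᶠ x in nhds s, |(γ x).re| < M :=
      (continuous_abs.continuousAt.comp
        (continuous_re.continuousAt.comp (hd' s hs).continuousAt)).eventually_lt continuousAt_const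
            h3
    obtain ⟨δ, hδ, h5⟩ := Metric.eventually_nhds_iff_ball.1
      (h4.and (isOpen_Ioo.mem_nhds hs : ∀ᶠ x in nhds s, x ∈ Ioo (-n) n))
    have hD : ∀ x ∈ ball s δ, HasDerivAt (fun x => R (l, γ x) - x) 0 x := by
      intro x hx
      have h6 := hR.hasDerivAt_comp (l := l) (hfield x (h5 x hx).2 (h5 x hx).1)
      refine (h6.sub (hasDerivAt_id x)).congr_deriv ?_
      rw [mul_inv_cancel₀ (hR.grad l hl _)]; simp
    filter_upwards [ball_mem_nhds s hδ] with x hx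
    have h7 := isOpen_ball.is_const_of_deriv_eq_zero (convex_ball s δ).isPreconnected
      (fun y hy => (hD y hy).differentiableAt.differentiableWithinAt)
      (fun y hy => (hD y hy).deriv) hx (mem_ball_self hδ)
    exact ⟨(h5 x hx).2, by rw [hs2] at h7; linarith⟩
  have hsub : Ioo (-n) n ⊆ U := by
    refine isPreconnected_Ioo.subset_of_closure_inter_subset hUo
      ⟨R (l, ζ), ⟨h2'.1, h2'.2⟩, ⟨h2'.1, h2'.2⟩, by simp only [hγ]; rw [hR0]⟩ ?_
    rintro s ⟨hs, hs2⟩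
    refine ⟨hs2, ?_⟩
    obtain ⟨u, hu, hus⟩ := mem_closure_iff_seq_limit.1 hs
    have h8 : Filter.Tendsto (fun k => R (l, γ (u k))) Filter.atTop (nhds (R (l, γ s))) :=
      (hRc.tendsto _).comp ((continuous_const.prodMk continuous_id).continuousAt.tendsto.comp
        ((hd' s hs2).continuousAt.tendsto.comp hus))
    exact tendsto_nhds_unique h8 (hus.congr fun k => (hu k).2.symm)
  intro s hs
  refine ⟨hfield s hs (hb l hl _ ?_), (hsub hs).2⟩
  rw [(hsub hs).2]; exact (abs_lt_of_mem_Ioo hs).le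

/-- The flow which identifies the level sets of `R (l, ·)`. -/
theorem exists_flow (hR : LogData R) {l : ℂ} (hl : l ∈ sphere (0 : ℂ) 1) :
    ∃ Φ : ℂ → ℝ → ℂ, Continuous (fun p : ℂ × ℝ => Φ p.1 p.2) ∧
      (∀ ζ, Φ ζ (R (l, ζ)) = ζ) ∧ (∀ ζ, IsFlowLine R l univ (Φ ζ)) ∧
      (∀ ζ s s', Φ (Φ ζ s) s' = Φ ζ s') ∧
      ∀ ζ s, Φ (ζ + 2 * Real.pi * I) s = Φ ζ s + 2 * Real.pi * I := by
  choose ψ hψc hψ using exists_local_flow hR hl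
  have hRc := hR.smooth.continuous
  set N : ℂ → ℝ → ℝ := fun ζ s => ‖ζ‖ + |R (l, ζ)| + |s| + 1 with hN
  set Φ : ℂ → ℝ → ℂ := fun ζ s => ψ (N ζ s) ζ s with hΦ
  have h1 : ∀ ζ s, ‖ζ‖ < N ζ s ∧ |R (l, ζ)| < N ζ s ∧ |s| < N ζ s := fun ζ s => by
    simp only [hN]
    refine ⟨?_, ?_, ?_⟩ <;> linarith [norm_nonneg ζ, abs_nonneg (R (l, ζ)), abs_nonneg s]
  have hmono : ∀ {n m : ℝ}, n ≤ m → Ioo (-n) n ⊆ Ioo (-m) m := fun h =>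
    Ioo_subset_Ioo (by linarith) h
  have hcomp0 : ∀ n m ζ s, n ≤ m → ‖ζ‖ < n → |R (l, ζ)| < n → |s| < n → ψ n ζ s = ψ m ζ s := by
    intro n m ζ s hnm h2 h3 h4
    have a := hψ n ζ h2 h3
    have b := hψ m ζ (h2.trans_le hnm) (h3.trans_le hnm)
    exact IsFlowLine.eqOn hR hl a.2 (b.2.mono (hmono hnm)) (abs_lt.1 h3) (a.1.trans b.1.symm)
      (abs_lt.1 h4)
  have hcomp : ∀ n ζ s, ‖ζ‖ < n → |R (l, ζ)| < n → |s| < n → ψ n ζ s = Φ ζ s := by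
    intro n ζ s h2 h3 h4
    rcases le_total n (N ζ s) with h | h
    · exact hcomp0 _ _ _ _ h h2 h3 h4
    · exact (hcomp0 _ _ _ _ h (h1 ζ s).1 (h1 ζ s).2.1 (h1 ζ s).2.2).symm
  have hopen : ∀ n : ℝ, IsOpen {p : ℂ × ℝ | ‖p.1‖ < n ∧ |R (l, p.1)| < n ∧ |p.2| < n} := by
    intro n
    simp only [ofPred_and]
    exact (isOpen_lt (f := fun p : ℂ × ℝ => ‖p.1‖) (by fun_prop) continuous_const).inter
      ((isOpen_lt (f := fun p : ℂ × ℝ => |R (l, p.1)|) (by fun_prop) continuous_const).inter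
        (isOpen_lt (f := fun p : ℂ × ℝ => |p.2|) (by fun_prop) continuous_const))
  have hcont : Continuous (fun p : ℂ × ℝ => Φ p.1 p.2) := by
    rw [continuous_iff_continuousAt]
    rintro ⟨ζ, s⟩
    have h2 := (hopen (N ζ s)).mem_nhds (x := (ζ, s)) (h1 ζ s)
    refine ((hψc (N ζ s)).continuousAt h2).congr ?_
    filter_upwards [h2] with p hp
    exact hcomp _ _ _ hp.1 hp.2.1 hp.2.2
  have hΦ0 : ∀ ζ, Φ ζ (R (l, ζ)) = ζ := fun ζ => (hψ _ ζ (h1 ζ _).1 (h1 ζ _).2.1).1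
  have hflow : ∀ ζ, IsFlowLine R l univ (Φ ζ) := by
    intro ζ s _
    have h2 := h1 ζ s
    have h3 := (hψ _ ζ h2.1 h2.2.1).2 s (abs_lt.1 h2.2.2)
    refine ⟨h3.1.congr_of_eventuallyEq ?_, h3.2⟩
    filter_upwards [isOpen_Ioo.mem_nhds (show s ∈ Ioo (-N ζ s) (N ζ s) from abs_lt.1 h2.2.2)]
      with x hx
    exact (hcomp _ _ _ h2.1 h2.2.1 (abs_lt.2 hx)).symm
  have huniq : ∀ γ₁ γ₂ : ℝ → ℂ, IsFlowLine R l univ γ₁ → IsFlowLine R l univ γ₂ → ∀ t,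
      γ₁ t = γ₂ t → γ₁ = γ₂ := by
    intro γ₁ γ₂ ha hb t ht
    funext s
    have h3 : t ∈ Ioo (-(|t| + |s| + 1)) (|t| + |s| + 1) :=
      abs_lt.1 (by linarith [abs_nonneg s])
    exact IsFlowLine.eqOn hR hl (ha.mono (subset_univ _)) (hb.mono (subset_univ _)) h3 ht
      (abs_lt.1 (by linarith [abs_nonneg t]))
  refine ⟨Φ, hcont, hΦ0, hflow, fun ζ s s' => ?_, fun ζ s => ?_⟩
  · refine congrFun (huniq _ _ (hflow _) (hflow _) s ?_) s'
    have := hΦ0 (Φ ζ s)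
    rwa [(hflow ζ s (mem_univ _)).2] at this
  · refine congrFun (huniq (Φ (ζ + 2 * Real.pi * I)) (fun s => Φ ζ s + 2 * Real.pi * I)
      (hflow _) ?_ (R (l, ζ)) ?_) s
    · intro x _
      rw [gradN_periodic hR, hR.periodic]
      exact ⟨(hflow ζ x (mem_univ _)).1.add_const _, (hflow ζ x (mem_univ _)).2⟩
    · simp only [hΦ0]
      have := hΦ0 (ζ + 2 * Real.pi * I)
      rwa [hR.periodic] at this

theorem norm_le_of_sphere {q : ℂ → ℂ} (hc : ContinuousOn q (closedBall 0 1))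
    (hd : DifferentiableOn ℂ q (ball 0 1)) {m : ℝ} (hm : ∀ z ∈ sphere (0 : ℂ) 1, ‖q z‖ ≤ m) :
    ∀ z ∈ closedBall (0 : ℂ) 1, ‖q z‖ ≤ m := by
  have h : DiffContOnCl ℂ q (ball 0 1) := by
    refine ⟨hd, ?_⟩
    rwa [closure_ball _ one_ne_zero]
  intro z hz
  refine Complex.norm_le_of_forall_mem_frontier_norm_le isBounded_ball h (fun w hw => ?_)
    (by rwa [closure_ball _ one_ne_zero])
  rw [frontier_ball _ one_ne_zero] at hw
  exact hm w hw

theorem le_norm_of_sphere {q : ℂ → ℂ} (hc : ContinuousOn q (closedBall 0 1))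
    (hd : DifferentiableOn ℂ q (ball 0 1)) {m : ℝ} (hm0 : 0 < m)
    (hm : ∀ z ∈ sphere (0 : ℂ) 1, m ≤ ‖q z‖) (hq : ∀ z ∈ closedBall (0 : ℂ) 1, q z ≠ 0) :
    ∀ z ∈ closedBall (0 : ℂ) 1, m ≤ ‖q z‖ := by
  intro z hz
  have h := norm_le_of_sphere (q := fun z => (q z)⁻¹) (m := m⁻¹) (hc.inv₀ hq)
    (hd.inv fun z hz => hq z (ball_subset_closedBall hz))
    (fun z hz => by rw [norm_inv]; exact inv_anti₀ hm0 (hm z hz)) z hz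
  rw [norm_inv] at h
  exact (inv_le_inv₀ (norm_pos_iff.2 (hq z hz)) hm0).1 h

/-- Zeros of a continuous family of holomorphic functions cannot appear in the interior without
crossing the boundary. -/
theorem zeroFree_of_homotopy {q : ℝ → ℂ → ℂ}
    (hc : ContinuousOn (fun p : ℝ × ℂ => q p.1 p.2) (Icc 0 1 ×ˢ closedBall 0 1))
    (hd : ∀ s ∈ Icc (0 : ℝ) 1, DifferentiableOn ℂ (q s) (ball 0 1))
    (hs : ∀ s ∈ Icc (0 : ℝ) 1, ∀ z ∈ sphere (0 : ℂ) 1, q s z ≠ 0)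
    (h1 : ∀ z ∈ closedBall (0 : ℂ) 1, q 1 z ≠ 0) :
    ∀ z ∈ closedBall (0 : ℂ) 1, q 0 z ≠ 0 := by
  have hqc : ∀ s ∈ Icc (0 : ℝ) 1, ContinuousOn (q s) (closedBall 0 1) := fun s hs =>
    hc.comp (f := fun z => (s, z)) (by fun_prop) fun z hz => ⟨hs, hz⟩
  have hK : IsCompact (Icc (0 : ℝ) 1 ×ˢ closedBall (0 : ℂ) 1) :=
    isCompact_Icc.prod (isCompact_closedBall _ _)
  obtain ⟨m, hm0, hm⟩ : ∃ m > 0, ∀ s ∈ Icc (0 : ℝ) 1, ∀ z ∈ sphere (0 : ℂ) 1, m ≤ ‖q s z‖ := by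
    have hK2 : IsCompact (Icc (0 : ℝ) 1 ×ˢ sphere (0 : ℂ) 1) :=
      isCompact_Icc.prod (isCompact_sphere _ _)
    obtain ⟨p, hp, hp2⟩ := hK2.exists_isMinOn ⟨(0, 1), by simp⟩
      ((hc.mono (prod_mono_right sphere_subset_closedBall)).norm)
    exact ⟨_, norm_pos_iff.2 (hs p.1 hp.1 p.2 hp.2), fun s hs z hz => hp2 (show (s,
        z) ∈ _ from ⟨hs, hz⟩)⟩
  have hu := hK.uniformContinuousOn_of_continuous hc
  obtain ⟨δ, hδ, hu⟩ := Metric.uniformContinuousOn_iff.1 hu m hm0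
  have key : ∀ k : ℕ, ∀ s ∈ Icc (0 : ℝ) 1, 1 - s ≤ k * (δ / 2) →
      ∀ z ∈ closedBall (0 : ℂ) 1, q s z ≠ 0 := by
    intro k
    induction k with
    | zero =>
      intro s hs h z hz
      have : s = 1 := le_antisymm hs.2 (by simp at h; linarith)
      rw [this]; exact h1 z hz
    | succ k ih =>
      intro s hs h z hz h0
      push_cast at h
      have hs' : min 1 (s + δ / 2) ∈ Icc (0 : ℝ) 1 :=
        ⟨le_min zero_le_one (by linarith [hs.1]), min_le_left _ _⟩
      have h3 := ih _ hs' (by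
        rcases min_choice 1 (s + δ / 2) with h | h <;> rw [h]
        · simp; positivity
        · linarith)
      have h4 := le_norm_of_sphere (hqc _ hs') (hd _ hs') hm0 (hm := ?_) h3 z hz
      · have h5 := hu (min 1 (s + δ / 2), z) ⟨hs', hz⟩ (s, z) ⟨hs, hz⟩ (by
          rw [Prod.dist_eq, dist_self, max_eq_left dist_nonneg, Real.dist_eq, abs_lt]
          constructor
          · have : s ≤ min 1 (s + δ / 2) := le_min hs.2 (by linarith)
            linarith
          · linarith [min_le_right 1 (s + δ / 2)])
        rw [dist_eq_norm] at h5
        simp only [h0, sub_zero] at h5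
        linarith
      · exact fun z hz => hm _ hs' z hz
  obtain ⟨k, hk⟩ := exists_nat_ge (1 / (δ / 2))
  refine key k 0 (by simp) ?_
  rw [div_le_iff₀ (by linarith)] at hk
  linarith

theorem exists_upper (hR : LogData R) (M : ℝ) :
    ∃ T, ∀ l ∈ sphere (0 : ℂ) 1, ∀ ζ : ℂ, ζ.re ≤ M → R (l, ζ) ≤ T := by
  obtain ⟨M', h'⟩ := hR.bot 0
  have hRc := hR.smooth.continuous
  set L := max |M| |M'| with hL
  obtain ⟨T, hT⟩ := ((isCompact_sphere (0 : ℂ) 1).prod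
    (isCompact_rect L Real.pi)).exists_bound_of_continuousOn hRc.continuousOn
  refine ⟨max 0 T, fun l hl ζ h => ?_⟩
  rcases le_or_gt ζ.re (-M') with h1 | h1
  · exact (h' l hl ζ h1).le.trans (le_max_left _ _)
  · obtain ⟨k, hk⟩ := exists_period_shift ζ
    have h2 := hT (l, ζ + k * (2 * Real.pi * I)) ⟨hl, mem_rect.2 ⟨?_, hk⟩⟩
    · rw [periodic_int (g := fun ζ => R (l, ζ)) (hR.periodic l)] at h2
      exact (le_abs_self _).trans (h2.trans (le_max_right _ _))
    · rw [exists_period_shift_re, abs_le]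
      constructor
      · linarith [le_abs_self M', le_max_right |M| |M'|]
      · exact h.trans ((le_abs_self M).trans (le_max_left _ _))

theorem exists_antiderivative (p : Polynomial ℂ) :
    ∃ q : Polynomial ℂ, q.derivative = p ∧ q.eval 0 = 0 := by
  induction p using Polynomial.induction_on' with
  | add p₁ p₂ h₁ h₂ =>
    obtain ⟨q₁, a₁, b₁⟩ := h₁
    obtain ⟨q₂, a₂, b₂⟩ := h₂
    exact ⟨q₁ + q₂, by simp [a₁, a₂], by simp [b₁, b₂]⟩
  | monomial n a =>
    refine ⟨Polynomial.monomial (n + 1) (a / (n + 1)), ?_, by simp⟩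
    rw [Polynomial.derivative_monomial]
    have : (n : ℂ) + 1 ≠ 0 := Nat.cast_add_one_ne_zero n
    simp [div_mul_cancel₀ _ this]

theorem exists_polynomial_near (u : ℝ → ℂ) (hu : Continuous u) {η : ℝ} (hη : 0 < η) :
    ∃ p : Polynomial ℂ, ∀ x ∈ Icc (0 : ℝ) 1, ‖p.eval (x : ℂ) - u x‖ ≤ η := by
  obtain ⟨p, hp⟩ := exists_polynomial_near_of_continuousOn 0 1 (fun x => (u x).re)
    (continuous_re.comp hu).continuousOn (η / 2) (by linarith)
  obtain ⟨q, hq⟩ := exists_polynomial_near_of_continuousOn 0 1 (fun x => (u x).im)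
    (continuous_im.comp hu).continuousOn (η / 2) (by linarith)
  refine ⟨p.map ofRealHom + Polynomial.C I * q.map ofRealHom, fun x hx => ?_⟩
  have e : ∀ r : Polynomial ℝ, (r.map ofRealHom).eval (x : ℂ) = ((r.eval x : ℝ) : ℂ) := fun r =>
    Polynomial.eval_map_apply ofRealHom x
  rw [Polynomial.eval_add, Polynomial.eval_mul, Polynomial.eval_C, e, e]
  refine (Complex.norm_le_abs_re_add_abs_im _).trans ?_
  have h1 := hp x hx
  have h2 := hq x hx
  simp only [sub_re, add_re, ofReal_re, mul_re, I_re, I_im, ofReal_im, sub_im, add_im, mul_im]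
  ring_nf at h1 h2 ⊢
  linarith

/-- A polynomial path which leaves the band, along which `R` increases linearly. -/
theorem exists_polynomial_path (hR : LogData R) {l₀ : ℂ} (hl : l₀ ∈ sphere (0 : ℂ) 1) (ζ₀ : ℂ)
    (M : ℝ) : ∃ Q : Polynomial ℂ, Q.eval 0 = 0 ∧ ∃ c > 0, ∃ δ > 0, ∀ l₁ ζ₁ : ℂ,
      ‖l₁ - l₀‖ < δ → ‖ζ₁ - ζ₀‖ < δ → ∀ x ∈ Icc (0 : ℝ) 1,
        R (l₁, ζ₁) + c * x ≤ R (l₁, ζ₁ + Q.eval (x : ℂ)) ∧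
        (1 / 2 ≤ x → M ≤ (ζ₁ + Q.eval (x : ℂ)).re) := by
  obtain ⟨Φ, hΦc, hΦ0, hΦ, -, -⟩ := exists_flow hR hl
  obtain ⟨T, hT⟩ := exists_upper hR (M + 1)
  set s₀ := R (l₀, ζ₀) with hs₀
  obtain ⟨L, hL0, hL⟩ : ∃ L : ℝ, 0 < L ∧ T < s₀ + L / 2 :=
    ⟨2 * (|T| + |s₀|) + 1, by positivity,
      by linarith [le_abs_self T, neg_abs_le s₀]⟩
  set σ : ℝ → ℂ := fun x => Φ ζ₀ (s₀ + L * x) with hσ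
  set σ' : ℝ → ℂ := fun x => L * (gradN R (l₀, σ x))⁻¹ with hσ'
  have hσd : ∀ x, HasDerivAt σ (σ' x) x := by
    intro x
    have h1 : HasDerivAt (fun x : ℝ => s₀ + L * x) L x := by
      simpa using ((hasDerivAt_id x).const_mul L).const_add s₀
    have := HasDerivAt.scomp x (hΦ ζ₀ (s₀ + L * x) (mem_univ _)).1 h1
    rw [real_smul] at this
    exact this
  have hσc : Continuous σ := continuous_iff_continuousAt.2 fun x => (hσd x).continuousAt
  have hNc : Continuous (gradN R) := (contDiff_gradN hR).continuous
  have hσ'c : Continuous σ' := by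
    refine continuous_const.mul (Continuous.inv₀ (hNc.comp (by fun_prop)) fun x => hR.grad _ hl _)
  set O : Set (ℂ × ℂ × ℂ) := {p | L / 2 < (gradN R (p.1, p.2.1) * p.2.2).re} with hO
  have hOo : IsOpen O := isOpen_lt continuous_const
    (continuous_re.comp ((hNc.comp (by fun_prop)).mul (by fun_prop)))
  have hK : IsCompact ((fun x : ℝ => (l₀, σ x, σ' x)) '' Icc 0 1) :=
    isCompact_Icc.image (by fun_prop)
  obtain ⟨δ, hδ, hδO⟩ := hK.exists_thickening_subset_open hOo (by
    rintro _ ⟨x, -, rfl⟩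
    simp only [hO, hσ', mem_ofPred_eq]
    rw [mul_left_comm, mul_inv_cancel₀ (hR.grad _ hl _), mul_one, ofReal_re]
    linarith)
  set η := min (δ / 4) (1 / 4) with hη
  have hη0 : 0 < η := by positivity
  have hη1 : η ≤ δ / 4 := min_le_left _ _
  have hη2 : η ≤ 1 / 4 := min_le_right _ _
  obtain ⟨P, hP⟩ := exists_polynomial_near σ' hσ'c hη0
  obtain ⟨Q, hQ, hQ0⟩ := exists_antiderivative P
  have hQd : ∀ x : ℝ, HasDerivAt (fun x : ℝ => Q.eval (x : ℂ)) (P.eval (x : ℂ)) x := by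
    intro x
    rw [← hQ]
    exact (Q.hasDerivAt (x : ℂ)).comp_ofReal
  have hσ0 : σ 0 = ζ₀ := by simp [hσ, hs₀, hΦ0]
  have hQσ : ∀ x ∈ Icc (0 : ℝ) 1, ‖ζ₀ + Q.eval (x : ℂ) - σ x‖ ≤ η := by
    intro x hx
    have h := norm_image_sub_le_of_norm_deriv_le_segment' (a := 0) (b := 1)
      (f := fun x : ℝ => Q.eval (x : ℂ) - σ x) (f' := fun x => P.eval (x : ℂ) - σ' x) (C := η)
      (fun x _ => ((hQd x).sub (hσd x)).hasDerivWithinAt)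
      (fun x hx => hP x (Ico_subset_Icc_self hx)) x hx
    simp only [ofReal_zero, hQ0, hσ0, sub_zero, zero_sub, sub_neg_eq_add] at h
    have e : ζ₀ + Q.eval (x : ℂ) - σ x = Q.eval (x : ℂ) - σ x + ζ₀ := by ring
    rw [e]
    exact h.trans (by nlinarith [hx.2])
  refine ⟨Q, hQ0, L / 2, by positivity, η, hη0, fun l₁ ζ₁ h1 h2 x hx => ⟨?_, fun hx2 => ?_⟩⟩
  · have hd : ∀ y : ℝ, HasDerivAt (fun y : ℝ => R (l₁, ζ₁ + Q.eval (y : ℂ)))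
        (gradN R (l₁, ζ₁ + Q.eval (y : ℂ)) * P.eval (y : ℂ)).re y := fun y =>
      hR.hasDerivAt_comp (γ := fun y : ℝ => ζ₁ + Q.eval (y : ℂ)) ((hQd y).const_add ζ₁)
    have hmem : ∀ y ∈ Icc (0 : ℝ) 1,
        L / 2 < (gradN R (l₁, ζ₁ + Q.eval (y : ℂ)) * P.eval (y : ℂ)).re := by
      intro y hy
      refine hδO (show (l₁, ζ₁ + Q.eval (y : ℂ), P.eval (y : ℂ)) ∈ _ from ?_)
      rw [mem_thickening_iff]
      refine ⟨_, mem_image_of_mem _ hy, ?_⟩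
      have h3 : ‖ζ₁ + Q.eval (y : ℂ) - σ y‖ ≤ 2 * η := by
        calc _ = ‖(ζ₁ - ζ₀) + (ζ₀ + Q.eval (y : ℂ) - σ y)‖ := by congr 1; ring
          _ ≤ _ := (norm_add_le _ _).trans (by linarith [hQσ y hy])
      rw [Prod.dist_eq, Prod.dist_eq]
      simp only [dist_eq_norm]
      refine max_lt (by linarith) (max_lt (by linarith) ?_)
      linarith [hP y hy]
    have := (convex_Icc (0 : ℝ) 1).mul_sub_le_image_sub_of_le_deriv
      (f := fun y : ℝ => R (l₁, ζ₁ + Q.eval (y : ℂ))) (C := L / 2)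
      (fun y _ => (hd y).continuousAt.continuousWithinAt)
      (fun y _ => (hd y).differentiableAt.differentiableWithinAt)
      (fun y hy => by rw [(hd y).deriv]; exact (hmem y (interior_subset hy)).le)
      0 (by simp) x hx hx.1
    simp only [ofReal_zero, hQ0, add_zero, sub_zero] at this
    linarith
  · have h3 : M + 1 < (σ x).re := by
      by_contra! h
      have := hT l₀ hl _ h
      rw [(hΦ ζ₀ (s₀ + L * x) (mem_univ _)).2] at this
      nlinarith
    have h4 : ‖ζ₁ + Q.eval (x : ℂ) - σ x‖ ≤ 2 * η := by
      calc _ = ‖(ζ₁ - ζ₀) + (ζ₀ + Q.eval (x : ℂ) - σ x)‖ := by congr 1; ring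
        _ ≤ _ := (norm_add_le _ _).trans (by linarith [hQσ x hx])
    have h5 := (abs_le.1 ((Complex.abs_re_le_norm _).trans h4)).1
    rw [sub_re] at h5
    linarith

theorem cpow_sector {κ : ℝ} (hκ : 0 < κ) (hκ1 : κ ≤ 1 / 2) {u : ℂ} (hu : 0 ≤ u.re) :
    ‖u ^ (κ : ℂ)‖ = ‖u‖ ^ κ ∧ 2 / 3 * ‖u ^ (κ : ℂ)‖ ≤ (u ^ (κ : ℂ)).re ∧
      |(u ^ (κ : ℂ)).im| ≤ 2 * κ * ‖u ^ (κ : ℂ)‖ := by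
  rcases eq_or_ne u 0 with rfl | h0
  · have : (κ : ℂ) ≠ 0 := by exact_mod_cast hκ.ne'
    rw [zero_cpow this]
    simp [Real.zero_rpow hκ.ne']
  have hn : ‖u ^ (κ : ℂ)‖ = ‖u‖ ^ κ := norm_cpow_real u κ
  have hθ : |arg u| ≤ Real.pi / 2 := abs_arg_le_pi_div_two_iff.2 hu
  have hθ2 : |κ * arg u| ≤ κ * 1.6 := by
    rw [abs_mul, abs_of_pos hκ]
    have := Real.pi_lt_d2
    exact mul_le_mul_of_nonneg_left (by linarith) hκ.le
  have e : u ^ (κ : ℂ) = (‖u‖ ^ κ : ℝ) * exp ((κ * arg u : ℝ) * I) := by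
    rw [cpow_def_of_ne_zero h0, Complex.log, add_mul, exp_add]
    congr 1
    · rw [Real.rpow_def_of_pos (norm_pos_iff.2 h0)]; push_cast; rfl
    · push_cast; congr 1; ring
  have hre : (u ^ (κ : ℂ)).re = ‖u‖ ^ κ * Real.cos (κ * arg u) := by
    rw [e, re_ofReal_mul, exp_ofReal_mul_I_re]
  have him : (u ^ (κ : ℂ)).im = ‖u‖ ^ κ * Real.sin (κ * arg u) := by
    rw [e, im_ofReal_mul, exp_ofReal_mul_I_im]
  have hp : 0 ≤ ‖u‖ ^ κ := by positivity
  refine ⟨hn, ?_, ?_⟩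
  · rw [hre, hn, mul_comm]
    refine mul_le_mul_of_nonneg_left ?_ hp
    have h1 := Real.one_sub_sq_div_two_le_cos (x := κ * arg u)
    have h2 : (κ * arg u) ^ 2 ≤ 0.8 ^ 2 := sq_le_sq' (by linarith [(abs_le.1 hθ2).1])
      (by linarith [(abs_le.1 hθ2).2])
    linarith
  · rw [him, hn, abs_mul, abs_of_nonneg hp, mul_comm]
    refine mul_le_mul_of_nonneg_right ?_ hp
    have := Real.abs_sin_le_abs (x := κ * arg u)
    linarith

theorem one_sub_conj_mul {l w : ℂ} (hl : l ∈ sphere (0 : ℂ) 1) (hw : w ∈ closedBall (0 : ℂ) 1) :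
    0 ≤ ((1 - starRingEnd ℂ l * w) / 2).re ∧
      ‖(1 - starRingEnd ℂ l * w) / 2‖ = ‖w - l‖ / 2 := by
  have h1 : ‖l‖ = 1 := by simpa using hl
  have h2 : ‖w‖ ≤ 1 := by simpa using hw
  constructor
  · have : (starRingEnd ℂ l * w).re ≤ 1 := (re_le_norm _).trans (by simpa [h1] using h2)
    rw [show (2 : ℂ) = ((2 : ℝ) : ℂ) by simp, div_ofReal_re, sub_re, one_re]
    linarith
  · have e : 1 - starRingEnd ℂ l * w = starRingEnd ℂ l * (l - w) := by
      have : starRingEnd ℂ l * l = 1 := by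
        rw [mul_comm, mul_conj, normSq_eq_norm_sq, h1]; simp
      rw [mul_sub, this]
    rw [norm_div, e, norm_mul, RCLike.norm_conj, h1, one_mul, norm_sub_rev]
    simp

theorem exists_lipschitz_polynomial (Q : Polynomial ℂ) :
    ∃ B ≥ 1, ∀ z ∈ closedBall (0 : ℂ) 1, ∀ w ∈ closedBall (0 : ℂ) 1,
      ‖Q.eval z - Q.eval w‖ ≤ B * ‖z - w‖ := by
  obtain ⟨B, hB⟩ := (isCompact_closedBall (0 : ℂ) 1).exists_bound_of_continuousOn
    (f := fun z => Q.derivative.eval z) (Polynomial.continuous _).continuousOn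
  refine ⟨max B 1, le_max_right _ _, fun z hz w hw => ?_⟩
  exact (convex_closedBall (0 : ℂ) 1).norm_image_sub_le_of_norm_hasDerivWithin_le
    (fun x _ => (Q.hasDerivAt x).hasDerivWithinAt)
    (fun x hx => (hB x hx).trans (le_max_left _ _)) hw hz

theorem exists_lipschitz_R (hR : LogData R) (ρ : ℝ) :
    ∃ A ≥ 0, ∀ p ∈ closedBall (0 : ℂ) 1 ×ˢ closedBall (0 : ℂ) ρ,
      ∀ q ∈ closedBall (0 : ℂ) 1 ×ˢ closedBall (0 : ℂ) ρ, |R p - R q| ≤ A * ‖p - q‖ := by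
  have hc := hR.smooth.continuous_fderiv (by norm_num)
  obtain ⟨A, hA⟩ := ((isCompact_closedBall (0 : ℂ) 1).prod
    (isCompact_closedBall (0 : ℂ) ρ)).exists_bound_of_continuousOn hc.continuousOn
  refine ⟨max A 0, le_max_right _ _, fun p hp q hq => ?_⟩
  exact ((convex_closedBall (0 : ℂ) 1).prod
    (convex_closedBall (0 : ℂ) ρ)).norm_image_sub_le_of_norm_hasFDerivWithin_le
    (fun x _ => (hR.hasFDerivAt x).hasFDerivWithinAt)
    (fun x hx => (hA x hx).trans (le_max_left _ _)) hq hp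

theorem exists_small_exponent (A B c : ℝ) (hc : 0 < c) :
    ∃ n : ℕ, 1 ≤ n ∧ A * (3 * (3 / 4) ^ n + 3 * B / ((n : ℝ) + 1)) ≤ c ∧
      3 * B / ((n : ℝ) + 1) ≤ 1 := by
  have h1 : Filter.Tendsto (fun n : ℕ => 3 * B / ((n : ℝ) + 1)) Filter.atTop (nhds 0) := by
    have := tendsto_one_div_add_atTop_nhds_zero_nat (𝕜 := ℝ)
    simpa [div_eq_mul_inv] using this.const_mul (3 * B)
  have h2 : Filter.Tendsto (fun n : ℕ => (3 / 4 : ℝ) ^ n) Filter.atTop (nhds 0) :=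
    tendsto_pow_atTop_nhds_zero_of_lt_one (by norm_num) (by norm_num)
  have h3 := ((h2.const_mul 3).add h1).const_mul A
  simp only [mul_zero, add_zero] at h3
  obtain ⟨n, a, b, d⟩ := ((Filter.eventually_ge_atTop 1).and
    ((h3.eventually_le_const hc).and (h1.eventually_le_const one_pos))).exists
  exact ⟨n, a, b, d⟩

theorem local_barrier (hR : LogData R) {M T : ℝ} (hT : 0 ≤ T) {l₀ : ℂ}
    (hl₀ : l₀ ∈ sphere (0 : ℂ) 1) (ζ₀ : ℂ) :
    ∃ κ : ℝ, 0 < κ ∧ κ < 1 ∧ ∃ C ≥ 0, ∃ δ > 0, ∀ l₁ ∈ sphere (0 : ℂ) 1, ∀ ζ₁, ‖l₁ - l₀‖ < δ →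
      ‖ζ₁ - ζ₀‖ < δ → ∀ t f, |t| ≤ T → Sol R t f → (∀ z ∈ closedBall (0 : ℂ) 1, |(f z).re| ≤ M) →
      ∀ z ∈ closedBall (0 : ℂ) 1, f z = ζ₁ → R (l₁, ζ₁) ≤ t + C * (‖z - l₁‖ / 2) ^ κ := by
  obtain ⟨Q, hQ0, c, hc, δ₀, hδ₀, hQ⟩ := exists_polynomial_path hR hl₀ ζ₀ (M + 3)
  obtain ⟨B, hB1, hB⟩ := exists_lipschitz_polynomial Q
  have hB' : ∀ z ∈ closedBall (0 : ℂ) 1, ‖Q.eval z‖ ≤ B * ‖z‖ := fun z hz => by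
    simpa [hQ0] using hB z hz 0 (by simp)
  obtain ⟨A, hA0, hA⟩ := exists_lipschitz_R hR (‖ζ₀‖ + 1 + 2 * B)
  obtain ⟨K, hK⟩ := ((isCompact_closedBall (0 : ℂ) 1).prod
    (isCompact_closedBall (0 : ℂ) (‖ζ₀‖ + 1 + 2 * B))).exists_bound_of_continuousOn
      hR.smooth.continuous.continuousOn
  obtain ⟨n, hn1, hn2, hn3⟩ := exists_small_exponent A B c hc
  have hnp : (0 : ℝ) < (n : ℝ) + 1 := by positivity
  set κ : ℝ := 1 / ((n : ℝ) + 1) with hκ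
  have hκ0 : 0 < κ := by positivity
  have hκ1 : κ ≤ 1 / 2 := by
    have : (1 : ℝ) ≤ n := by exact_mod_cast hn1
    exact one_div_le_one_div_of_le (by norm_num) (by linarith)
  have hBκ : 3 * B / ((n : ℝ) + 1) = B * (3 * κ) := by rw [hκ]; ring
  rw [hBκ] at hn2 hn3
  refine ⟨κ, hκ0, by linarith, A * B + (|K| + T) * B, by positivity, min δ₀ 1, by positivity, ?_⟩
  intro l₁ hl₁ ζ₁ h1 h2 t f ht hf hM z hz hfz
  have hζ₁ : ‖ζ₁‖ ≤ ‖ζ₀‖ + 1 := by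
    have : ‖ζ₁ - ζ₀‖ < 1 := h2.trans_le (min_le_right _ _)
    calc ‖ζ₁‖ = ‖ζ₀ + (ζ₁ - ζ₀)‖ := by congr 1; ring
      _ ≤ _ := (norm_add_le _ _).trans (by linarith)
  set u : ℂ → ℂ := fun w => (1 - starRingEnd ℂ l₁ * w) / 2 with hu
  set y : ℂ → ℂ := fun w => u w ^ (κ : ℂ) with hy
  have hyn : ∀ w ∈ closedBall (0 : ℂ) 1, ‖y w‖ = (‖w - l₁‖ / 2) ^ κ := fun w hw => by
    rw [hy]; simp only; rw [(cpow_sector hκ0 hκ1 (one_sub_conj_mul hl₁ hw).1).1]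
    rw [(one_sub_conj_mul hl₁ hw).2]
  have hl₁n : ‖l₁‖ = 1 := by simpa using hl₁
  have hy1 : ∀ w ∈ closedBall (0 : ℂ) 1, ‖y w‖ ≤ 1 := fun w hw => by
    rw [hyn w hw]
    refine Real.rpow_le_one (by positivity) ?_ hκ0.le
    have := norm_sub_le w l₁
    have : ‖w‖ ≤ 1 := by simpa using hw
    linarith
  rw [← hyn z hz]
  rcases lt_or_ge 1 (B * ‖y z‖) with hbig | hsmall
  · have h3 := hK (l₁, ζ₁) ⟨sphere_subset_closedBall hl₁, by simp; linarith⟩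
    have h4 : |K| + T ≤ (|K| + T) * (B * ‖y z‖) := le_mul_of_one_le_right (by positivity) hbig.le
    have h5 : 0 ≤ A * B * ‖y z‖ := by positivity
    have h6 := (abs_le.1 ht).1
    have h7 := (le_abs_self _).trans (h3.trans (le_abs_self K))
    nlinarith
  -- the barrier family
  set v : ℝ → ℂ → ℂ := fun s w => s + (1 - s) * y w with hv
  have hvfacts : ∀ s ∈ Icc (0 : ℝ) 1, ∀ w ∈ closedBall (0 : ℂ) 1,
      ‖v s w‖ ≤ 1 ∧ (v s w).re ∈ Icc (0 : ℝ) 1 ∧ 2 / 3 * ‖y w‖ ≤ (v s w).re ∧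
      |(v s w).im| ≤ 3 * κ * (v s w).re := by
    intro s hs w hw
    obtain ⟨-, ha, hb⟩ := cpow_sector hκ0 hκ1 (one_sub_conj_mul hl₁ hw).1
    have hyw := hy1 w hw
    have hvn : ‖v s w‖ ≤ 1 := by
      refine (norm_add_le _ _).trans ?_
      have e : (1 : ℂ) - s = ((1 - s : ℝ) : ℂ) := by push_cast; ring
      rw [norm_mul, e, norm_real, norm_real, Real.norm_of_nonneg hs.1,
        Real.norm_of_nonneg (by linarith [hs.2])]
      nlinarith [hs.2]
    have hre : (v s w).re = s + (1 - s) * (y w).re := by simp [hv]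
    have him : (v s w).im = (1 - s) * (y w).im := by simp [hv]
    have hyre : (y w).re ≤ 1 := (re_le_norm _).trans hyw
    have h3 : 2 / 3 * ‖y w‖ ≤ (v s w).re := by
      rw [hre]; nlinarith [hs.1, hs.2]
    refine ⟨hvn, ⟨le_trans (by positivity) h3, (re_le_norm _).trans hvn⟩, h3, ?_⟩
    rw [him, abs_mul, abs_of_nonneg (by linarith [hs.2])]
    calc (1 - s) * |(y w).im| ≤ 1 * |(y w).im| := by
          gcongr; linarith [hs.1]
      _ ≤ 2 * κ * ‖y w‖ := by rw [one_mul]; exact hb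
      _ = 3 * κ * (2 / 3 * ‖y w‖) := by ring
      _ ≤ _ := by gcongr
  have hQv : ∀ s ∈ Icc (0 : ℝ) 1, ∀ w ∈ closedBall (0 : ℂ) 1,
      ‖Q.eval (v s w) - Q.eval (((v s w).re : ℝ) : ℂ)‖ ≤ B * (3 * κ) * (v s w).re := by
    intro s hs w hw
    obtain ⟨ha, hb, -, hd⟩ := hvfacts s hs w hw
    have h3 := hB (v s w) (by simpa using ha) ((v s w).re : ℝ) (by
      simp only [mem_closedBall, dist_zero_right, norm_real, Real.norm_eq_abs, abs_of_nonneg hb.1]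
      exact hb.2)
    have e : v s w - ((v s w).re : ℝ) = (v s w).im * I := by
      apply Complex.ext <;> simp
    rw [e, norm_mul, norm_real, norm_I, mul_one, Real.norm_eq_abs] at h3
    calc _ ≤ _ := h3
      _ ≤ B * (3 * κ * (v s w).re) := by gcongr
      _ = _ := by ring
  set p : ℝ → ℂ → ℂ := fun s w => ζ₁ - Q.eval (y z) + Q.eval (v s w) with hp
  have hyz : ‖Q.eval (y z)‖ ≤ B * ‖y z‖ := hB' _ (by simpa using hy1 z hz)
  have hre_big : ∀ s ∈ Icc (0 : ℝ) 1, ∀ w ∈ closedBall (0 : ℂ) 1, 1 / 2 ≤ (v s w).re →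
      M < (p s w).re := by
    intro s hs w hw hx
    obtain ⟨-, hb, -, -⟩ := hvfacts s hs w hw
    have h3 := (hQ l₁ ζ₁ (h1.trans_le (min_le_left _ _)) (h2.trans_le (min_le_left _ _))
      (v s w).re hb).2 hx
    have h4 := (abs_le.1 ((abs_re_le_norm _).trans (hQv s hs w hw))).1
    have h5 := (abs_le.1 ((abs_re_le_norm _).trans hyz)).2
    have h6 : B * (3 * κ) * (v s w).re ≤ 1 := by
      have : 0 ≤ B * (3 * κ) := by positivity
      nlinarith [hb.1, hb.2]
    simp only [hp, sub_re, add_re] at h3 h4 ⊢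
    linarith
  have hyc : ContinuousOn y (closedBall 0 1) := by
    intro w hw
    have hca : ContinuousAt (fun x : ℂ => x ^ (κ : ℂ)) (u w) :=
      continuousAt_cpow_const_of_re_pos (Or.inl (one_sub_conj_mul hl₁ hw).1) (by simpa using hκ0)
    exact (ContinuousAt.comp (f := u) hca (by fun_prop)).continuousWithinAt
  have hyd : DifferentiableOn ℂ y (ball 0 1) := by
    intro w hw
    have hpos : 0 < (u w).re := by
      refine lt_of_le_of_ne (one_sub_conj_mul hl₁ (ball_subset_closedBall hw)).1 fun h => ?_
      have : (starRingEnd ℂ l₁ * w).re < 1 := (re_le_norm _).trans_lt (by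
        simpa [hl₁n] using hw)
      simp only [hu] at h
      rw [show (2 : ℂ) = ((2 : ℝ) : ℂ) by simp, div_ofReal_re, sub_re, one_re] at h
      linarith
    refine (DifferentiableAt.cpow (by fun_prop) (by fun_prop) ?_).differentiableWithinAt
    exact Or.inl hpos
  obtain ⟨s, hs, w, hw, hsw⟩ : ∃ s ∈ Icc (0 : ℝ) 1, ∃ w ∈ sphere (0 : ℂ) 1, p s w = f w := by
    by_contra! hne
    refine zeroFree_of_homotopy (q := fun s w => p s w - f w) ?_ ?_
      (fun s hs w hw => sub_ne_zero.2 (hne s hs w hw)) ?_ z hz ?_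
    · have hfc := hf.1.1
      have h3 : ContinuousOn (fun q : ℝ × ℂ => y q.2) (Icc 0 1 ×ˢ closedBall 0 1) :=
        hyc.comp continuousOn_snd fun q hq => hq.2
      have h4 : ContinuousOn (fun q : ℝ × ℂ => f q.2) (Icc 0 1 ×ˢ closedBall 0 1) :=
        hfc.comp continuousOn_snd fun q hq => hq.2
      refine ContinuousOn.sub (ContinuousOn.add continuousOn_const
        (Q.continuous.comp_continuousOn ?_)) h4
      exact ContinuousOn.add (Continuous.continuousOn (by fun_prop))
        (ContinuousOn.mul (Continuous.continuousOn (by fun_prop)) h3)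
    · intro s _
      refine DifferentiableOn.sub (DifferentiableOn.const_add _ ?_) hf.1.2
      exact Q.differentiable.comp_differentiableOn
        (DifferentiableOn.const_add _ (hyd.const_mul _))
    · intro w hw h
      have h3 := hre_big 1 (by simp) w hw (by simp [hv]; norm_num)
      rw [sub_eq_zero.1 h] at h3
      linarith [(abs_le.1 (hM w hw)).2]
    · simp [hp, hv, hfz]
  have hw' := sphere_subset_closedBall hw
  obtain ⟨ha, hb, hd, -⟩ := hvfacts s hs w hw'
  have hx : (v s w).re < 1 / 2 := by
    by_contra! h
    have h3 := hre_big s hs w hw' h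
    rw [hsw] at h3
    linarith [(abs_le.1 (hM w hw')).2]
  set x := (v s w).re with hx'
  have hQ1 := (hQ l₁ ζ₁ (h1.trans_le (min_le_left _ _)) (h2.trans_le (min_le_left _ _)) x hb).1
  have ht' : R (w, p s w) = t := by rw [hsw]; exact hf.2 w hw
  have hdist : ‖w - l₁‖ ≤ 3 * (3 / 4) ^ n * x := by
    have h3 : ‖y w‖ ^ (n + 1) = ‖w - l₁‖ / 2 := by
      rw [hyn w hw', ← Real.rpow_natCast, ← Real.rpow_mul (by positivity), hκ]
      push_cast
      rw [one_div_mul_cancel hnp.ne', Real.rpow_one]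
    have h4 : ‖y w‖ ≤ 3 / 4 := by linarith
    have h5 : ‖y w‖ ^ n ≤ (3 / 4) ^ n := by gcongr
    have h6 : ‖y w‖ ^ (n + 1) ≤ (3 / 4) ^ n * (3 / 2 * x) := by
      rw [pow_succ]
      gcongr
      linarith
    linarith
  have hxn : ‖((x : ℝ) : ℂ)‖ ≤ 1 := by
    rw [norm_real, Real.norm_of_nonneg hb.1]; exact hb.2
  have hLip := hA (w, p s w) ⟨hw', ?_⟩ (l₁, ζ₁ + Q.eval (x : ℂ))
    ⟨sphere_subset_closedBall hl₁, ?_⟩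
  · have h3 : ‖(w, p s w) - (l₁, ζ₁ + Q.eval (x : ℂ))‖ ≤
        3 * (3 / 4) ^ n * x + B * (3 * κ) * x + B * ‖y z‖ := by
      rw [Prod.mk_sub_mk, Prod.norm_mk]
      have hx0 := hb.1
      refine max_le (hdist.trans ?_) ?_
      · have : 0 ≤ B * (3 * κ) * x + B * ‖y z‖ := by positivity
        linarith
      · have h4 : p s w - (ζ₁ + Q.eval (x : ℂ)) =
            (Q.eval (v s w) - Q.eval (x : ℂ)) - Q.eval (y z) := by simp only [hp]; ring
        rw [h4]
        have h5 : 0 ≤ 3 * (3 / 4) ^ n * x := by positivity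
        refine (norm_sub_le _ _).trans ?_
        linarith [hQv s hs w hw']
    have h6 := (abs_le.1 (hLip.trans (mul_le_mul_of_nonneg_left h3 hA0))).1
    rw [ht'] at h6
    have h7 : A * (3 * (3 / 4) ^ n + B * (3 * κ)) * x ≤ c * x :=
      mul_le_mul_of_nonneg_right hn2 hb.1
    have h8 : 0 ≤ (|K| + T) * B * ‖y z‖ := by positivity
    linarith
  · have : ‖p s w‖ ≤ ‖ζ₁‖ + ‖Q.eval (y z)‖ + ‖Q.eval (v s w)‖ :=
      (norm_add_le _ _).trans (by gcongr; exact norm_sub_le _ _)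
    have h3 : ‖Q.eval (v s w)‖ ≤ B * ‖v s w‖ := hB' _ (by simpa using ha)
    simp only [mem_closedBall, dist_zero_right]
    nlinarith
  · have h3 : ‖Q.eval (x : ℂ)‖ ≤ B * ‖(x : ℂ)‖ := hB' _ (by simpa using hxn)
    simp only [mem_closedBall, dist_zero_right]
    have := norm_add_le ζ₁ (Q.eval (x : ℂ))
    nlinarith

theorem Sol.exists_re_bound (hR : LogData R) (T : ℝ) : ∃ M ≥ 0, ∀ t f, |t| ≤ T → Sol R t f →
    ∀ z ∈ closedBall (0 : ℂ) 1, |(f z).re| ≤ M := by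
  obtain ⟨M, hM0, hM⟩ := exists_band hR T
  refine ⟨M, hM0, fun t f ht hf z hz => ?_⟩
  have hb : ∀ l ∈ sphere (0 : ℂ) 1, |(f l).re| < M := fun l hl => hM l hl _ (by rwa [hf.2 l hl])
  have h1 := norm_le_of_sphere (q := fun z => exp (f z)) (m := Real.exp M) hf.1.1.cexp hf.1.2.cexp
    (fun l hl => by rw [norm_exp]; exact Real.exp_le_exp.2 (abs_lt.1 (hb l hl)).2.le) z hz
  have h2 := norm_le_of_sphere (q := fun z => exp (-f z)) (m := Real.exp M) hf.1.1.neg.cexp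
    hf.1.2.neg.cexp
    (fun l hl => by
      rw [norm_exp, neg_re]; exact Real.exp_le_exp.2 (by linarith [(abs_lt.1 (hb l hl)).1])) z hz
  rw [norm_exp, Real.exp_le_exp] at h1 h2
  rw [neg_re] at h2
  exact abs_le.2 ⟨by linarith, h1⟩

theorem Sol.add_period (hR : LogData R) {t : ℝ} {f : ℂ → ℂ} (hf : Sol R t f) (k : ℤ) :
    Sol R t (fun z => f z + k * (2 * Real.pi * I)) :=
  ⟨⟨hf.1.1.add continuousOn_const, hf.1.2.add_const _⟩, fun l hl => by
    rw [periodic_int (g := fun ζ => R (l, ζ)) (hR.periodic l)]; exact hf.2 l hl⟩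

theorem boundary_upper (hR : LogData R) {T : ℝ} (hT : 0 ≤ T) :
    ∃ κ : ℝ, 0 < κ ∧ κ < 1 ∧ ∃ C ≥ 0, ∀ t f, |t| ≤ T → Sol R t f → ∀ z ∈ closedBall (0 : ℂ) 1,
      ∀ l ∈ sphere (0 : ℂ) 1, R (l, f z) ≤ t + C * (‖z - l‖ / 2) ^ κ := by
  obtain ⟨M, hM0, hM⟩ := Sol.exists_re_bound hR T
  have key : ∃ κ : ℝ, 0 < κ ∧ κ < 1 ∧ ∃ C ≥ 0, ∀ p ∈ sphere (0 : ℂ) 1 ×ˢ rect M Real.pi,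
      p.1 ∈ sphere (0 : ℂ) 1 → ∀ t f, |t| ≤ T → Sol R t f → ∀ z ∈ closedBall (0 : ℂ) 1, f z = p.2 →
      R p ≤ t + C * (‖z - p.1‖ / 2) ^ κ := by
    refine IsCompact.induction_on ((isCompact_sphere (0 : ℂ) 1).prod (isCompact_rect M Real.pi))
      (p := fun s => ∃ κ : ℝ, 0 < κ ∧ κ < 1 ∧ ∃ C ≥ 0, ∀ p ∈ s,
      p.1 ∈ sphere (0 : ℂ) 1 → ∀ t f, |t| ≤ T → Sol R t f → ∀ z ∈ closedBall (0 : ℂ) 1, f z = p.2 →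
      R p ≤ t + C * (‖z - p.1‖ / 2) ^ κ) ?_ ?_ ?_ ?_
    · exact ⟨1 / 2, by norm_num, by norm_num, 0, le_rfl, by simp⟩
    · rintro s s' hs ⟨κ, h1, h2, C, h3, h4⟩
      exact ⟨κ, h1, h2, C, h3, fun p hp => h4 p (hs hp)⟩
    · rintro s s' ⟨κ, h1, h2, C, h3, h4⟩ ⟨κ', h1', h2', C', h3', h4'⟩
      refine ⟨min κ κ', lt_min h1 h1', (min_le_left _ _).trans_lt h2, C + C', by positivity, ?_⟩
      intro p hp hp1 t f ht hf z hz hfz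
      have hx : ‖z - p.1‖ / 2 ≤ 1 := by
        have := norm_sub_le z p.1
        have h5 : ‖z‖ ≤ 1 := by simpa using hz
        have h6 : ‖p.1‖ = 1 := by simpa using hp1
        linarith
      have hx0 : 0 ≤ ‖z - p.1‖ / 2 := by positivity
      have hm : 0 ≤ min κ κ' := le_min h1.le h1'.le
      have e1 := Real.rpow_le_rpow_of_exponent_ge' hx0 hx hm (min_le_left κ κ')
      have e2 := Real.rpow_le_rpow_of_exponent_ge' hx0 hx hm (min_le_right κ κ')
      have e3 : 0 ≤ (‖z - p.1‖ / 2) ^ (min κ κ') := by positivity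
      rcases hp with hp | hp
      · have := h4 p hp hp1 t f ht hf z hz hfz
        nlinarith
      · have := h4' p hp hp1 t f ht hf z hz hfz
        nlinarith
    · rintro ⟨l₀, ζ₀⟩ ⟨hl₀, -⟩
      obtain ⟨κ, h1, h2, C, h3, δ, hδ, h4⟩ := local_barrier hR (M := M) hT hl₀ ζ₀
      refine ⟨ball (l₀, ζ₀) δ, mem_nhdsWithin_of_mem_nhds (ball_mem_nhds _ hδ), κ, h1,
          h2, C, h3, ?_⟩
      rintro ⟨l, ζ⟩ hp hl t f ht hf z hz hfz
      rw [mem_ball, Prod.dist_eq, max_lt_iff, dist_eq_norm, dist_eq_norm] at hp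
      exact h4 l hl ζ hp.1 hp.2 t f ht hf (hM t f ht hf) z hz hfz
  obtain ⟨κ, h1, h2, C, h3, h4⟩ := key
  refine ⟨κ, h1, h2, C, h3, fun t f ht hf z hz l hl => ?_⟩
  obtain ⟨k, hk⟩ := exists_period_shift (f z)
  have := h4 (l, f z + k * (2 * Real.pi * I)) ⟨hl, mem_rect.2 ⟨?_, hk⟩⟩ hl t _ ht
    (hf.add_period hR k) z hz rfl
  · rwa [periodic_int (g := fun ζ => R (l, ζ)) (hR.periodic l)] at this
  · rw [exists_period_shift_re]; exact hM t f ht hf z hz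

theorem LogData.neg (hR : LogData R) : LogData (fun p => -R (p.1, -p.2)) where
  smooth := (hR.smooth.comp (contDiff_fst.prodMk contDiff_snd.neg)).neg
  periodic l ζ := by
    have := hR.periodic l (-ζ - 2 * Real.pi * I)
    rw [sub_add_cancel] at this
    simp only
    rw [this, neg_add, ← sub_eq_add_neg]
  grad l hl ζ := by
    have h1 : HasFDerivAt (fun p : ℂ × ℂ => -R (p.1, -p.2))
        (-((fderiv ℝ R (l, -ζ)).comp ((ContinuousLinearMap.fst ℝ ℂ ℂ).prod
          (-ContinuousLinearMap.snd ℝ ℂ ℂ)))) (l, ζ) :=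
      ((hR.hasFDerivAt (l, -ζ)).comp (l, ζ)
        (hasFDerivAt_fst.prodMk hasFDerivAt_snd.neg)).neg
    have h2 : gradN (fun p : ℂ × ℂ => -R (p.1, -p.2)) (l, ζ) = gradN R (l, -ζ) := by
      have e : ∀ v : ℂ, fderiv ℝ (fun p : ℂ × ℂ => -R (p.1, -p.2)) (l, ζ) (0, v)
          = fderiv ℝ R (l, -ζ) (0, v) := fun v => by
        have e2 : ((0 : ℂ), -v) = -((0 : ℂ), v) := by rw [Prod.neg_mk, neg_zero]
        rw [h1.fderiv]
        change -(fderiv ℝ R (l, -ζ) (0, -v)) = _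
        rw [e2, map_neg, neg_neg]
      simp only [gradN, e]
    rw [h2]; exact hR.grad l hl _
  top T := by
    obtain ⟨M, hM⟩ := hR.bot (-T)
    exact ⟨M, fun l hl ζ h => by have := hM l hl (-ζ) (by simpa using h); simp only; linarith⟩
  bot T := by
    obtain ⟨M, hM⟩ := hR.top (-T)
    exact ⟨M, fun l hl ζ h => by
      have := hM l hl (-ζ) (by rw [neg_re]; linarith); simp only; linarith⟩

theorem boundary_estimate (hR : LogData R) {T : ℝ} (hT : 0 ≤ T) :
    ∃ κ : ℝ, 0 < κ ∧ κ < 1 ∧ ∃ C ≥ 0, ∀ t f, |t| ≤ T → Sol R t f → ∀ z ∈ closedBall (0 : ℂ) 1,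
      ∀ l ∈ sphere (0 : ℂ) 1, |R (l, f z) - t| ≤ C * (‖z - l‖ / 2) ^ κ := by
  obtain ⟨κ, h1, h2, C, h3, h4⟩ := boundary_upper hR hT
  obtain ⟨κ', h1', h2', C', h3', h4'⟩ := boundary_upper hR.neg hT
  refine ⟨min κ κ', lt_min h1 h1', (min_le_left _ _).trans_lt h2, C + C', by positivity, ?_⟩
  intro t f ht hf z hz l hl
  have hx : ‖z - l‖ / 2 ≤ 1 := by
    have := norm_sub_le z l
    have h5 : ‖z‖ ≤ 1 := by simpa using hz
    have h6 : ‖l‖ = 1 := by simpa using hl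
    linarith
  have hx0 : 0 ≤ ‖z - l‖ / 2 := by positivity
  have hm : 0 ≤ min κ κ' := le_min h1.le h1'.le
  have e1 := Real.rpow_le_rpow_of_exponent_ge' hx0 hx hm (min_le_left κ κ')
  have e2 := Real.rpow_le_rpow_of_exponent_ge' hx0 hx hm (min_le_right κ κ')
  have e3 : 0 ≤ (‖z - l‖ / 2) ^ (min κ κ') := by positivity
  have a := h4 t f ht hf z hz l hl
  have b := h4' (-t) (fun z => -f z) (by rwa [abs_neg]) ⟨⟨hf.1.1.neg, hf.1.2.neg⟩, fun l hl => by
    simp [hf.2 l hl]⟩ z hz l hl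
  simp only [neg_neg] at b
  rw [abs_le]
  constructor <;> nlinarith

theorem periodic_bound {E : Type*} [NormedAddCommGroup E] {g : ℂ × ℂ → E} (hc : Continuous g)
    (hp : ∀ l ζ, g (l, ζ + 2 * Real.pi * I) = g (l, ζ)) (M : ℝ) :
    ∃ K ≥ 0, ∀ l ∈ closedBall (0 : ℂ) 1, ∀ ζ : ℂ, |ζ.re| ≤ M → ‖g (l, ζ)‖ ≤ K := by
  obtain ⟨K, hK⟩ := ((isCompact_closedBall (0 : ℂ) 1).prod
    (isCompact_rect M Real.pi)).exists_bound_of_continuousOn hc.continuousOn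
  refine ⟨max K 0, le_max_right _ _, fun l hl ζ h => le_max_of_le_left ?_⟩
  obtain ⟨k, hk⟩ := exists_period_shift ζ
  have := hK (l, ζ + k * (2 * Real.pi * I)) ⟨hl, mem_rect.2 ⟨by rwa [exists_period_shift_re], hk⟩⟩
  rwa [periodic_int (g := fun ζ => g (l, ζ)) (hp l)] at this

theorem fderiv_periodic {E : Type*} [NormedAddCommGroup E] [NormedSpace ℝ E] {g : ℂ × ℂ → E}
    (hp : ∀ l ζ, g (l, ζ + 2 * Real.pi * I) = g (l, ζ)) (l ζ : ℂ) :
    fderiv ℝ g (l, ζ + 2 * Real.pi * I) = fderiv ℝ g (l, ζ) := by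
  have h : (fun p : ℂ × ℂ => g (p + (0, 2 * Real.pi * I))) = g := by
    ext ⟨a, b⟩; simpa using hp a b
  have h2 : fderiv ℝ g ((l, ζ) + (0, 2 * Real.pi * I)) = fderiv ℝ g (l, ζ) := by
    rw [← fderiv_comp_add_right, h]
  rwa [Prod.mk_add_mk, add_zero] at h2

theorem convex_band (M : ℝ) : Convex ℝ {ζ : ℂ | |ζ.re| ≤ M} := by
  have : {ζ : ℂ | |ζ.re| ≤ M} = reCLM ⁻¹' (Icc (-M) M) := by
    ext ζ; simp [abs_le]
  rw [this]
  exact (convex_Icc _ _).is_linear_preimage reLm.isLinear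

theorem lipschitz_of_periodic {E : Type*} [NormedAddCommGroup E] [NormedSpace ℝ E] {g : ℂ × ℂ → E}
    (hg : ContDiff ℝ 1 g) (hp : ∀ l ζ, g (l, ζ + 2 * Real.pi * I) = g (l, ζ)) (M : ℝ) :
    ∃ K ≥ 0, ∀ p q : ℂ × ℂ, p.1 ∈ closedBall (0 : ℂ) 1 → q.1 ∈ closedBall (0 : ℂ) 1 →
      |p.2.re| ≤ M → |q.2.re| ≤ M → ‖g p - g q‖ ≤ K * ‖p - q‖ := by
  obtain ⟨K, hK0, hK⟩ := periodic_bound (hg.continuous_fderiv (by norm_num)) (fderiv_periodic hp) M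
  refine ⟨K, hK0, fun p q h1 h2 h3 h4 => ?_⟩
  exact ((convex_closedBall (0 : ℂ) 1).prod
    (convex_band M)).norm_image_sub_le_of_norm_hasFDerivWithin_le
    (fun x _ => (hg.differentiable (by norm_num) x).hasFDerivAt.hasFDerivWithinAt)
    (fun x hx => hK x.1 hx.1 x.2 hx.2) ⟨h2, h4⟩ ⟨h1, h3⟩

theorem exists_quadratic (hR : LogData R) (M : ℝ) : ∃ A ≥ 0, ∀ l ∈ sphere (0 : ℂ) 1, ∀ ζ h : ℂ,
    |ζ.re| ≤ M → |(ζ + h).re| ≤ M →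
      |R (l, ζ + h) - R (l, ζ) - (gradN R (l, ζ) * h).re| ≤ A * ‖h‖ ^ 2 := by
  obtain ⟨A, hA0, hA⟩ := lipschitz_of_periodic ((contDiff_gradN hR).of_le (by norm_num))
    (gradN_periodic hR) M
  refine ⟨A, hA0, fun l hl ζ h h1 h2 => ?_⟩
  have hl' := sphere_subset_closedBall hl
  have hd : ∀ x : ℝ, HasDerivAt (fun x : ℝ => R (l, ζ + x * h) - x * (gradN R (l, ζ) * h).re)
      ((gradN R (l, ζ + x * h) * h).re - (gradN R (l, ζ) * h).re) x := by
    intro x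
    have e : HasDerivAt (fun x : ℝ => ζ + x * h) h x := by
      simpa using ((hasDerivAt_id x).ofReal_comp.mul_const h).const_add ζ
    exact ((hR.hasDerivAt_comp (l := l) e).sub
      ((hasDerivAt_id' x).mul_const (gradN R (l, ζ) * h).re)).congr_deriv (by rw [one_mul])
  have := norm_image_sub_le_of_norm_deriv_le_segment_01' (C := A * ‖h‖ ^ 2)
    (fun x _ => (hd x).hasDerivWithinAt) (fun x hx => by
      rw [← sub_re, ← sub_mul]
      refine (abs_re_le_norm _).trans ?_
      rw [norm_mul, pow_two, ← mul_assoc]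
      refine mul_le_mul_of_nonneg_right ?_ (norm_nonneg _)
      have hm : |(ζ + x * h).re| ≤ M := by
        have := convex_band M h1 h2 (a := 1 - x) (b := x) (by linarith [hx.2]) hx.1 (by ring)
        have e : (1 - x) • ζ + x • (ζ + h) = ζ + x * h := by
          simp only [real_smul]; push_cast; ring
        rwa [e] at this
      refine (hA (l, ζ + x * h) (l, ζ) hl' hl' hm h1).trans ?_
      refine mul_le_mul_of_nonneg_left ?_ hA0
      rw [Prod.mk_sub_mk, Prod.norm_mk, sub_self, norm_zero, add_sub_cancel_left,
        max_eq_right (norm_nonneg _), norm_mul, norm_real, Real.norm_of_nonneg hx.1]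
      nlinarith [norm_nonneg h, hx.2])
  simp only [ofReal_one, one_mul, ofReal_zero, zero_mul, add_zero, sub_zero,
      Real.norm_eq_abs] at this
  rwa [sub_right_comm] at this

theorem norm_deriv_le_of_abs_re_le {G : ℂ → ℂ} {s m : ℝ} (hs : 0 < s) (hm : 0 < m)
    (hG : DifferentiableOn ℂ G (ball 0 s)) (h0 : G 0 = 0) (hb : ∀ w ∈ ball (0 : ℂ) s,
        |(G w).re| ≤ m) :
    ‖deriv G 0‖ ≤ 4 * m / s := by
  have hsub : closedBall (0 : ℂ) (s / 2) ⊆ ball 0 s := closedBall_subset_ball (by linarith)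
  have h1 : ∀ w ∈ sphere (0 : ℂ) (s / 2), ‖G w‖ ≤ 2 * m := by
    intro w hw
    have hw' : ‖w‖ = s / 2 := by simpa using hw
    have := borelCaratheodory_zero hm hG (fun w hw => (abs_le.1 (hb w hw)).2) hs
      (hsub (sphere_subset_closedBall hw)) h0
    rw [hw'] at this
    refine this.trans (le_of_eq ?_)
    field_simp
    ring
  have h2 := norm_deriv_le_of_forall_mem_sphere_norm_le (half_pos hs)
    (hG.diffContOnCl_ball hsub) h1
  refine h2.trans (le_of_eq ?_)
  field_simp
  ring

theorem exists_inv_gradN_bound (hR : LogData R) (M : ℝ) : ∃ B > 0, ∀ l ∈ sphere (0 : ℂ) 1,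
    ∀ ζ : ℂ, |ζ.re| ≤ M → 1 ≤ B * ‖gradN R (l, ζ)‖ := by
  have hc : ContinuousOn (fun p : ℂ × ℂ => (gradN R p)⁻¹)
      (sphere (0 : ℂ) 1 ×ˢ rect M Real.pi) :=
    (contDiff_gradN hR).continuous.continuousOn.inv₀ fun p hp => hR.grad _ hp.1 _
  obtain ⟨B, hB⟩ := ((isCompact_sphere (0 : ℂ) 1).prod
    (isCompact_rect M Real.pi)).exists_bound_of_continuousOn hc
  refine ⟨max B 1, lt_max_of_lt_right one_pos, fun l hl ζ hζ => ?_⟩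
  obtain ⟨k, hk⟩ := exists_period_shift ζ
  have := hB (l, ζ + k * (2 * Real.pi * I)) ⟨hl, mem_rect.2 ⟨by rwa [exists_period_shift_re], hk⟩⟩
  rw [periodic_int (g := fun ζ => gradN R (l, ζ)) (gradN_periodic hR l), norm_inv] at this
  have hn : 0 < ‖gradN R (l, ζ)‖ := norm_pos_iff.2 (hR.grad l hl ζ)
  rw [inv_le_iff_one_le_mul₀ hn] at this
  exact this.trans (mul_le_mul_of_nonneg_right (le_max_left _ _) hn.le)

theorem uniform_holder (hR : LogData R) {T : ℝ} (hT : 0 ≤ T) :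
    ∃ κ : ℝ, 0 < κ ∧ κ < 1 ∧ ∃ C ≥ 0, ∀ t f, |t| ≤ T → Sol R t f →
      HolBd κ C f (closedBall 0 1) := by
  obtain ⟨M, hM0, hM⟩ := Sol.exists_re_bound hR T
  obtain ⟨κ, hκ0, hκ1, C, hC0, hC⟩ := boundary_estimate hR hT
  obtain ⟨A, hA0, hA⟩ := exists_quadratic hR M
  obtain ⟨B, hB0, hB⟩ := exists_inv_gradN_bound hR M
  set K := 4 * (2 * M + 1) with hK
  set D := 2 * C + A * K ^ 2 + 1 with hD
  have hD0 : 0 < D := by positivity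
  refine ⟨κ / 2, by linarith, by linarith, B * (8 * D) * (2 * (2 ^ (1 - κ / 2) / (κ / 2)) + 1),
    by positivity, fun t f ht hf => ?_⟩
  refine HolBd.closedBall (by linarith) (HolBd.of_deriv (f' := deriv f) (by linarith) (by linarith)
    (by positivity) (fun z hz => (hf.1.2.differentiableAt (isOpen_ball.mem_nhds hz)).hasDerivAt)
    fun z hz => ?_) hf.1.1
  have hz1 : ‖z‖ < 1 := by simpa using hz
  obtain ⟨l, hl, hzl⟩ : ∃ l ∈ sphere (0 : ℂ) 1, ‖z - l‖ = 1 - ‖z‖ := by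
    rcases eq_or_ne z 0 with rfl | h0
    · exact ⟨1, by simp, by simp⟩
    · have hn : (‖z‖ : ℂ) ≠ 0 := by simpa using h0
      refine ⟨z / ‖z‖, by simp [h0], ?_⟩
      have : z - z / ‖z‖ = -(z / ‖z‖) * ((1 - ‖z‖ : ℝ) : ℂ) := by
        push_cast; field_simp; ring
      rw [this, norm_mul, norm_neg, norm_div, norm_real, norm_norm, div_self (by simpa using h0),
        one_mul, norm_real, Real.norm_of_nonneg (by linarith)]
  set d := 1 - ‖z‖ with hd
  have hd0 : 0 < d := by linarith
  have hd1 : d ≤ 1 := by linarith [norm_nonneg z]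
  have hmem : ∀ w ∈ ball (0 : ℂ) d, z + w ∈ ball (0 : ℂ) 1 := by
    intro w hw
    have h1 : ‖w‖ < d := by simpa using hw
    have := norm_add_le z w
    rw [mem_ball_zero_iff]; linarith
  set φ : ℂ → ℂ := fun w => f (z + w) - f z with hφ
  have hφd : DifferentiableOn ℂ φ (ball 0 d) :=
    (hf.1.2.comp (by fun_prop) hmem).sub_const _
  have hφ0 : φ 0 = 0 := by simp [hφ]
  have hzM := hM t f ht hf z (ball_subset_closedBall hz)
  have hφM : ∀ w ∈ ball (0 : ℂ) d, (φ w).re ≤ 2 * M + 1 := by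
    intro w hw
    have := hM t f ht hf _ (ball_subset_closedBall (hmem w hw))
    rw [abs_le] at this hzM
    simp only [hφ, sub_re]; linarith
  have hφb : ∀ w : ℂ, ‖w‖ ≤ d / 2 → ‖φ w‖ ≤ K * (‖w‖ / d) := by
    intro w hw
    have := borelCaratheodory_zero (M := 2 * M + 1) (by positivity) hφd hφM hd0
      (by rw [mem_ball_zero_iff]; linarith) hφ0
    refine this.trans ?_
    rw [div_le_iff₀ (by linarith), hK]
    have e : 4 * (2 * M + 1) * (‖w‖ / d) * (d - ‖w‖) =
      2 * (2 * M + 1) * ‖w‖ * (2 * (d - ‖w‖) / d) := by ring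
    rw [e]
    refine le_mul_of_one_le_right (by positivity) ?_
    rw [one_le_div hd0]; linarith
  set N := gradN R (l, f z) with hN
  set r := d * d ^ (κ / 2) / 2 with hr
  have hdp : 0 < d ^ (κ / 2) := Real.rpow_pos_of_pos hd0 _
  have hdp1 : d ^ (κ / 2) ≤ 1 := Real.rpow_le_one hd0.le hd1 (by linarith)
  have hdsq : d ^ κ = d ^ (κ / 2) * d ^ (κ / 2) := by
    rw [← Real.rpow_add hd0]; ring_nf
  have hr0 : 0 < r := by positivity
  have hrd : r ≤ d / 2 := by
    rw [hr]; gcongr; exact mul_le_of_le_one_right hd0.le hdp1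
  have hbd : ∀ w : ℂ, ‖w‖ < d → |R (l, f (z + w)) - t| ≤ C * d ^ κ := by
    intro w hw
    refine (hC t f ht hf _ (ball_subset_closedBall (hmem w (by simpa using hw))) l hl).trans ?_
    have : ‖z + w - l‖ / 2 ≤ d := by
      have := norm_add_le (z - l) w
      rw [show z + w - l = z - l + w by ring]; linarith
    gcongr
  have hG := norm_deriv_le_of_abs_re_le (G := fun w => N * φ w) (m := D * d ^ κ) hr0 (by positivity)
    ((hφd.mono (ball_subset_ball (by linarith))).const_mul N) (by simp [hφ0]) (by
      intro w hw
      have hw' : ‖w‖ < r := by simpa using hw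
      have a1 := hbd w (by linarith)
      have a2 := hbd 0 (by simpa using hd0)
      rw [add_zero] at a2
      have hwM := hM t f ht hf _ (ball_subset_closedBall (hmem w (by
        rw [mem_ball_zero_iff]; linarith)))
      have e : f z + φ w = f (z + w) := by simp [hφ]
      have a3 := hA l hl (f z) (φ w) hzM (by rwa [e])
      rw [e] at a3
      have a4 := hφb w (by linarith)
      have a5 : K * (‖w‖ / d) ≤ K * d ^ (κ / 2) := by
        have : ‖w‖ / d ≤ d ^ (κ / 2) := by
          rw [div_le_iff₀ hd0]
          have : d * d ^ (κ / 2) / 2 ≤ d * d ^ (κ / 2) := by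
            have : 0 < d * d ^ (κ / 2) := by positivity
            linarith
          linarith
        have hK0 : 0 ≤ K := by positivity
        gcongr
      have a6 : ‖φ w‖ ^ 2 ≤ K ^ 2 * d ^ κ := by
        rw [hdsq]
        calc ‖φ w‖ ^ 2 ≤ (K * d ^ (κ / 2)) ^ 2 := by
              have := a4.trans a5
              gcongr
          _ = _ := by ring
      have a7 : A * ‖φ w‖ ^ 2 ≤ A * (K ^ 2 * d ^ κ) := by gcongr
      have hdk : 0 < d ^ κ := Real.rpow_pos_of_pos hd0 _
      rw [abs_le] at a1 a2 a3 ⊢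
      simp only [hD]
      constructor <;> nlinarith)
  have hder : deriv (fun w => N * φ w) 0 = N * deriv f z := by
    have h1 : HasDerivAt f (deriv f z) (z + 0) := by
      rw [add_zero]
      exact (hf.1.2.differentiableAt (isOpen_ball.mem_nhds hz)).hasDerivAt
    exact (((h1.comp_const_add z 0).sub_const (f z)).const_mul N).deriv
  rw [hder, norm_mul] at hG
  have hB' := hB l hl (f z) hzM
  have h3 : 4 * (D * d ^ κ) / r = 8 * D * d ^ (κ / 2 - 1) := by
    rw [Real.rpow_sub_one hd0.ne', hr, hdsq]
    field_simp
    ring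
  calc ‖deriv f z‖ ≤ B * ‖N‖ * ‖deriv f z‖ := le_mul_of_one_le_left (norm_nonneg _) hB'
    _ = B * (‖N‖ * ‖deriv f z‖) := by ring
    _ ≤ B * (8 * D * d ^ (κ / 2 - 1)) := by rw [← h3]; gcongr
    _ = _ := by ring

/-- `f` is bounded and `κ`-Hölder on `s`. -/
def HolMem {V : Type*} [NormedAddCommGroup V] (κ : ℝ) (f : ℂ → V) (s : Set ℂ) : Prop :=
  ∃ C ≥ 0, HolBd κ C f s ∧ ∀ x ∈ s, ‖f x‖ ≤ C

section
variable {V W : Type*} [NormedAddCommGroup V] [NormedAddCommGroup W] {κ : ℝ} {s : Set ℂ}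

theorem HolMem.congr {f g : ℂ → V} (hf : HolMem κ f s) (h : EqOn g f s) : HolMem κ g s := by
  obtain ⟨C, h0, h1, h2⟩ := hf
  exact ⟨C, h0, fun x hx y hy => by rw [h hx, h hy]; exact h1 x hx y hy,
    fun x hx => by rw [h hx]; exact h2 x hx⟩

theorem HolMem.mono {s' : Set ℂ} {f : ℂ → V} (hf : HolMem κ f s) (h : s' ⊆ s) : HolMem κ f s' := by
  obtain ⟨C, h0, h1, h2⟩ := hf
  exact ⟨C, h0, fun x hx y hy => h1 x (h hx) y (h hy), fun x hx => h2 x (h hx)⟩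

theorem HolMem.continuousOn {f : ℂ → V} (hf : HolMem κ f s) (hκ : 0 < κ) : ContinuousOn f s := by
  obtain ⟨C, -, h1, -⟩ := hf
  exact h1.continuousOn hκ

theorem HolMem.const (c : V) : HolMem κ (fun _ => c) s :=
  ⟨‖c‖, norm_nonneg _, fun x _ y _ => by
    rw [sub_self, norm_zero]; positivity, fun _ _ => le_rfl⟩

theorem HolMem.add {f g : ℂ → V} (hf : HolMem κ f s) (hg : HolMem κ g s) :
    HolMem κ (fun x => f x + g x) s := by
  obtain ⟨C, h0, h1, h2⟩ := hf
  obtain ⟨D, k0, k1, k2⟩ := hg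
  refine ⟨C + D, by positivity, fun x hx y hy => ?_, fun x hx =>
    (norm_add_le _ _).trans (add_le_add (h2 x hx) (k2 x hx))⟩
  rw [add_sub_add_comm, add_mul]
  exact (norm_add_le _ _).trans (add_le_add (h1 x hx y hy) (k1 x hx y hy))

theorem HolMem.neg {f : ℂ → V} (hf : HolMem κ f s) : HolMem κ (fun x => -f x) s := by
  obtain ⟨C, h0, h1, h2⟩ := hf
  refine ⟨C, h0, fun x hx y hy => ?_, fun x hx => by rw [norm_neg]; exact h2 x hx⟩
  rw [neg_sub_neg, norm_sub_rev]; exact h1 x hx y hy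

theorem HolMem.sub {f g : ℂ → V} (hf : HolMem κ f s) (hg : HolMem κ g s) :
    HolMem κ (fun x => f x - g x) s :=
  (hf.add hg.neg).congr fun _ _ => sub_eq_add_neg _ _

theorem HolBd.mul {f g : ℂ → ℂ} {A B a b : ℝ} (hf : HolBd κ A f s) (hg : HolBd κ B g s)
    (ha0 : 0 ≤ a) (ha : ∀ x ∈ s, ‖f x‖ ≤ a) (hb : ∀ x ∈ s, ‖g x‖ ≤ b) :
    HolBd κ (a * B + A * b) (fun x => f x * g x) s := fun x hx y hy => by
  have e : f x * g x - f y * g y = f x * (g x - g y) + (f x - f y) * g y := by ring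
  rw [e]
  refine (norm_add_le _ _).trans ?_
  rw [norm_mul, norm_mul, add_mul]
  refine add_le_add ?_ ?_
  · rw [mul_assoc]
    exact mul_le_mul (ha x hx) (hg x hx y hy) (norm_nonneg _) ha0
  · rw [mul_right_comm]
    exact mul_le_mul (hf x hx y hy) (hb y hy) (norm_nonneg _) ((norm_nonneg _).trans (hf x hx y hy))

theorem HolMem.mul {f g : ℂ → ℂ} (hf : HolMem κ f s) (hg : HolMem κ g s) :
    HolMem κ (fun x => f x * g x) s := by
  obtain ⟨C, h0, h1, h2⟩ := hf
  obtain ⟨D, k0, k1, k2⟩ := hg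
  refine ⟨C * D + C * D, by positivity, h1.mul k1 h0 h2 k2, fun x hx => ?_⟩
  rw [norm_mul]
  have := mul_le_mul (h2 x hx) (k2 x hx) (norm_nonneg _) h0
  have : 0 ≤ C * D := by positivity
  linarith

theorem HolMem.prodMk {f : ℂ → V} {g : ℂ → W} (hf : HolMem κ f s) (hg : HolMem κ g s) :
    HolMem κ (fun x => (f x, g x)) s := by
  obtain ⟨C, h0, h1, h2⟩ := hf
  obtain ⟨D, k0, k1, k2⟩ := hg
  refine ⟨max C D, le_max_of_le_left h0, fun x hx y hy => ?_, fun x hx => ?_⟩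
  · rw [Prod.mk_sub_mk, Prod.norm_mk]
    exact max_le (h1.mono (le_max_left _ _) x hx y hy) (k1.mono (le_max_right _ _) x hx y hy)
  · rw [Prod.norm_mk]
    exact max_le_max (h2 x hx) (k2 x hx)

theorem norm_le_two_mul_rpow (hκ0 : 0 ≤ κ) (hκ1 : κ ≤ 1) {x : ℝ} (h0 : 0 ≤ x) (h2 : x ≤ 2) :
    x ≤ 2 * x ^ κ := by
  rcases h0.eq_or_lt with rfl | h0
  · positivity
  have e1 : (x / 2) ^ (1 : ℝ) ≤ (x / 2) ^ κ :=
    Real.rpow_le_rpow_of_exponent_ge (by positivity) (by linarith) hκ1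
  have e2 : (x / 2) ^ κ ≤ x ^ κ := by gcongr; linarith
  rw [Real.rpow_one] at e1
  linarith

theorem HolMem.id (hκ0 : 0 ≤ κ) (hκ1 : κ ≤ 1) : HolMem κ (fun x => x) (closedBall (0 : ℂ) 1) := by
  refine ⟨2, by norm_num, fun x hx y hy => ?_, fun x hx => ?_⟩
  · rw [mem_closedBall_zero_iff] at hx hy
    exact norm_le_two_mul_rpow hκ0 hκ1 (norm_nonneg _) ((norm_sub_le _ _).trans (by linarith))
  · rw [mem_closedBall_zero_iff] at hx; linarith

theorem HolMem.comp [NormedSpace ℝ V] [NormedSpace ℝ W] {f : ℂ → V} {φ : V → W} (hκ : 0 < κ)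
    (hs : IsCompact s) (hf : HolMem κ f s) (hφ : ∀ x ∈ s, ContDiffAt ℝ 1 φ (f x)) :
    HolMem κ (fun x => φ (f x)) s := by
  have hK : IsCompact (f '' s) := hs.image_of_continuousOn (hf.continuousOn hκ)
  have hl : LocallyLipschitzOn (f '' s) φ := by
    rintro _ ⟨x, hx, rfl⟩
    obtain ⟨K, t, ht, h⟩ := (hφ x hx).exists_lipschitzOnWith
    exact ⟨K, t, mem_nhdsWithin_of_mem_nhds ht, h⟩
  obtain ⟨K, hL⟩ := hl.exists_lipschitzOnWith_of_compact hK
  obtain ⟨B, hB⟩ := hK.exists_bound_of_continuousOn hL.continuousOn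
  obtain ⟨C, h0, h1, h2⟩ := hf
  refine ⟨max (K * C) B, le_max_of_le_left (by positivity), fun x hx y hy => ?_, fun x hx =>
    (hB _ ⟨x, hx, rfl⟩).trans (le_max_right _ _)⟩
  refine (hL.norm_sub_le ⟨x, hx, rfl⟩ ⟨y, hy, rfl⟩).trans ?_
  calc K * ‖f x - f y‖ ≤ K * (C * ‖x - y‖ ^ κ) := by gcongr; exact h1 x hx y hy
    _ = K * C * ‖x - y‖ ^ κ := by ring
    _ ≤ _ := by gcongr; exact le_max_left _ _

end

/-- The ambient Banach space for the Hölder spaces: a bounded function together with its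
weighted difference quotients. -/
abbrev HolAmb (V : Type) [NormedAddCommGroup V] : Type :=
  lp (fun _ : ℂ => V) ∞ × lp (fun _ : ℂ × ℂ => V) ∞

open Classical in
/-- The weight in the Hölder difference quotient on `s`. -/
def holWeight (κ : ℝ) (s : Set ℂ) (x y : ℂ) : ℝ :=
  if x ∈ s ∧ y ∈ s then (‖x - y‖ ^ κ)⁻¹ else 0

/-- The space of bounded `κ`-Hölder functions on `s`. -/
def holSub (κ : ℝ) (s : Set ℂ) (V : Type) [NormedAddCommGroup V] [NormedSpace ℝ V] :
    Submodule ℝ (HolAmb V) where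
  carrier := {p | (∀ x ∉ s, p.1 x = 0) ∧
    ∀ x y, p.2 (x, y) = holWeight κ s x y • (p.1 x - p.1 y)}
  add_mem' := by
    rintro p q ⟨h1, h2⟩ ⟨k1, k2⟩
    refine ⟨fun x hx => ?_, fun x y => ?_⟩
    · change p.1 x + q.1 x = 0
      rw [h1 x hx, k1 x hx, add_zero]
    · change p.2 (x, y) + q.2 (x, y) = _ • (p.1 x + q.1 x - (p.1 y + q.1 y))
      rw [h2, k2, add_sub_add_comm, smul_add]
  zero_mem' := ⟨fun x _ => rfl, fun x y => by
    change (0 : V) = _ • ((0 : V) - 0)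
    simp⟩
  smul_mem' := by
    rintro c p ⟨h1, h2⟩
    refine ⟨fun x hx => ?_, fun x y => ?_⟩
    · change c • p.1 x = 0
      rw [h1 x hx, smul_zero]
    · change c • p.2 (x, y) = _ • (c • p.1 x - c • p.1 y)
      rw [h2, ← smul_sub, smul_comm]

theorem holSub_norm_apply_le {V : Type} [NormedAddCommGroup V] {p : HolAmb V} (x : ℂ) :
    ‖p.1 x‖ ≤ ‖p‖ :=
  (lp.norm_apply_le_norm (by simp) p.1 x).trans (norm_fst_le p)

section
variable {V : Type} [NormedAddCommGroup V] [NormedSpace ℝ V] {κ : ℝ} {s : Set ℂ}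

theorem isClosed_holSub : IsClosed (holSub κ s V : Set (HolAmb V)) := by
  have c1 : ∀ x : ℂ, Continuous fun p : HolAmb V => p.1 x := fun x =>
    (lp.evalCLM ℝ (fun _ : ℂ => V) ∞ x).continuous.comp continuous_fst
  have c2 : ∀ x : ℂ × ℂ, Continuous fun p : HolAmb V => p.2 x := fun x =>
    (lp.evalCLM ℝ (fun _ : ℂ × ℂ => V) ∞ x).continuous.comp continuous_snd
  have e : (holSub κ s V : Set (HolAmb V)) = (⋂ x ∈ sᶜ, {p | p.1 x = 0}) ∩
      ⋂ x, ⋂ y, {p | p.2 (x, y) = holWeight κ s x y • (p.1 x - p.1 y)} := by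
    ext p; simp [holSub]
  rw [e]
  refine (isClosed_biInter fun x _ => isClosed_eq (c1 x) continuous_const).inter
    (isClosed_iInter fun x => isClosed_iInter fun y => isClosed_eq (c2 _) ?_)
  exact continuous_const.smul ((c1 x).sub (c1 y))

theorem holSub_holBd (hκ : 0 < κ) {p : HolAmb V} (hp : p ∈ holSub κ s V) : HolBd κ ‖p‖ p.1 s := by
  intro x hx y hy
  rcases eq_or_ne x y with rfl | hxy
  · simp [Real.zero_rpow hκ.ne']
  have h := (lp.norm_apply_le_norm (by simp) p.2 (x, y)).trans (norm_snd_le p)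
  have h0 : 0 < ‖x - y‖ ^ κ := Real.rpow_pos_of_pos (norm_pos_iff.2 (sub_ne_zero.2 hxy)) _
  rw [hp.2 x y, holWeight, if_pos ⟨hx, hy⟩, norm_smul, norm_inv, Real.norm_of_nonneg h0.le,
    inv_mul_le_iff₀ h0, mul_comm] at h
  exact h

theorem holSub_holMem (hκ : 0 < κ) {p : HolAmb V} (hp : p ∈ holSub κ s V) : HolMem κ p.1 s :=
  ⟨‖p‖, norm_nonneg _, holSub_holBd hκ hp, fun x _ => holSub_norm_apply_le x⟩

theorem holSub_norm_le {p : HolAmb V} (hp : p ∈ holSub κ s V) {C : ℝ} (hC : 0 ≤ C)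
    (h1 : HolBd κ C p.1 s) (h2 : ∀ x ∈ s, ‖p.1 x‖ ≤ C) : ‖p‖ ≤ C := by
  refine max_le (lp.norm_le_of_forall_le hC fun x => ?_) (lp.norm_le_of_forall_le hC ?_)
  · by_cases hx : x ∈ s
    · exact h2 x hx
    · rw [hp.1 x hx, norm_zero]; exact hC
  · rintro ⟨x, y⟩
    rw [hp.2 x y, holWeight]
    split_ifs with h
    · have h0 : 0 ≤ ‖x - y‖ ^ κ := by positivity
      rw [norm_smul, norm_inv, Real.norm_of_nonneg h0]
      refine inv_mul_le_of_le_mul₀ h0 hC ?_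
      rw [mul_comm]
      exact h1 x h.1 y h.2
    · simpa using hC

theorem exists_holSub {u : ℂ → V} (hu : HolMem κ u s) :
    ∃ p ∈ holSub κ s V, ∀ x ∈ s, p.1 x = u x := by
  classical
  obtain ⟨C, h0, h1, h2⟩ := hu
  have m1 : Memℓp (fun x : ℂ => if x ∈ s then u x else 0) ∞ := by
    refine memℓp_infty ⟨C, ?_⟩
    rintro _ ⟨x, rfl⟩
    dsimp only
    split_ifs with h
    · exact h2 x h
    · simpa using h0
  have m2 : Memℓp (fun q : ℂ × ℂ => holWeight κ s q.1 q.2 •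
      ((if q.1 ∈ s then u q.1 else 0) - (if q.2 ∈ s then u q.2 else 0))) ∞ := by
    refine memℓp_infty ⟨C, ?_⟩
    rintro _ ⟨⟨x, y⟩, rfl⟩
    dsimp only
    rw [holWeight]
    split_ifs with h h' h'' h''
    · have h0' : 0 ≤ ‖x - y‖ ^ κ := by positivity
      rw [norm_smul, norm_inv, Real.norm_of_nonneg h0']
      refine inv_mul_le_of_le_mul₀ h0' h0 ?_
      rw [mul_comm]
      exact h1 x h.1 y h.2
    all_goals first | (exfalso; tauto) | simpa using h0
  exact ⟨(⟨_, m1⟩, ⟨_, m2⟩), ⟨fun x hx => if_neg hx, fun x y => rfl⟩, fun x hx => if_pos hx⟩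

theorem holSub_ext {p q : HolAmb V} (hp : p ∈ holSub κ s V) (hq : q ∈ holSub κ s V)
    (h : ∀ x ∈ s, p.1 x = q.1 x) : p = q := by
  have h1 : ∀ x, p.1 x = q.1 x := fun x => by
    by_cases hx : x ∈ s
    · exact h x hx
    · rw [hp.1 x hx, hq.1 x hx]
  refine Prod.ext (lp.ext (funext h1)) (lp.ext (funext fun ⟨x, y⟩ => ?_))
  rw [hp.2, hq.2, h1, h1]

end

theorem HolBd.holMem {V : Type*} [NormedAddCommGroup V] {κ C : ℝ} {f : ℂ → V} (hκ : 0 < κ)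
    (h : HolBd κ C f (Metric.closedBall (0 : ℂ) 1)) : HolMem κ f (Metric.closedBall (0 : ℂ) 1) := by
  obtain ⟨B, hB⟩ := (isCompact_closedBall (0 : ℂ) 1).exists_bound_of_continuousOn
    (h.continuousOn hκ)
  exact ⟨max (max C B) 0, le_max_right _ _, h.mono ((le_max_left _ _).trans (le_max_left _ _)),
    fun x hx => (hB x hx).trans ((le_max_right _ _).trans (le_max_left _ _))⟩

theorem re_le_of_sphere {q : ℂ → ℂ} {a : ℝ} (hc : ContinuousOn q (closedBall (0 : ℂ) 1))
    (hd : DifferentiableOn ℂ q (ball (0 : ℂ) 1)) (h : ∀ l ∈ sphere (0 : ℂ) 1, (q l).re ≤ a) :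
    ∀ z ∈ closedBall (0 : ℂ) 1, (q z).re ≤ a := by
  intro z hz
  have := norm_le_of_sphere (q := fun z => exp (q z)) (m := Real.exp a)
    (continuous_exp.comp_continuousOn hc) hd.cexp (fun l hl => by
      rw [norm_exp]; exact Real.exp_le_exp.2 (h l hl)) z hz
  rw [norm_exp] at this
  exact Real.exp_le_exp.1 this

theorem le_re_of_sphere {q : ℂ → ℂ} {a : ℝ} (hc : ContinuousOn q (closedBall (0 : ℂ) 1))
    (hd : DifferentiableOn ℂ q (ball (0 : ℂ) 1)) (h : ∀ l ∈ sphere (0 : ℂ) 1, a ≤ (q l).re) :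
    ∀ z ∈ closedBall (0 : ℂ) 1, a ≤ (q z).re := by
  intro z hz
  have := re_le_of_sphere (a := -a) hc.neg hd.neg (fun l hl => by
    simpa using h l hl) z hz
  simpa using this

theorem eq_of_re_sphere {q : ℂ → ℂ} {a : ℝ} (hc : ContinuousOn q (closedBall (0 : ℂ) 1))
    (hd : DifferentiableOn ℂ q (ball (0 : ℂ) 1)) (h : ∀ l ∈ sphere (0 : ℂ) 1, (q l).re = a) :
    ∀ z ∈ closedBall (0 : ℂ) 1, q z = q 0 := by
  have hb : ∀ z ∈ ball (0 : ℂ) 1, q z = q 0 := by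
    have hre : ∀ z ∈ closedBall (0 : ℂ) 1, (q z).re = a := fun z hz =>
      le_antisymm (re_le_of_sphere hc hd (fun l hl => (h l hl).le) z hz)
        (le_re_of_sphere hc hd (fun l hl => (h l hl).ge) z hz)
    intro z hz
    have hz1 : ‖z‖ < 1 := by simpa using hz
    have hlim : ∀ M > 0, ‖q z - q 0‖ ≤ M * (2 * ‖z‖ / (1 - ‖z‖)) := by
      intro M hM
      have := borelCaratheodory_zero (f := fun z => q z - q 0) hM (hd.sub_const _) (fun w hw => by
        change (q w - q 0).re ≤ M
        rw [sub_re, hre w (ball_subset_closedBall hw), hre 0 (by simp), sub_self]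
        exact hM.le) one_pos hz (sub_self _)
      refine this.trans (le_of_eq (by ring))
    rw [← sub_eq_zero, ← norm_le_zero_iff]
    refine le_of_forall_pos_le_add fun ε hε => ?_
    have hk : 0 ≤ 2 * ‖z‖ / (1 - ‖z‖) := div_nonneg (by positivity) (by linarith)
    have := hlim (ε / (2 * ‖z‖ / (1 - ‖z‖) + 1)) (by positivity)
    rw [zero_add]
    refine this.trans ?_
    rw [div_mul_eq_mul_div, div_le_iff₀ (by positivity)]
    nlinarith
  have hcl : EqOn q (fun _ => q 0) (closure (ball (0 : ℂ) 1)) := by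
    refine EqOn.of_subset_closure (t := closedBall (0 : ℂ) 1) (s := ball (0 : ℂ) 1) hb hc
      continuousOn_const ball_subset_closedBall ?_ |>.mono ?_
    · rw [closure_ball _ one_ne_zero]
    · rw [closure_ball _ one_ne_zero]
  rw [closure_ball _ one_ne_zero] at hcl
  exact hcl

/-- `q` has a Hölder continuous logarithm on `s`. -/
def HasLog (κ : ℝ) (q : ℂ → ℂ) (s : Set ℂ) : Prop :=
  ∃ n, HolMem κ n s ∧ ∀ x ∈ s, q x = exp (n x)

theorem HasLog.of_near {κ : ℝ} {p q : ℂ → ℂ} {s : Set ℂ} (hκ : 0 < κ) (hs : IsCompact s)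
    (hq : HasLog κ q s) (hp : HolMem κ p s) (h : ∀ x ∈ s, ‖p x - q x‖ < ‖q x‖) :
    HasLog κ p s := by
  obtain ⟨n, hn, hqn⟩ := hq
  have hexp : HolMem κ (fun x => exp (-n x)) s :=
    hn.neg.comp (φ := exp) hκ hs fun x _ => contDiff_exp.contDiffAt
  have hslit : ∀ x ∈ s, p x * exp (-n x) ∈ slitPlane := by
    intro x hx
    refine mem_slitPlane_of_norm_lt_one (z := p x * exp (-n x) - 1) ?_ |> fun h => by
      simpa using h
    have h1 : p x * exp (-n x) - 1 = (p x - q x) * exp (-n x) := by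
      rw [sub_mul, hqn x hx, ← exp_add, add_neg_cancel, exp_zero]
    have h2 := h x hx
    rw [h1, norm_mul]
    rw [hqn x hx] at h2 ⊢
    have h3 : ‖exp (n x)‖ * ‖exp (-n x)‖ = 1 := by
      rw [← norm_mul, ← exp_add, add_neg_cancel, exp_zero, norm_one]
    rw [← h3]
    exact mul_lt_mul_of_pos_right h2 (norm_pos_iff.2 (exp_ne_zero _))
  refine ⟨fun x => n x + log (p x * exp (-n x)), hn.add ((hp.mul hexp).comp hκ hs fun x hx =>
    (contDiffAt_log (hslit x hx)).restrict_scalars ℝ), fun x hx => ?_⟩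
  rw [exp_add, exp_log (slitPlane_ne_zero (hslit x hx)), mul_left_comm, ← exp_add, add_neg_cancel,
    exp_zero, mul_one]

/-- Near `-∞` the defining function is the standard one. -/
def StdEnd (R : ℂ × ℂ → ℝ) : Prop :=
  ∃ M₀ : ℝ, ∀ l ∈ sphere (0 : ℂ) 1, ∀ ζ : ℂ, ζ.re ≤ M₀ → R (l, ζ) = 2 * ζ.re

theorem gradN_stdEnd (hR : LogData R) {M₀ : ℝ}
    (h : ∀ l ∈ sphere (0 : ℂ) 1, ∀ ζ : ℂ, ζ.re ≤ M₀ → R (l, ζ) = 2 * ζ.re) {l ζ : ℂ}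
    (hl : l ∈ sphere (0 : ℂ) 1) (hζ : ζ.re < M₀) : gradN R (l, ζ) = 2 := by
  have key : ∀ v : ℂ, (gradN R (l, ζ) * v).re = 2 * v.re := by
    intro v
    have h1 : HasDerivAt (fun x : ℝ => ζ + x * v) v 0 := by
      simpa using ((hasDerivAt_id (0 : ℝ)).ofReal_comp.mul_const v).const_add ζ
    have h2 := hR.hasDerivAt_comp (l := l) h1
    simp only [ofReal_zero, zero_mul, add_zero] at h2
    have h3 : HasDerivAt (fun x : ℝ => 2 * (ζ.re + x * v.re)) (2 * v.re) 0 := by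
      simpa using (((hasDerivAt_id (0 : ℝ)).mul_const v.re).const_add ζ.re).const_mul 2
    refine h2.unique (h3.congr_of_eventuallyEq ?_)
    have hc : ContinuousAt (fun x : ℝ => (ζ + x * v).re) 0 := by fun_prop
    filter_upwards [hc.eventually_lt (continuousAt_const (y := M₀)) (by simpa using hζ)] with x hx
    rw [h l hl _ hx.le]
    simp
  have h1 := key 1
  have h2 := key I
  apply Complex.ext
  · simpa using h1
  · simpa using h2

theorem hasLog_gradN (hR : LogData R) (hE : StdEnd R) {κ : ℝ} (hκ0 : 0 < κ) (hκ1 : κ ≤ 1)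
    {f : ℂ → ℂ} (hf : HolMem κ f (closedBall (0 : ℂ) 1)) :
    HasLog κ (fun l => gradN R (l, f l)) (sphere (0 : ℂ) 1) := by
  have hf' := hf.mono (sphere_subset_closedBall (x := (0 : ℂ)) (ε := 1))
  obtain ⟨M, hM0, -, hM⟩ := id hf'
  obtain ⟨M₀, hM₀⟩ := hE
  set M₁ := M + |M₀| + 1 with hM₁
  set L := 2 * M₁ with hL
  obtain ⟨K, hK0, hK⟩ := lipschitz_of_periodic ((contDiff_gradN hR).of_le (by norm_num))
    (gradN_periodic hR) (M + L)
  obtain ⟨B, hB0, hB⟩ := exists_inv_gradN_bound hR (M + L)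
  obtain ⟨n, hn⟩ := exists_nat_gt (L * K * B)
  set m : ℝ := n + 1 with hm
  have hm0 : 0 < m := by positivity
  have hL0 : 0 ≤ L := by positivity
  have hre : ∀ j : ℕ, (j : ℝ) ≤ m → ∀ l ∈ sphere (0 : ℂ) 1,
      |(f l - ((j / m * L : ℝ) : ℂ)).re| ≤ M + L := by
    intro j hj l hl
    have h1 := (abs_re_le_norm (f l)).trans (hM l hl)
    have h2 : j / m * L ≤ L := mul_le_of_le_one_left hL0 (by rwa [div_le_one hm0])
    have h3 : 0 ≤ j / m * L := by positivity
    rw [abs_le] at h1 ⊢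
    rw [sub_re, ofReal_re]
    constructor <;> linarith
  have main : ∀ i : ℕ, i ≤ n + 1 → HasLog κ
      (fun l => gradN R (l, f l - (((n + 1 - i : ℕ) / m * L : ℝ) : ℂ))) (sphere (0 : ℂ) 1) := by
    intro i
    induction i with
    | zero =>
      intro _
      refine ⟨fun _ => log 2, HolMem.const _, fun l hl => ?_⟩
      rw [exp_log two_ne_zero]
      refine gradN_stdEnd hR hM₀ hl ?_
      have h1 := (re_le_norm (f l)).trans (hM l hl)
      have h2 : ((n + 1 - 0 : ℕ) : ℝ) / m * L = L := by
        rw [Nat.sub_zero, Nat.cast_add_one, ← hm, div_self hm0.ne', one_mul]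
      rw [h2, sub_re, ofReal_re]
      have := neg_abs_le M₀
      linarith
    | succ i ih =>
      intro hi
      refine (ih (by omega)).of_near hκ0 (isCompact_sphere _ _) ?_ fun l hl => ?_
      · exact (((HolMem.id hκ0.le hκ1).mono sphere_subset_closedBall).prodMk
          (hf'.sub (HolMem.const _))).comp (φ := gradN R) hκ0 (isCompact_sphere _ _)
          fun x _ => ((contDiff_gradN hR).of_le (by norm_num)).contDiffAt
      · have hj : ((n + 1 - i : ℕ) : ℝ) = (n + 1 - (i + 1) : ℕ) + 1 := by
          have : n + 1 - i = n + 1 - (i + 1) + 1 := by omega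
          exact_mod_cast this
        have hjm : ((n + 1 - i : ℕ) : ℝ) ≤ m := by
          rw [hm]; exact_mod_cast Nat.sub_le _ _
        have l1 := sphere_subset_closedBall hl
        have a1 := hK (l, f l - (((n + 1 - (i + 1) : ℕ) / m * L : ℝ) : ℂ))
          (l, f l - (((n + 1 - i : ℕ) / m * L : ℝ) : ℂ)) l1 l1
          (hre _ (by linarith) l hl) (hre _ hjm l hl)
        have a2 := hB l hl _ (hre _ hjm l hl)
        have a3 : ‖((l, f l - (((n + 1 - (i + 1) : ℕ) / m * L : ℝ) : ℂ)) : ℂ × ℂ) -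
            (l, f l - (((n + 1 - i : ℕ) / m * L : ℝ) : ℂ))‖ = L / m := by
          rw [Prod.mk_sub_mk, Prod.norm_mk, sub_self, norm_zero, sub_sub_sub_cancel_left,
            ← ofReal_sub, hj, max_eq_right (norm_nonneg _), norm_real,
            show ∀ a : ℝ, (a + 1) / m * L - a / m * L = L / m from fun a => by ring]
          exact Real.norm_of_nonneg (by positivity)
        rw [a3] at a1
        refine a1.trans_lt ?_
        have a4 : K * (L / m) * B < 1 := by
          rw [mul_div_assoc', div_mul_eq_mul_div, div_lt_one hm0]
          have : K * L * B = L * K * B := by ring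
          linarith
        have hg0 : 0 < ‖gradN R (l, f l - (((n + 1 - i : ℕ) / m * L : ℝ) : ℂ))‖ :=
          norm_pos_iff.2 (hR.grad l hl _)
        have a5 : 0 ≤ K * (L / m) := by positivity
        calc K * (L / m) ≤ K * (L / m) * (B * ‖gradN R (l, f l -
              (((n + 1 - i : ℕ) / m * L : ℝ) : ℂ))‖) := le_mul_of_one_le_right a5 a2
          _ = K * (L / m) * B * ‖gradN R (l, f l -
              (((n + 1 - i : ℕ) / m * L : ℝ) : ℂ))‖ := by ring
          _ < _ := mul_lt_of_lt_one_left hg0 a4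
  have := main (n + 1) le_rfl
  simpa using this

theorem exists_schwarz_holMem {κ : ℝ} (hκ : 0 < κ) (hκ1 : κ < 1) {u : ℂ → ℝ}
    (hu : HolMem κ u (sphere (0 : ℂ) 1)) :
    ∃ f : ℂ → ℂ, DifferentiableOn ℂ f (ball (0 : ℂ) 1) ∧
      HolMem κ f (closedBall (0 : ℂ) 1) ∧ ∀ l ∈ sphere (0 : ℂ) 1, (f l).re = u l := by
  obtain ⟨C, -, h1, -⟩ := hu
  obtain ⟨f, C', hd, hb, h⟩ := exists_schwarz hκ hκ1 h1
  exact ⟨f, hd, hb.holMem hκ, h⟩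

theorem HasLog.exists_factor {κ : ℝ} (hκ : 0 < κ) (hκ1 : κ < 1) {q : ℂ → ℂ}
    (hq : HasLog κ q (sphere (0 : ℂ) 1)) :
    ∃ (H : ℂ → ℂ) (m : ℂ → ℝ), DifferentiableOn ℂ H (ball (0 : ℂ) 1) ∧
      HolMem κ H (closedBall (0 : ℂ) 1) ∧ HolMem κ m (sphere (0 : ℂ) 1) ∧
      ∀ l ∈ sphere (0 : ℂ) 1, q l * exp (H l) = (Real.exp (m l) : ℂ) := by
  obtain ⟨n, hn, hqn⟩ := hq
  have him : HolMem κ (fun x => (n x).im) (sphere (0 : ℂ) 1) :=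
    hn.comp (φ := Complex.im) hκ (isCompact_sphere _ _) fun x _ => imCLM.contDiff.contDiffAt
  have hre : ∀ {g : ℂ → ℂ}, HolMem κ g (sphere (0 : ℂ) 1) →
      HolMem κ (fun x => (g x).re) (sphere (0 : ℂ) 1) := fun hg =>
    hg.comp (φ := Complex.re) hκ (isCompact_sphere _ _) fun x _ => reCLM.contDiff.contDiffAt
  obtain ⟨f, hd, hf, h⟩ := exists_schwarz_holMem hκ hκ1 him
  have hIf : HolMem κ (fun z => -I * f z) (closedBall (0 : ℂ) 1) := (HolMem.const _).mul hf
  refine ⟨fun z => -I * f z, fun l => (n l + -I * f l).re, hd.const_mul _, hIf,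
    hre (hn.add (hIf.mono sphere_subset_closedBall)), fun l hl => ?_⟩
  rw [hqn l hl, ← exp_add, ofReal_exp]
  congr 1
  apply Complex.ext
  · rw [ofReal_re]
  · have := h l hl
    simp [this]

theorem linear_surjective {κ : ℝ} (hκ : 0 < κ) (hκ1 : κ < 1) {q : ℂ → ℂ}
    (hq : HasLog κ q (sphere (0 : ℂ) 1)) {z₀ : ℂ} (hz₀ : z₀ ∈ closedBall (0 : ℂ) 1) {y : ℂ → ℝ}
    (hy : HolMem κ y (sphere (0 : ℂ) 1)) (c : ℂ) :
    ∃ (h : ℂ → ℂ) (s : ℝ), DifferentiableOn ℂ h (ball (0 : ℂ) 1) ∧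
      HolMem κ h (closedBall (0 : ℂ) 1) ∧ (∀ l ∈ sphere (0 : ℂ) 1, (q l * h l).re - s = y l) ∧
      h z₀ = c := by
  obtain ⟨H, m, hHd, hH, hm, hqH⟩ := hq.exists_factor hκ hκ1
  have hS := isCompact_sphere (0 : ℂ) 1
  have hem : HolMem κ (fun x => Real.exp (-m x)) (sphere (0 : ℂ) 1) :=
    hm.neg.comp (φ := Real.exp) hκ hS fun x _ => Real.contDiff_exp.contDiffAt
  have hyem : HolMem κ (fun x => y x * Real.exp (-m x)) (sphere (0 : ℂ) 1) :=
    (hy.prodMk hem).comp (φ := fun p : ℝ × ℝ => p.1 * p.2) hκ hS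
      fun x _ => (contDiff_fst.mul contDiff_snd).contDiffAt
  obtain ⟨k1, k1d, k1h, k1r⟩ := exists_schwarz_holMem hκ hκ1 hyem
  obtain ⟨k2, k2d, k2h, k2r⟩ := exists_schwarz_holMem hκ hκ1 hem
  have hpos : 0 < (k2 z₀).re := by
    obtain ⟨C, -, -, hC⟩ := hm
    have := le_re_of_sphere (a := Real.exp (-C)) (k2h.continuousOn hκ) k2d (fun l hl => by
      rw [k2r l hl]
      exact Real.exp_le_exp.2 (neg_le_neg ((le_abs_self _).trans (hC l hl)))) z₀ hz₀
    exact (Real.exp_pos _).trans_le this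
  set c' := exp (-H z₀) * c with hc'
  set s := ((c' - k1 z₀).re) / (k2 z₀).re with hs
  set b := (c' - k1 z₀ - s * k2 z₀).im with hb
  have hk : HolMem κ (fun z => k1 z + s * k2 z + b * I) (closedBall (0 : ℂ) 1) :=
    (k1h.add ((HolMem.const _).mul k2h)).add (HolMem.const _)
  refine ⟨fun z => exp (H z) * (k1 z + s * k2 z + b * I), s, hHd.cexp.mul
    ((k1d.add (k2d.const_mul _)).add_const _), (hH.comp (φ := exp) hκ (isCompact_closedBall _ _)
      fun x _ => contDiff_exp.contDiffAt).mul hk, fun l hl => ?_, ?_⟩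
  · rw [← mul_assoc, hqH l hl, re_ofReal_mul]
    have e : Real.exp (m l) * Real.exp (-m l) = 1 := by
      rw [← Real.exp_add, add_neg_cancel, Real.exp_zero]
    have : (k1 l + s * k2 l + b * I).re = y l * Real.exp (-m l) + s * Real.exp (-m l) := by
      simp [k1r l hl, k2r l hl]
    rw [this]
    linear_combination (y l + s) * e
  · have : k1 z₀ + s * k2 z₀ + b * I = c' := by
      apply Complex.ext
      · have : s * (k2 z₀).re = (c' - k1 z₀).re := div_mul_cancel₀ _ hpos.ne'
        rw [sub_re] at this
        simp [this]
      · simp [hb]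
    simp only
    rw [this, hc', ← mul_assoc, ← exp_add, add_neg_cancel, exp_zero, one_mul]

theorem linear_injective {κ : ℝ} (hκ : 0 < κ) (hκ1 : κ < 1) {q : ℂ → ℂ}
    (hq : HasLog κ q (sphere (0 : ℂ) 1)) {z₀ : ℂ} (hz₀ : z₀ ∈ closedBall (0 : ℂ) 1)
    {h : ℂ → ℂ} {s : ℝ} (hd : DifferentiableOn ℂ h (ball (0 : ℂ) 1))
    (hc : ContinuousOn h (closedBall (0 : ℂ) 1))
    (hs : ∀ l ∈ sphere (0 : ℂ) 1, (q l * h l).re = s) (h0 : h z₀ = 0) :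
    s = 0 ∧ ∀ z ∈ closedBall (0 : ℂ) 1, h z = 0 := by
  obtain ⟨H, m, hHd, hH, hm, hqH⟩ := hq.exists_factor hκ hκ1
  have hS := isCompact_sphere (0 : ℂ) 1
  have hem : HolMem κ (fun x => Real.exp (-m x)) (sphere (0 : ℂ) 1) :=
    hm.neg.comp (φ := Real.exp) hκ hS fun x _ => Real.contDiff_exp.contDiffAt
  obtain ⟨k2, k2d, k2h, k2r⟩ := exists_schwarz_holMem hκ hκ1 hem
  have hpos : 0 < (k2 z₀).re := by
    obtain ⟨C, -, -, hC⟩ := hm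
    have := le_re_of_sphere (a := Real.exp (-C)) (k2h.continuousOn hκ) k2d (fun l hl => by
      rw [k2r l hl]
      exact Real.exp_le_exp.2 (neg_le_neg ((le_abs_self _).trans (hC l hl)))) z₀ hz₀
    exact (Real.exp_pos _).trans_le this
  have hHc := hH.continuousOn hκ
  have hk : ∀ l ∈ sphere (0 : ℂ) 1, (exp (-H l) * h l - s * k2 l).re = 0 := by
    intro l hl
    have e : Real.exp (m l) * Real.exp (-m l) = 1 := by
      rw [← Real.exp_add, add_neg_cancel, Real.exp_zero]
    have e1 : q l * h l = (Real.exp (m l) : ℂ) * (exp (-H l) * h l) := by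
      rw [← hqH l hl, mul_assoc, ← mul_assoc (exp (H l)), ← exp_add, add_neg_cancel, exp_zero,
        one_mul]
    have e2 := hs l hl
    rw [e1, re_ofReal_mul] at e2
    rw [sub_re, re_ofReal_mul, k2r l hl, ← e2]
    linear_combination -(exp (-H l) * h l).re * e
  have key := eq_of_re_sphere (q := fun z => exp (-H z) * h z - s * k2 z)
    (((continuous_exp.comp_continuousOn hHc.neg).mul hc).sub
      (continuousOn_const.mul (k2h.continuousOn hκ)))
    ((hHd.neg.cexp.mul hd).sub (k2d.const_mul _)) hk
  have hs0 : s = 0 := by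
    have h1 : (exp (-H z₀) * h z₀ - s * k2 z₀).re = 0 := by
      rw [key z₀ hz₀, ← key 1 (by simp)]
      exact hk 1 (by simp)
    rw [h0, mul_zero, zero_sub, neg_re, re_ofReal_mul, neg_eq_zero] at h1
    exact (mul_eq_zero.1 h1).resolve_right hpos.ne'
  refine ⟨hs0, fun z hz => ?_⟩
  have h1 := (key z hz).trans (key z₀ hz₀).symm
  rw [hs0, h0] at h1
  simpa using h1

theorem abs_re_segment_le {M x : ℝ} {ζ h : ℂ} (h1 : |ζ.re| ≤ M) (h2 : |(ζ + h).re| ≤ M)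
    (hx : x ∈ Icc (0 : ℝ) 1) : |(ζ + x * h).re| ≤ M := by
  have := convex_band M h1 h2 (a := 1 - x) (b := x) (by linarith [hx.2]) hx.1 (by ring)
  have e : (1 - x) • ζ + x • (ζ + h) = ζ + x * h := by
    simp only [real_smul]; push_cast; ring
  rwa [e] at this

theorem hasDerivAt_line (ζ h : ℂ) (x : ℝ) : HasDerivAt (fun x : ℝ => ζ + x * h) h x := by
  simpa using ((hasDerivAt_id x).ofReal_comp.mul_const h).const_add ζ

theorem gradN_double_diff (hR : LogData R) (M : ℝ) : ∃ K ≥ 0, ∀ l ∈ sphere (0 : ℂ) 1,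
    ∀ m ∈ sphere (0 : ℂ) 1, ∀ x p y q : ℂ, |x.re| ≤ M → |(x + p).re| ≤ M → |y.re| ≤ M →
      |(y + q).re| ≤ M →
      ‖(gradN R (l, x + p) - gradN R (l, x)) - (gradN R (m, y + q) - gradN R (m, y))‖ ≤
        K * ((‖l - m‖ + ‖x - y‖ + ‖p - q‖) * ‖p‖ + ‖p - q‖) := by
  have hN := contDiff_gradN hR
  have hN' : ContDiff ℝ 1 (fderiv ℝ (gradN R)) := hN.fderiv_right (by norm_num)
  have hper := fderiv_periodic (g := gradN R) (gradN_periodic hR)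
  obtain ⟨K₁, hK₁0, hK₁⟩ := lipschitz_of_periodic hN' hper M
  obtain ⟨K₂, hK₂0, hK₂⟩ := periodic_bound hN'.continuous hper M
  refine ⟨max K₁ K₂, le_max_of_le_left hK₁0, fun l hl m hm x p y q h1 h2 h3 h4 => ?_⟩
  have hd : ∀ (l x p : ℂ) (s : ℝ), HasDerivAt (fun s : ℝ => gradN R (l, x + s * p))
      (fderiv ℝ (gradN R) (l, x + s * p) (0, p)) s := fun l x p s =>
    ((hN.differentiable (by norm_num) _).hasFDerivAt).comp_hasDerivAt s
      ((hasDerivAt_const s l).prodMk (hasDerivAt_line x p s))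
  have := norm_image_sub_le_of_norm_deriv_le_segment_01'
    (f := fun s : ℝ => gradN R (l, x + s * p) - gradN R (m, y + s * q))
    (C := max K₁ K₂ * ((‖l - m‖ + ‖x - y‖ + ‖p - q‖) * ‖p‖ + ‖p - q‖))
    (fun s _ => ((hd l x p s).sub (hd m y q s)).hasDerivWithinAt) (fun s hs => by
      have hs' := Ico_subset_Icc_self hs
      have e : fderiv ℝ (gradN R) (l, x + s * p) (0, p) - fderiv ℝ (gradN R) (m, y + s * q) (0, q)
          = (fderiv ℝ (gradN R) (l, x + s * p) - fderiv ℝ (gradN R) (m, y + s * q)) (0, p) +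
            fderiv ℝ (gradN R) (m, y + s * q) (0, p - q) := by
        rw [sub_apply, show ((0 : ℂ), p - q) = (0, p) - (0, q) by simp,
          map_sub]
        abel
      have n0 : ∀ v : ℂ, ‖((0 : ℂ), v)‖ = ‖v‖ := fun v => by simp
      rw [e, mul_add]
      refine (norm_add_le _ _).trans (add_le_add ?_ ?_)
      · refine (ContinuousLinearMap.le_opNorm _ _).trans ?_
        rw [n0, ← mul_assoc]
        refine mul_le_mul_of_nonneg_right ?_ (norm_nonneg _)
        refine (hK₁ (l, x + s * p) (m, y + s * q) (sphere_subset_closedBall hl)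
          (sphere_subset_closedBall hm) (abs_re_segment_le h1 h2 hs')
          (abs_re_segment_le h3 h4 hs')).trans ?_
        refine mul_le_mul (le_max_left _ _) ?_ (norm_nonneg _) (le_max_of_le_left hK₁0)
        rw [Prod.mk_sub_mk, Prod.norm_mk]
        refine max_le (by linarith [norm_nonneg (x - y), norm_nonneg (p - q)]) ?_
        rw [show x + s * p - (y + s * q) = (x - y) + s * (p - q) by ring]
        refine (norm_add_le _ _).trans ?_
        rw [norm_mul, norm_real, Real.norm_of_nonneg hs.1]
        have := mul_le_of_le_one_left (norm_nonneg (p - q)) hs.2.le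
        linarith [norm_nonneg (l - m)]
      · refine (ContinuousLinearMap.le_opNorm _ _).trans ?_
        rw [n0]
        exact mul_le_mul_of_nonneg_right ((hK₂ _ (sphere_subset_closedBall hm) _
          (abs_re_segment_le h3 h4 hs')).trans (le_max_right _ _)) (norm_nonneg _))
  refine le_of_eq_of_le ?_ this
  congr 1
  simp only [ofReal_one, one_mul, ofReal_zero, zero_mul, add_zero]
  ring

theorem strict_estimate (hR : LogData R) {κ A : ℝ} (hκ0 : 0 ≤ κ) (hκ1 : κ ≤ 1) (hA : 0 ≤ A)
    {f₀ : ℂ → ℂ} (hf₀ : HolBd κ A f₀ (sphere (0 : ℂ) 1))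
    (hb₀ : ∀ l ∈ sphere (0 : ℂ) 1, ‖f₀ l‖ ≤ A) :
    ∃ K ≥ 0, ∀ δ H : ℝ, 0 ≤ δ → δ ≤ 1 → 0 ≤ H → ∀ f g : ℂ → ℂ,
      HolBd κ δ (fun l => f l - f₀ l) (sphere (0 : ℂ) 1) →
      (∀ l ∈ sphere (0 : ℂ) 1, ‖f l - f₀ l‖ ≤ δ) →
      HolBd κ δ (fun l => g l - f₀ l) (sphere (0 : ℂ) 1) →
      (∀ l ∈ sphere (0 : ℂ) 1, ‖g l - f₀ l‖ ≤ δ) →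
      HolBd κ H (fun l => f l - g l) (sphere (0 : ℂ) 1) →
      (∀ l ∈ sphere (0 : ℂ) 1, ‖f l - g l‖ ≤ H) →
      HolBd κ (K * δ * H) (fun l => R (l, f l) - R (l, g l) -
        (gradN R (l, f₀ l) * (f l - g l)).re) (sphere (0 : ℂ) 1) ∧
      ∀ l ∈ sphere (0 : ℂ) 1, |R (l, f l) - R (l, g l) -
        (gradN R (l, f₀ l) * (f l - g l)).re| ≤ K * δ * H := by
  obtain ⟨K₁, hK₁0, hK₁⟩ := lipschitz_of_periodic ((contDiff_gradN hR).of_le (by norm_num))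
    (gradN_periodic hR) (A + 1)
  obtain ⟨K₂, hK₂0, hK₂⟩ := gradN_double_diff hR (A + 1)
  refine ⟨K₁ + K₂ * (A + 4), by positivity, ?_⟩
  intro δ H hδ0 hδ1 hH f g hf hfb hg hgb hfg hfgb
  set p : ℝ → ℂ → ℂ := fun x l => (1 - x) * (g l - f₀ l) + x * (f l - f₀ l) with hp
  have hpe : ∀ x l, f₀ l + p x l = g l + x * (f l - g l) := fun x l => by simp only [hp]; ring
  have conv : ∀ x ∈ Icc (0 : ℝ) 1, ∀ (u v : ℂ) (B : ℝ), ‖u‖ ≤ B → ‖v‖ ≤ B →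
      ‖(1 - x) * u + x * v‖ ≤ B := by
    intro x hx u v B hu hv
    refine (norm_add_le _ _).trans ?_
    rw [norm_mul, norm_mul, ← ofReal_one, ← ofReal_sub, norm_real, norm_real,
      Real.norm_of_nonneg hx.1, Real.norm_of_nonneg (sub_nonneg.2 hx.2)]
    have := mul_le_mul_of_nonneg_left hu (sub_nonneg.2 hx.2)
    have := mul_le_mul_of_nonneg_left hv hx.1
    linarith
  have hpb : ∀ x ∈ Icc (0 : ℝ) 1, ∀ l ∈ sphere (0 : ℂ) 1, ‖p x l‖ ≤ δ := fun x hx l hl =>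
    conv x hx _ _ _ (hgb l hl) (hfb l hl)
  have hph : ∀ x ∈ Icc (0 : ℝ) 1, HolBd κ δ (p x) (sphere (0 : ℂ) 1) := by
    intro x hx l hl m hm
    have e : p x l - p x m = (1 - x) * ((g l - f₀ l) - (g m - f₀ m)) +
        x * ((f l - f₀ l) - (f m - f₀ m)) := by simp only [hp]; ring
    rw [e]
    exact conv x hx _ _ _ (hg l hl m hm) (hf l hl m hm)
  have hre : ∀ l ∈ sphere (0 : ℂ) 1, |(f₀ l).re| ≤ A + 1 := fun l hl =>
    (abs_re_le_norm _).trans ((hb₀ l hl).trans (by linarith))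
  have hre' : ∀ x ∈ Icc (0 : ℝ) 1, ∀ l ∈ sphere (0 : ℂ) 1, |(f₀ l + p x l).re| ≤ A + 1 :=
    fun x hx l hl => (abs_re_le_norm _).trans ((norm_add_le _ _).trans
      (add_le_add (hb₀ l hl) ((hpb x hx l hl).trans hδ1)))
  set D : ℝ → ℂ → ℂ := fun x l => gradN R (l, f₀ l + p x l) - gradN R (l, f₀ l) with hD
  have hDb : ∀ x ∈ Icc (0 : ℝ) 1, ∀ l ∈ sphere (0 : ℂ) 1, ‖D x l‖ ≤ K₁ * δ := by
    intro x hx l hl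
    have hl' := sphere_subset_closedBall hl
    refine (hK₁ (l, f₀ l + p x l) (l, f₀ l) hl' hl' (hre' x hx l hl) (hre l hl)).trans ?_
    rw [Prod.mk_sub_mk, Prod.norm_mk, sub_self, norm_zero, add_sub_cancel_left,
      max_eq_right (norm_nonneg _)]
    exact mul_le_mul_of_nonneg_left (hpb x hx l hl) hK₁0
  have hDh : ∀ x ∈ Icc (0 : ℝ) 1, HolBd κ (K₂ * (A + 4) * δ) (D x) (sphere (0 : ℂ) 1) := by
    intro x hx l hl m hm
    refine (hK₂ l hl m hm _ _ _ _ (hre l hl) (hre' x hx l hl) (hre m hm) (hre' x hx m hm)).trans ?_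
    rw [mul_assoc K₂, mul_assoc K₂]
    refine mul_le_mul_of_nonneg_left ?_ hK₂0
    have a1 : ‖l - m‖ ≤ 2 * ‖l - m‖ ^ κ := by
      rw [mem_sphere_zero_iff_norm] at hl hm
      exact norm_le_two_mul_rpow hκ0 hκ1 (norm_nonneg _) ((norm_sub_le _ _).trans (by linarith))
    have a2 := hf₀ l hl m hm
    have a3 := hph x hx l hl m hm
    have a4 := hpb x hx l hl
    have a5 : 0 ≤ ‖l - m‖ ^ κ := by positivity
    have a6 : δ * ‖l - m‖ ^ κ ≤ 1 * ‖l - m‖ ^ κ := by gcongr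
    have a7 : ‖l - m‖ + ‖f₀ l - f₀ m‖ + ‖p x l - p x m‖ ≤ (A + 3) * ‖l - m‖ ^ κ := by linarith
    have a8 := mul_le_mul a7 a4 (norm_nonneg _) (by positivity)
    linarith
  have hder : ∀ l ∈ sphere (0 : ℂ) 1, ∀ x : ℝ,
      HasDerivAt (fun x : ℝ => R (l, g l + x * (f l - g l)) - x * (gradN R (l, f₀ l) *
        (f l - g l)).re) (D x l * (f l - g l)).re x := by
    intro l hl x
    refine ((hR.hasDerivAt_comp (l := l) (hasDerivAt_line (g l) (f l - g l) x)).sub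
      ((hasDerivAt_id' x).mul_const (gradN R (l, f₀ l) * (f l - g l)).re)).congr_deriv ?_
    simp only [hD]
    rw [hpe, one_mul, sub_mul, sub_re]
  have hK : K₁ * δ * H + K₂ * (A + 4) * δ * H = (K₁ + K₂ * (A + 4)) * δ * H := by ring
  refine ⟨fun l hl m hm => ?_, fun l hl => ?_⟩
  · have := norm_image_sub_le_of_norm_deriv_le_segment_01'
      (C := (K₁ + K₂ * (A + 4)) * δ * H * ‖l - m‖ ^ κ)
      (fun x _ => ((hder l hl x).sub (hder m hm x)).hasDerivWithinAt) (fun x hx => by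
        have hx' := Ico_subset_Icc_self hx
        rw [← sub_re]
        refine (abs_re_le_norm _).trans ?_
        have := (hDh x hx').mul hfg (by positivity) (hDb x hx') hfgb l hl m hm
        rwa [hK] at this)
    refine le_of_eq_of_le ?_ this
    congr 1
    simp only [Pi.sub_apply, ofReal_one, one_mul, ofReal_zero, zero_mul, add_zero,
      add_sub_cancel]
    ring
  · have := norm_image_sub_le_of_norm_deriv_le_segment_01'
      (C := (K₁ + K₂ * (A + 4)) * δ * H)
      (fun x _ => (hder l hl x).hasDerivWithinAt) (fun x hx => by
        have hx' := Ico_subset_Icc_self hx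
        refine (abs_re_le_norm _).trans ?_
        rw [norm_mul, ← hK]
        have := mul_le_mul (hDb x hx' l hl) (hfgb l hl) (norm_nonneg _) (by positivity)
        have : 0 ≤ K₂ * (A + 4) * δ * H := by positivity
        linarith)
    rw [← Real.norm_eq_abs]
    refine le_of_eq_of_le ?_ this
    congr 1
    simp only [ofReal_one, one_mul, ofReal_zero, zero_mul, add_zero, add_sub_cancel]
    ring

theorem HasStrictFDerivAt.exists_local_inverse {E F : Type*} [NormedAddCommGroup E]
    [NormedSpace ℝ E]
    [CompleteSpace E] [NormedAddCommGroup F] [NormedSpace ℝ F] [CompleteSpace F] {f : E → F}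
    {f' : E →L[ℝ] F} {a : E} (hf : HasStrictFDerivAt f f' a) (hi : Function.Injective f')
    (hs : Function.Surjective f') :
    ∃ δ > 0, ∃ C ≥ 0, (∀ η > 0, ∃ ρ > 0, ∀ y, ‖y - f a‖ < ρ → ∃ x, ‖x - a‖ < η ∧ f x = y) ∧
      ∀ x y, ‖x - a‖ ≤ δ → ‖y - a‖ ≤ δ → ‖x - y‖ ≤ C * ‖f x - f y‖ := by
  set e := ContinuousLinearEquiv.ofBijective f' (LinearMap.ker_eq_bot.2 hi)
    (LinearMap.range_eq_top.2 hs) with he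
  have hf2 : HasStrictFDerivAt f (e : E →L[ℝ] F) a := by
    rwa [he, ContinuousLinearEquiv.coe_ofBijective]
  obtain ⟨s, has, hso, happ⟩ := hf2.approximates_deriv_on_open_nhds
  have hc : Subsingleton E ∨ ‖(e.symm : F →L[ℝ] E)‖₊⁻¹ / 2 < ‖(e.symm : F →L[ℝ] E)‖₊⁻¹ :=
    e.subsingleton_or_nnnorm_symm_pos.imp id fun h => NNReal.half_lt_self (inv_pos.2 h).ne'
  have hanti := happ.antilipschitz hc
  obtain ⟨δ, hδ, hball⟩ := Metric.isOpen_iff.1 hso a has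
  refine ⟨δ / 2, half_pos hδ, (((‖(e.symm : F →L[ℝ] E)‖₊⁻¹ -
    ‖(e.symm : F →L[ℝ] E)‖₊⁻¹ / 2)⁻¹ : NNReal) : ℝ), NNReal.coe_nonneg _, fun η hη => ?_,
        fun x y hx hy => ?_⟩
  · have h1 := hf.map_nhds_eq_of_surj (LinearMap.range_eq_top.2 hs)
    have h2 : f '' ball a η ∈ nhds (f a) := h1 ▸ Filter.image_mem_map (ball_mem_nhds a hη)
    obtain ⟨ρ, hρ, hsub⟩ := Metric.mem_nhds_iff.1 h2
    refine ⟨ρ, hρ, fun y hy => ?_⟩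
    obtain ⟨x, hx, rfl⟩ := hsub (mem_ball_iff_norm.2 hy)
    exact ⟨x, mem_ball_iff_norm.1 hx, rfl⟩
  · have hmem : ∀ z, ‖z - a‖ ≤ δ / 2 → z ∈ s := fun z hz =>
      hball (mem_ball_iff_norm.2 (by linarith))
    have := hanti.le_mul_dist ⟨x, hmem x hx⟩ ⟨y, hmem y hy⟩
    rwa [Subtype.dist_eq, dist_eq_norm, dist_eq_norm] at this

/-- Elements of the ambient space which are holomorphic in the open unit disk. -/
def diffSub : Submodule ℝ (HolAmb ℂ) where
  carrier := {p | DifferentiableOn ℂ p.1 (ball (0 : ℂ) 1)}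
  add_mem' hp hq := hp.add hq
  zero_mem' := differentiableOn_const (0 : ℂ)
  smul_mem' c p hp := by
    change DifferentiableOn ℂ (fun x => (c : ℝ) • p.1 x) _
    exact hp.const_smul c

theorem isClosed_diffSub : IsClosed (diffSub : Set (HolAmb ℂ)) := by
  refine IsSeqClosed.isClosed fun u p hu hlim => ?_
  change DifferentiableOn ℂ p.1 (ball (0 : ℂ) 1)
  have h : TendstoUniformlyOn (fun n x => (u n).1 x) (fun x => p.1 x) Filter.atTop
      (ball (0 : ℂ) 1) := by
    rw [Metric.tendstoUniformlyOn_iff]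
    intro ε hε
    filter_upwards [Metric.tendsto_nhds.1 hlim ε hε] with n hn x _
    rw [dist_eq_norm] at hn ⊢
    have := holSub_norm_apply_le (p := u n - p) x
    rw [norm_sub_rev]
    exact this.trans_lt hn
  exact h.tendstoLocallyUniformlyOn.differentiableOn (Filter.Eventually.of_forall hu) isOpen_ball

/-- Hölder continuous functions on the closed disk which are holomorphic in the interior. -/
def holE (κ : ℝ) : Submodule ℝ (HolAmb ℂ) := holSub κ (closedBall (0 : ℂ) 1) ℂ ⊓ diffSub

instance (κ : ℝ) : CompleteSpace (holE κ) :=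
  (isClosed_holSub.inter isClosed_diffSub).completeSpace_coe

instance (κ : ℝ) : CompleteSpace (holSub κ (sphere (0 : ℂ) 1) ℝ) :=
  isClosed_holSub.completeSpace_coe

theorem exists_holE {κ : ℝ} {f : ℂ → ℂ} (hd : DifferentiableOn ℂ f (ball (0 : ℂ) 1))
    (hf : HolMem κ f (closedBall (0 : ℂ) 1)) :
    ∃ p : holE κ, ∀ x ∈ closedBall (0 : ℂ) 1, p.1.1 x = f x := by
  obtain ⟨p, hp, h⟩ := exists_holSub hf
  exact ⟨⟨p, hp, hd.congr fun x hx => h x (ball_subset_closedBall hx)⟩, h⟩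

theorem exists_bdry_linear {κ : ℝ} (hκ : 0 < κ) {q : ℂ → ℂ}
    (hq : HolMem κ q (sphere (0 : ℂ) 1)) :
    ∃ L : holE κ →L[ℝ] holSub κ (sphere (0 : ℂ) 1) ℝ, ∀ h : holE κ, ∀ l ∈ sphere (0 : ℂ) 1,
      (L h).1.1 l = (q l * h.1.1 l).re := by
  have hre : ∀ {C : ℝ} {g : ℂ → ℂ}, HolBd κ C g (sphere (0 : ℂ) 1) →
      HolBd κ C (fun l => (g l).re) (sphere (0 : ℂ) 1) := fun hg x hx y hy => by
    rw [← sub_re]; exact (abs_re_le_norm _).trans (hg x hx y hy)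
  obtain ⟨C, hC0, hC1, hC2⟩ := hq
  have hbd : ∀ h : holE κ, HolBd κ (C * ‖h‖ + C * ‖h‖) (fun l => (q l * h.1.1 l).re)
      (sphere (0 : ℂ) 1) ∧ ∀ l ∈ sphere (0 : ℂ) 1, ‖(q l * h.1.1 l).re‖ ≤ C * ‖h‖ + C * ‖h‖ := by
    intro h
    have h1 : HolBd κ ‖h‖ h.1.1 (sphere (0 : ℂ) 1) := fun x hx y hy =>
      holSub_holBd hκ h.2.1 x (sphere_subset_closedBall hx) y (sphere_subset_closedBall hy)
    have h2 : ∀ x ∈ sphere (0 : ℂ) 1, ‖h.1.1 x‖ ≤ ‖h‖ := fun x _ => holSub_norm_apply_le x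
    refine ⟨hre (hC1.mul h1 hC0 hC2 h2), fun l hl => (abs_re_le_norm _).trans ?_⟩
    rw [norm_mul]
    have := mul_le_mul (hC2 l hl) (h2 l hl) (norm_nonneg _) hC0
    have : 0 ≤ C * ‖h‖ := by positivity
    linarith
  have hex : ∀ h : holE κ, ∃ y : holSub κ (sphere (0 : ℂ) 1) ℝ, ∀ l ∈ sphere (0 : ℂ) 1,
      y.1.1 l = (q l * h.1.1 l).re := fun h => by
    obtain ⟨p, hp, hpe⟩ := exists_holSub (V := ℝ) (s := sphere (0 : ℂ) 1) (κ := κ)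
      (u := fun l => (q l * h.1.1 l).re) ⟨_, by positivity, (hbd h).1, (hbd h).2⟩
    exact ⟨⟨p, hp⟩, hpe⟩
  choose L hL using hex
  have hadd : ∀ x y, L (x + y) = L x + L y := fun x y => by
    refine Subtype.ext (holSub_ext (L (x + y)).2 (L x + L y).2 fun l hl => ?_)
    change (L (x + y)).1.1 l = (L x).1.1 l + (L y).1.1 l
    rw [hL _ l hl, hL _ l hl, hL _ l hl]
    change (q l * (x.1.1 l + y.1.1 l)).re = _
    rw [mul_add, add_re]
  have hsmul : ∀ (c : ℝ) x, L (c • x) = c • L x := fun c x => by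
    refine Subtype.ext (holSub_ext (L (c • x)).2 (c • L x).2 fun l hl => ?_)
    change (L (c • x)).1.1 l = c • (L x).1.1 l
    rw [hL _ l hl, hL _ l hl]
    change (q l * (c • x.1.1 l)).re = _
    rw [real_smul, mul_left_comm, re_ofReal_mul, smul_eq_mul]
  refine ⟨LinearMap.mkContinuous ⟨⟨L, hadd⟩, hsmul⟩ (C + C) fun x => ?_, hL⟩
  rw [add_mul]
  refine holSub_norm_le (L x).2 (by positivity) (fun l hl m hm => ?_) fun l hl => ?_
  · change ‖(L x).1.1 l - (L x).1.1 m‖ ≤ _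
    rw [hL x l hl, hL x m hm]
    exact (hbd x).1 l hl m hm
  · change ‖(L x).1.1 l‖ ≤ _
    rw [hL x l hl]
    exact (hbd x).2 l hl

theorem HolMem.exp {κ : ℝ} (hκ : 0 < κ) {s : Set ℂ} (hs : IsCompact s) {q : ℂ → ℂ}
    (h : HolMem κ q s) : HolMem κ (fun x => Complex.exp (q x)) s :=
  h.comp (φ := Complex.exp) hκ hs fun _ _ => Complex.contDiff_exp.contDiffAt

theorem HasLog.holMem {κ : ℝ} (hκ : 0 < κ) {s : Set ℂ} (hs : IsCompact s) {q : ℂ → ℂ}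
    (h : HasLog κ q s) : HolMem κ q s := by
  obtain ⟨n, hn, he⟩ := h
  exact (hn.exp hκ hs).congr he

theorem HolMem.defining (hR : LogData R) {κ : ℝ} (hκ0 : 0 < κ) (hκ1 : κ ≤ 1) {f : ℂ → ℂ}
    (hf : HolMem κ f (sphere (0 : ℂ) 1)) :
    HolMem κ (fun l => R (l, f l)) (sphere (0 : ℂ) 1) :=
  (((HolMem.id hκ0.le hκ1).mono sphere_subset_closedBall).prodMk hf).comp (φ := R) hκ0
      (isCompact_sphere _ _) fun _ _ =>
    (hR.smooth.of_le (by norm_num)).contDiffAt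

/-- The boundary defect of a Hölder continuous disk is strictly differentiable. -/
theorem exists_bdry_map (hR : LogData R) {κ : ℝ} (hκ0 : 0 < κ) (hκ1 : κ ≤ 1) :
    ∃ Θ : holE κ → holSub κ (sphere (0 : ℂ) 1) ℝ,
      (∀ p, ∀ l ∈ sphere (0 : ℂ) 1, (Θ p).1.1 l = R (l, p.1.1 l)) ∧
      ∀ p₀ : holE κ, ∀ L : holE κ →L[ℝ] holSub κ (sphere (0 : ℂ) 1) ℝ,
        (∀ h : holE κ, ∀ l ∈ sphere (0 : ℂ) 1, (L h).1.1 l = (gradN R (l, p₀.1.1 l) * h.1.1 l).re) →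
        HasStrictFDerivAt Θ L p₀ := by
  have hsc := sphere_subset_closedBall (x := (0 : ℂ)) (ε := 1)
  have hex : ∀ p : holE κ, ∃ y : holSub κ (sphere (0 : ℂ) 1) ℝ, ∀ l ∈ sphere (0 : ℂ) 1,
      y.1.1 l = R (l, p.1.1 l) := fun p => by
    obtain ⟨y, hy, he⟩ := exists_holSub
      (HolMem.defining hR hκ0 hκ1 ((holSub_holMem hκ0 p.2.1).mono hsc))
    exact ⟨⟨y, hy⟩, he⟩
  choose Θ hΘ using hex
  refine ⟨Θ, hΘ, fun p₀ L hL => ?_⟩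
  have hn : ∀ p : holE κ, HolBd κ ‖p‖ p.1.1 (sphere (0 : ℂ) 1) ∧
      ∀ l ∈ sphere (0 : ℂ) 1, ‖p.1.1 l‖ ≤ ‖p‖ := fun p =>
    ⟨fun x hx y hy => holSub_holBd hκ0 p.2.1 x (hsc hx) y (hsc hy), fun l _ =>
        holSub_norm_apply_le l⟩
  obtain ⟨K, hK, hst⟩ := strict_estimate hR hκ0.le hκ1 (norm_nonneg p₀) (hn p₀).1 (hn p₀).2
  rw [hasStrictFDerivAt_iff_isLittleO, Asymptotics.isLittleO_iff]
  intro c hc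
  set δ := min 1 (c / (K + 1)) with hδ
  have hδ0 : 0 < δ := lt_min one_pos (by positivity)
  have hKδ : K * δ ≤ c := by
    have : δ ≤ c / (K + 1) := min_le_right _ _
    rw [le_div_iff₀ (by positivity)] at this
    nlinarith
  filter_upwards [Metric.ball_mem_nhds (p₀, p₀) hδ0] with x hx
  rw [mem_ball, Prod.dist_eq, max_lt_iff, dist_eq_norm, dist_eq_norm] at hx
  have hd : ∀ p : holE κ, ‖p - p₀‖ < δ →
      HolBd κ δ (fun l => p.1.1 l - p₀.1.1 l) (sphere (0 : ℂ) 1) ∧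
      ∀ l ∈ sphere (0 : ℂ) 1, ‖p.1.1 l - p₀.1.1 l‖ ≤ δ := fun p hp =>
    ⟨(hn (p - p₀)).1.mono hp.le, fun l hl => ((hn (p - p₀)).2 l hl).trans hp.le⟩
  obtain ⟨h1, h2⟩ := hst δ ‖x.1 - x.2‖ hδ0.le (min_le_left _ _) (norm_nonneg _) x.1.1.1 x.2.1.1
    (hd _ hx.1).1 (hd _ hx.1).2 (hd _ hx.2).1 (hd _ hx.2).2 (hn (x.1 - x.2)).1 (hn (x.1 - x.2)).2
  have hval : ∀ l ∈ sphere (0 : ℂ) 1, (Θ x.1 - Θ x.2 - L (x.1 - x.2)).1.1 l =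
      R (l, x.1.1.1 l) - R (l, x.2.1.1 l) -
        (gradN R (l, p₀.1.1 l) * (x.1.1.1 l - x.2.1.1 l)).re := fun l hl => by
    change (Θ x.1).1.1 l - (Θ x.2).1.1 l - (L (x.1 - x.2)).1.1 l = _
    rw [hΘ _ l hl, hΘ _ l hl, hL _ l hl]
    rfl
  refine (holSub_norm_le (Θ x.1 - Θ x.2 - L (x.1 - x.2)).2 (C := K * δ * ‖x.1 - x.2‖)
    (by positivity) (fun l hl m hm => ?_) fun l hl => ?_).trans (by gcongr)
  · have := h1 l hl m hm
    beta_reduce at this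
    rw [← hval l hl, ← hval m hm] at this
    exact this
  · have := h2 l hl
    rw [← hval l hl] at this
    exact this

theorem exists_local_operator (hR : LogData R) (hE : StdEnd R) {κ : ℝ} (hκ0 : 0 < κ) (hκ1 : κ < 1)
    (p₀ : holE κ) (t₀ : ℝ) {z₀ : ℂ} (hz₀ : z₀ ∈ closedBall (0 : ℂ) 1) :
    ∃ (Ψ : holE κ × ℝ → holSub κ (sphere (0 : ℂ) 1) ℝ × ℂ)
      (Ψ' : holE κ × ℝ →L[ℝ] holSub κ (sphere (0 : ℂ) 1) ℝ × ℂ),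
      HasStrictFDerivAt Ψ Ψ' (p₀, t₀) ∧ Function.Injective Ψ' ∧ Function.Surjective Ψ' ∧
      (∀ p t, ∀ l ∈ sphere (0 : ℂ) 1, (Ψ (p, t)).1.1.1 l = R (l, p.1.1 l) - t) ∧
      ∀ p t, (Ψ (p, t)).2 = p.1.1 z₀ := by
  have hsc := sphere_subset_closedBall (x := (0 : ℂ)) (ε := 1)
  obtain ⟨Θ, hΘ, hΘd⟩ := exists_bdry_map hR hκ0 hκ1.le
  have hq : HasLog κ (fun l => gradN R (l, p₀.1.1 l)) (sphere (0 : ℂ) 1) :=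
    hasLog_gradN hR hE hκ0 hκ1.le (holSub_holMem hκ0 p₀.2.1)
  obtain ⟨L, hL⟩ := exists_bdry_linear hκ0 (hq.holMem hκ0 (isCompact_sphere _ _))
  obtain ⟨one, hone, hone'⟩ := exists_holSub (κ := κ) (s := sphere (0 : ℂ) 1)
    (HolMem.const (1 : ℝ))
  set one' : holSub κ (sphere (0 : ℂ) 1) ℝ := ⟨one, hone⟩
  let ev : holE κ →L[ℝ] ℂ := (lp.evalCLM ℝ (fun _ : ℂ => ℂ) ∞ z₀).comp
    ((ContinuousLinearMap.fst ℝ _ _).comp (holE κ).subtypeL)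
  have hev : ∀ p, ev p = p.1.1 z₀ := fun p => rfl
  let Ψ : holE κ × ℝ → holSub κ (sphere (0 : ℂ) 1) ℝ × ℂ := fun x =>
    (Θ x.1 - x.2 • one', ev x.1)
  let Ψ' : holE κ × ℝ →L[ℝ] holSub κ (sphere (0 : ℂ) 1) ℝ × ℂ :=
    ((L.comp (ContinuousLinearMap.fst ℝ _ _)) -
      (ContinuousLinearMap.snd ℝ (holE κ) ℝ).smulRight one').prod
      (ev.comp (ContinuousLinearMap.fst ℝ _ _))
  have hΨ' : HasStrictFDerivAt Ψ Ψ' (p₀, t₀) :=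
    (((hΘd p₀ L hL).comp (p₀, t₀) hasStrictFDerivAt_fst).sub
      (hasStrictFDerivAt_snd.smul_const one')).prodMk
      (ev.hasStrictFDerivAt.comp (p₀, t₀) hasStrictFDerivAt_fst)
  have hΨ'v : ∀ h s, ∀ l ∈ sphere (0 : ℂ) 1,
      (Ψ' (h, s)).1.1.1 l = (gradN R (l, p₀.1.1 l) * h.1.1 l).re - s := fun h s l hl => by
    change (L h).1.1 l - s • one.1 l = _
    rw [hL _ l hl, hone' l hl, smul_eq_mul, mul_one]
  have hΨv : ∀ p t, ∀ l ∈ sphere (0 : ℂ) 1, (Ψ (p, t)).1.1.1 l = R (l, p.1.1 l) - t :=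
    fun p t l hl => by
    change (Θ p).1.1 l - t • one.1 l = _
    rw [hΘ _ l hl, hone' l hl, smul_eq_mul, mul_one]
  have hinj : Function.Injective Ψ' := by
    rw [injective_iff_map_eq_zero]
    rintro ⟨h, s⟩ h0
    have h1 := hΨ'v h s
    rw [h0] at h1
    obtain ⟨hs, hz⟩ := linear_injective (s := s) hκ0 hκ1 hq hz₀ h.2.2
      ((holSub_holMem hκ0 h.2.1).continuousOn hκ0)
      (fun l hl => by
        have := h1 l hl
        change (0 : ℝ) = _ at this
        linarith)
      (by
        have : (Ψ' (h, s)).2 = 0 := by rw [h0]; rfl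
        exact this)
    have : h = 0 := Subtype.ext (holSub_ext h.2.1 (zero_mem _) fun x hx => by rw [hz x hx]; rfl)
    rw [this, hs]
    rfl
  have hsurj : Function.Surjective Ψ' := by
    rintro ⟨y, c⟩
    obtain ⟨h, s, hd, hh, he, hc⟩ := linear_surjective hκ0 hκ1 hq hz₀ (holSub_holMem hκ0 y.2) c
    obtain ⟨p, hp⟩ := exists_holE hd hh
    refine ⟨(p, s), Prod.ext (Subtype.ext (holSub_ext (Ψ' (p, s)).1.2 y.2 fun l hl => ?_)) ?_⟩
    · rw [hΨ'v _ _ l hl, hp l (hsc hl), he l hl]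
    · exact (hp z₀ hz₀).trans hc
  exact ⟨Ψ, Ψ', hΨ', hinj, hsurj, hΨv, fun _ _ => rfl⟩

theorem local_structure (hR : LogData R) (hE : StdEnd R) {κ : ℝ} (hκ0 : 0 < κ) (hκ1 : κ < 1)
    {t₀ : ℝ} {f₀ : ℂ → ℂ} (hf₀ : Sol R t₀ f₀) (hm : HolMem κ f₀ (closedBall (0 : ℂ) 1)) {z₀ : ℂ}
    (hz₀ : z₀ ∈ closedBall (0 : ℂ) 1) :
    ∃ δ > 0, ∃ C ≥ 0,
      (∀ η > 0, ∃ ρ > 0, ∀ c, ‖c - f₀ z₀‖ < ρ → ∃ t f, Sol R t f ∧ f z₀ = c ∧ |t - t₀| < η ∧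
        ∀ z ∈ closedBall (0 : ℂ) 1, ‖f z - f₀ z‖ < η) ∧
      ∀ t t' f g, DifferentiableOn ℂ f (ball (0 : ℂ) 1) → DifferentiableOn ℂ g (ball (0 : ℂ) 1) →
        HolBd κ δ (fun z => f z - f₀ z) (closedBall (0 : ℂ) 1) →
        (∀ z ∈ closedBall (0 : ℂ) 1, ‖f z - f₀ z‖ ≤ δ) → |t - t₀| ≤ δ →
        HolBd κ δ (fun z => g z - f₀ z) (closedBall (0 : ℂ) 1) →
        (∀ z ∈ closedBall (0 : ℂ) 1, ‖g z - f₀ z‖ ≤ δ) → |t' - t₀| ≤ δ →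
        ∀ A ≥ 0, HolBd κ A (fun l => (R (l, f l) - t) - (R (l, g l) - t')) (sphere (0 : ℂ) 1) →
          (∀ l ∈ sphere (0 : ℂ) 1, |(R (l, f l) - t) - (R (l, g l) - t')| ≤ A) →
          ‖f z₀ - g z₀‖ ≤ A →
          (∀ z ∈ closedBall (0 : ℂ) 1, ‖f z - g z‖ ≤ C * A) ∧
            HolBd κ (C * A) (fun z => f z - g z) (closedBall (0 : ℂ) 1) ∧ |t - t'| ≤ C * A := by
  have hsc := sphere_subset_closedBall (x := (0 : ℂ)) (ε := 1)
  obtain ⟨p₀, hp₀⟩ := exists_holE hf₀.1.2 hm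
  obtain ⟨Ψ, Ψ', hΨ', hinj, hsurj, hΨv, hΨz⟩ := exists_local_operator hR hE hκ0 hκ1 p₀ t₀ hz₀
  obtain ⟨δ, hδ, C, hC, h1, h2⟩ := hΨ'.exists_local_inverse hinj hsurj
  have hΨ0 : Ψ (p₀, t₀) = (0, f₀ z₀) := by
    refine Prod.ext (Subtype.ext (holSub_ext (Ψ (p₀, t₀)).1.2 (zero_mem _) fun l hl => ?_)) ?_
    · rw [hΨv _ _ l hl, hp₀ l (hsc hl), hf₀.2 l hl, sub_self]
      rfl
    · exact (hΨz _ _).trans (hp₀ z₀ hz₀)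
  refine ⟨δ, hδ, C, hC, fun η hη => ?_, ?_⟩
  · obtain ⟨ρ, hρ, hex⟩ := h1 η hη
    refine ⟨ρ, hρ, fun c hc => ?_⟩
    obtain ⟨⟨p, t⟩, hlt, he⟩ := hex (0, c) (by
      rw [hΨ0, Prod.mk_sub_mk, sub_zero, Prod.norm_mk, norm_zero]
      exact max_lt hρ hc)
    rw [Prod.mk_sub_mk, Prod.norm_mk, max_lt_iff] at hlt
    refine ⟨t, p.1.1, ⟨⟨(holSub_holMem hκ0 p.2.1).continuousOn hκ0, p.2.2⟩, fun l hl => ?_⟩, ?_,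
      hlt.2, fun z hz => ?_⟩
    · have := hΨv p t l hl
      rw [he] at this
      change (0 : ℝ) = _ at this
      linarith
    · rw [← hΨz p t, he]
    · rw [← hp₀ z hz]
      exact (holSub_norm_apply_le (p := (p - p₀).1) z).trans_lt hlt.1
  · intro t t' f g hfd hgd hf1 hf2 ht hg1 hg2 ht' A hA hA1 hA2 hA3
    have key : ∀ (f : ℂ → ℂ) (t : ℝ), DifferentiableOn ℂ f (ball (0 : ℂ) 1) →
        HolBd κ δ (fun z => f z - f₀ z) (closedBall (0 : ℂ) 1) →
        (∀ z ∈ closedBall (0 : ℂ) 1, ‖f z - f₀ z‖ ≤ δ) → |t - t₀| ≤ δ →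
        ∃ p : holE κ, (∀ z ∈ closedBall (0 : ℂ) 1, p.1.1 z = f z) ∧ ‖(p, t) - (p₀, t₀)‖ ≤ δ := by
      intro f t hfd hf1 hf2 ht
      have hmem : HolMem κ f (closedBall (0 : ℂ) 1) :=
        (HolMem.add ⟨δ, hδ.le, hf1, hf2⟩ hm).congr fun z _ => (sub_add_cancel (f z) (f₀ z)).symm
      obtain ⟨p, hp⟩ := exists_holE hfd hmem
      refine ⟨p, hp, ?_⟩
      rw [Prod.mk_sub_mk, Prod.norm_mk]
      refine max_le (holSub_norm_le (p - p₀).2.1 hδ.le (fun z hz w hw => ?_) fun z hz => ?_) ht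
      · change ‖(p.1.1 z - p₀.1.1 z) - (p.1.1 w - p₀.1.1 w)‖ ≤ _
        rw [hp z hz, hp w hw, hp₀ z hz, hp₀ w hw]
        exact hf1 z hz w hw
      · change ‖p.1.1 z - p₀.1.1 z‖ ≤ _
        rw [hp z hz, hp₀ z hz]
        exact hf2 z hz
    obtain ⟨p, hp, hpn⟩ := key f t hfd hf1 hf2 ht
    obtain ⟨q, hq, hqn⟩ := key g t' hgd hg1 hg2 ht'
    have hmain := h2 (p, t) (q, t') hpn hqn
    have hval : ∀ l ∈ sphere (0 : ℂ) 1, ((Ψ (p, t)).1 - (Ψ (q, t')).1).1.1 l =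
        (R (l, f l) - t) - (R (l, g l) - t') := fun l hl => by
      change (Ψ (p, t)).1.1.1 l - (Ψ (q, t')).1.1.1 l = _
      rw [hΨv _ _ l hl, hΨv _ _ l hl, hp l (hsc hl), hq l (hsc hl)]
    have hle : ‖Ψ (p, t) - Ψ (q, t')‖ ≤ A := by
      rw [Prod.norm_def]
      refine max_le (holSub_norm_le ((Ψ (p, t)).1 - (Ψ (q, t')).1).2 hA
        (fun l hl m hm => ?_) fun l hl => ?_) ?_
      · have := hA1 l hl m hm
        beta_reduce at this
        rw [← hval l hl, ← hval m hm] at this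
        exact this
      · have := hA2 l hl
        rw [← hval l hl] at this
        exact this
      · rw [← hp z₀ hz₀, ← hq z₀ hz₀, ← hΨz p t, ← hΨz q t'] at hA3
        exact hA3
    have hfin := hmain.trans (mul_le_mul_of_nonneg_left hle hC)
    rw [Prod.mk_sub_mk, Prod.norm_mk, max_le_iff] at hfin
    refine ⟨fun z hz => ?_, fun z hz w hw => ?_, hfin.2⟩
    · rw [← hp z hz, ← hq z hz]
      exact (holSub_norm_apply_le (p := (p - q).1) z).trans hfin.1
    · have := (holSub_holBd hκ0 (p - q).2.1).mono hfin.1 z hz w hw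
      beta_reduce
      rw [← hp z hz, ← hq z hz, ← hp w hw, ← hq w hw]
      exact this

theorem exists_lower (hR : LogData R) (M : ℝ) :
    ∃ T, ∀ l ∈ sphere (0 : ℂ) 1, ∀ ζ : ℂ, M ≤ ζ.re → T ≤ R (l, ζ) := by
  obtain ⟨T, hT⟩ := exists_upper hR.neg (-M)
  refine ⟨-T, fun l hl ζ hζ => ?_⟩
  have := hT l hl (-ζ) (by simpa using hζ)
  simp only [neg_neg] at this
  linarith

theorem exists_sphere_re_le {q : ℂ → ℂ} (hc : ContinuousOn q (closedBall (0 : ℂ) 1))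
    (hd : DifferentiableOn ℂ q (ball (0 : ℂ) 1)) {z : ℂ} (hz : z ∈ closedBall (0 : ℂ) 1) :
    ∃ l ∈ sphere (0 : ℂ) 1, (q l).re ≤ (q z).re := by
  obtain ⟨l, hl, hmin⟩ := (isCompact_sphere (0 : ℂ) 1).exists_isMinOn ⟨1, by simp⟩
    (continuous_re.comp_continuousOn (hc.mono sphere_subset_closedBall))
  exact ⟨l, hl, le_re_of_sphere hc hd (fun m hm => hmin hm) z hz⟩

theorem exists_sphere_le_re {q : ℂ → ℂ} (hc : ContinuousOn q (closedBall (0 : ℂ) 1))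
    (hd : DifferentiableOn ℂ q (ball (0 : ℂ) 1)) {z : ℂ} (hz : z ∈ closedBall (0 : ℂ) 1) :
    ∃ l ∈ sphere (0 : ℂ) 1, (q z).re ≤ (q l).re := by
  obtain ⟨l, hl, h⟩ := exists_sphere_re_le hc.neg hd.neg hz
  exact ⟨l, hl, by simpa using h⟩

theorem exists_level_bound (hR : LogData R) (B : ℝ) : ∃ T ≥ 0, ∀ t f, Sol R t f →
    ∀ z ∈ closedBall (0 : ℂ) 1, |(f z).re| ≤ B → |t| ≤ T := by
  obtain ⟨T₁, h1⟩ := exists_upper hR B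
  obtain ⟨T₂, h2⟩ := exists_lower hR (-B)
  refine ⟨max |T₁| |T₂|, by positivity, fun t f hf z hz hB => ?_⟩
  obtain ⟨l, hl, hl'⟩ := exists_sphere_re_le hf.1.1 hf.1.2 hz
  obtain ⟨m, hm, hm'⟩ := exists_sphere_le_re hf.1.1 hf.1.2 hz
  have e1 := h1 l hl (f l) (hl'.trans (abs_le.1 hB).2)
  have e2 := h2 m hm (f m) ((abs_le.1 hB).1.trans hm')
  rw [hf.2 l hl] at e1
  rw [hf.2 m hm] at e2
  exact abs_le.2 ⟨by linarith [neg_abs_le T₂, le_max_right |T₁| |T₂|],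
    by linarith [le_abs_self T₁, le_max_left |T₁| |T₂|]⟩

theorem exists_subseq_of_holBd {κ C B : ℝ} (hκ : 0 < κ) {f : ℕ → ℂ → ℂ}
    (hf : ∀ n, HolBd κ C (f n) (Metric.closedBall 0 1))
    (hB : ∀ n, ∀ z ∈ closedBall (0 : ℂ) 1, ‖f n z‖ ≤ B) :
    ∃ (g : ℂ → ℂ) (φ : ℕ → ℕ), StrictMono φ ∧
      TendstoUniformlyOn (fun n => f (φ n)) g Filter.atTop (closedBall (0 : ℂ) 1) := by
  let X := closedBall (0 : ℂ) 1
  have : CompactSpace X := isCompact_iff_compactSpace.1 (isCompact_closedBall (0 : ℂ) 1)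
  let F : ℕ → BoundedContinuousFunction X ℂ := fun n =>
    BoundedContinuousFunction.mkOfCompact ⟨fun x => f n x,
      continuousOn_iff_continuous_domRestrict.1 ((hf n).continuousOn hκ)⟩
  have hequi : Equicontinuous ((↑) : range F → X → ℂ) := by
    intro x
    rw [Metric.equicontinuousAt_iff_right]
    intro ε hε
    have hlim : Filter.Tendsto (fun y : X => C * dist (x : ℂ) y ^ κ) (nhds x) (nhds 0) := by
      have : Continuous fun y : X => C * dist (x : ℂ) y ^ κ :=
        continuous_const.mul ((continuous_const.dist continuous_subtype_val).rpow_const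
          fun _ => Or.inr hκ.le)
      have h := this.tendsto x
      simpa [Real.zero_rpow hκ.ne'] using h
    filter_upwards [hlim.eventually_lt_const hε] with y hy
    rintro ⟨_, n, rfl⟩
    change dist (f n x) (f n y) < ε
    rw [dist_eq_norm]
    refine (hf n x x.2 y y.2).trans_lt ?_
    rwa [← dist_eq_norm]
  have hcomp := BoundedContinuousFunction.arzela_ascoli (closedBall (0 : ℂ) B)
    (isCompact_closedBall _ _) (range F)
    (by
      rintro _ x ⟨n, rfl⟩
      rw [mem_closedBall_zero_iff]
      exact hB n x x.2) hequi
  obtain ⟨G, -, φ, hφ, hlim⟩ := hcomp.isSeqCompact (x := F) fun n => subset_closure ⟨n, rfl⟩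
  refine ⟨Function.extend Subtype.val G 0, φ, hφ, ?_⟩
  rw [Metric.tendstoUniformlyOn_iff]
  intro ε hε
  filter_upwards [Metric.tendsto_nhds.1 hlim ε hε] with n hn z hz
  have e : Function.extend Subtype.val G 0 z = G ⟨z, hz⟩ :=
    Subtype.val_injective.extend_apply G 0 ⟨z, hz⟩
  rw [e, dist_comm]
  exact (BoundedContinuousFunction.dist_coe_le_dist (f := F (φ n)) (g := G) ⟨z, hz⟩).trans_lt hn

theorem Sol.exists_subseq (hR : LogData R) {B : ℝ} {t : ℕ → ℝ} {f : ℕ → ℂ → ℂ}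
    (hf : ∀ n, Sol R (t n) (f n)) {z : ℂ} (hz : z ∈ closedBall (0 : ℂ) 1)
    (hB : ∀ n, ‖f n z‖ ≤ B) :
    ∃ (s : ℝ) (g : ℂ → ℂ) (φ : ℕ → ℕ), StrictMono φ ∧ Sol R s g ∧
      Filter.Tendsto (fun n => t (φ n)) Filter.atTop (nhds s) ∧
      TendstoUniformlyOn (fun n => f (φ n)) g Filter.atTop (closedBall (0 : ℂ) 1) := by
  obtain ⟨T, hT0, hT⟩ := exists_level_bound hR B
  have ht : ∀ n, |t n| ≤ T := fun n => hT _ _ (hf n) z hz ((abs_re_le_norm _).trans (hB n))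
  obtain ⟨κ, hκ0, hκ1, C, hC0, hC⟩ := uniform_holder hR hT0
  have hb : ∀ n, ∀ w ∈ closedBall (0 : ℂ) 1, ‖f n w‖ ≤ C * 2 ^ κ + B := fun n w hw => by
    have h1 := hC _ _ (ht n) (hf n) w hw z hz
    have h2 : ‖w - z‖ ≤ 2 := by
      rw [mem_closedBall_zero_iff] at hw hz
      exact (norm_sub_le _ _).trans (by linarith)
    have h3 : C * ‖w - z‖ ^ κ ≤ C * 2 ^ κ := by gcongr
    have h4 : ‖f n w‖ ≤ ‖f n w - f n z‖ + ‖f n z‖ := by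
      simpa using norm_add_le (f n w - f n z) (f n z)
    linarith [hB n]
  obtain ⟨g, φ, hφ, hlim⟩ := exists_subseq_of_holBd hκ0 (fun n => hC _ _ (ht n) (hf n)) hb
  have hgc : ContinuousOn g (closedBall (0 : ℂ) 1) :=
    hlim.continuousOn (Filter.Frequently.of_forall fun n => (hf (φ n)).1.1)
  have hgd : DifferentiableOn ℂ g (ball (0 : ℂ) 1) :=
    (hlim.mono ball_subset_closedBall).tendstoLocallyUniformlyOn.differentiableOn
      (Filter.Eventually.of_forall fun n => (hf (φ n)).1.2) isOpen_ball
  have hval : ∀ l ∈ sphere (0 : ℂ) 1,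
      Filter.Tendsto (fun n => t (φ n)) Filter.atTop (nhds (R (l, g l))) := fun l hl => by
    have h1 := hlim.tendsto_at (sphere_subset_closedBall hl)
    have h2 : Filter.Tendsto (fun n => R (l, f (φ n) l)) Filter.atTop (nhds (R (l, g l))) :=
      (hR.smooth.continuous.tendsto (l, g l)).comp (tendsto_const_nhds.prodMk_nhds h1)
    exact h2.congr fun n => (hf (φ n)).2 l hl
  exact ⟨R (1, g 1), g, φ, hφ, ⟨⟨hgc, hgd⟩, fun l hl =>
    tendsto_nhds_unique (hval l hl) (hval 1 (by simp))⟩, hval 1 (by simp), hlim⟩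

/-- Interpolation between a Hölder bound and a uniform bound. -/
theorem HolBd.interpolate {V : Type*} [NormedAddCommGroup V] {κ C η : ℝ} {s : Set ℂ} {h : ℂ → V}
    (hC : 0 ≤ C) (hh : HolBd κ C h s) (hη : ∀ x ∈ s, ‖h x‖ ≤ η) :
    HolBd (κ / 2) (√(2 * η * C)) h s := fun x hx y hy => by
  have h0 := norm_nonneg (x - y)
  have hη0 : 0 ≤ η := (norm_nonneg _).trans (hη x hx)
  have h1 := hh x hx y hy
  have h2 : ‖h x - h y‖ ≤ 2 * η := by
    linarith [norm_sub_le (h x) (h y), hη x hx, hη y hy]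
  have h3 : ‖x - y‖ ^ (κ / 2) = √(‖x - y‖ ^ κ) := by
    rw [Real.sqrt_eq_rpow, ← Real.rpow_mul h0]
    ring_nf
  rw [h3, ← Real.sqrt_mul (by positivity)]
  refine Real.le_sqrt_of_sq_le ?_
  have := mul_le_mul h2 h1 (norm_nonneg _) (by positivity)
  nlinarith

theorem Sol.local_bijective (hR : LogData R) (hE : StdEnd R) {t₀ : ℝ} {f₀ : ℂ → ℂ}
    (hf₀ : Sol R t₀ f₀) {z₀ : ℂ} (hz₀ : z₀ ∈ closedBall (0 : ℂ) 1) :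
    (∀ η > 0, ∃ ρ > 0, ∀ c, ‖c - f₀ z₀‖ < ρ → ∃ t f, Sol R t f ∧ f z₀ = c ∧
      ∀ z ∈ closedBall (0 : ℂ) 1, ‖f z - f₀ z‖ < η) ∧
    ∃ ε > 0, ∀ t t' f g, Sol R t f → Sol R t' g → |t - t₀| ≤ ε → |t' - t₀| ≤ ε →
      (∀ z ∈ closedBall (0 : ℂ) 1, ‖f z - f₀ z‖ ≤ ε) →
      (∀ z ∈ closedBall (0 : ℂ) 1, ‖g z - f₀ z‖ ≤ ε) → f z₀ = g z₀ →
      ∀ z ∈ closedBall (0 : ℂ) 1, f z = g z := by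
  obtain ⟨κ, hκ0, hκ1, C, hC0, hC⟩ := uniform_holder hR (T := |t₀| + 1) (by positivity)
  have hb₀ := hC t₀ f₀ (by linarith) hf₀
  obtain ⟨B, hB0, -, hB⟩ := hb₀.holMem hκ0
  have hm : HolMem (κ / 2) f₀ (closedBall (0 : ℂ) 1) := (hb₀.interpolate hC0 hB).holMem (half_pos
      hκ0)
  obtain ⟨δ, hδ, A, hA, h1, h2⟩ := local_structure hR hE (half_pos hκ0) (by linarith) hf₀ hm hz₀
  refine ⟨fun η hη => ?_, ?_⟩
  · obtain ⟨ρ, hρ, h⟩ := h1 η hη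
    refine ⟨ρ, hρ, fun c hc => ?_⟩
    obtain ⟨t, f, hf, hfc, -, hfd⟩ := h c hc
    exact ⟨t, f, hf, hfc, hfd⟩
  · set ε := min (min 1 δ) (δ ^ 2 / (4 * C + 1)) with hε
    have hε0 : 0 < ε := lt_min (lt_min one_pos hδ) (by positivity)
    have hε1 : ε ≤ 1 := (min_le_left _ _).trans (min_le_left _ _)
    have hεδ : ε ≤ δ := (min_le_left _ _).trans (min_le_right _ _)
    have hεC : √(2 * ε * (C + C)) ≤ δ := by
      refine Real.sqrt_le_iff.2 ⟨hδ.le, ?_⟩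
      have : ε ≤ δ ^ 2 / (4 * C + 1) := min_le_right _ _
      rw [le_div_iff₀ (by positivity)] at this
      linarith
    have key : ∀ t f, Sol R t f → |t - t₀| ≤ ε →
        (∀ z ∈ closedBall (0 : ℂ) 1, ‖f z - f₀ z‖ ≤ ε) →
        HolBd (κ / 2) δ (fun z => f z - f₀ z) (closedBall (0 : ℂ) 1) := by
      intro t f hf ht hfε
      have hft := hC t f (by
        have := abs_add_le (t - t₀) t₀
        rw [sub_add_cancel] at this
        linarith) hf
      have hd : HolBd κ (C + C) (fun z => f z - f₀ z) (Metric.closedBall (0 : ℂ) 1) := by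
        intro x hx y hy
        have e : f x - f₀ x - (f y - f₀ y) = (f x - f y) - (f₀ x - f₀ y) := by ring
        rw [e, add_mul]
        exact (norm_sub_le _ _).trans (add_le_add (hft x hx y hy) (hb₀ x hx y hy))
      exact (hd.interpolate (by positivity) hfε).mono hεC
    refine ⟨ε, hε0, fun t t' f g hf hg ht ht' hfε hgε hz z hz' => ?_⟩
    have := (h2 t t' f g hf.1.2 hg.1.2 (key t f hf ht hfε) (fun z hz => (hfε z hz).trans hεδ)
      (ht.trans hεδ) (key t' g hg ht' hgε) (fun z hz => (hgε z hz).trans hεδ) (ht'.trans hεδ)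
      0 le_rfl (fun l hl m hm => by simp [hf.2 l hl, hf.2 m hm, hg.2 l hl, hg.2 m hm])
      (fun l hl => by simp [hf.2 l hl, hg.2 l hl]) (by simp [hz])).1 z hz'
    rw [mul_zero, norm_le_zero_iff, sub_eq_zero] at this
    exact this

/-- Disks with boundary on a very low level are constant. -/
theorem exists_const_level (hR : LogData R) (hE : StdEnd R) :
    ∃ m : ℝ, (∀ t f, Sol R t f → ∀ z ∈ closedBall (0 : ℂ) 1, (f z).re ≤ m →
        ∀ w ∈ closedBall (0 : ℂ) 1, f w = f z) ∧
      (∀ t f, Sol R t f → t ≤ 2 * m → ∀ w ∈ closedBall (0 : ℂ) 1, f w = f 0) ∧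
      (∀ ζ : ℂ, ζ.re ≤ m → ∀ l ∈ sphere (0 : ℂ) 1, R (l, ζ) = 2 * ζ.re) ∧
      ∀ l ∈ sphere (0 : ℂ) 1, ∀ ζ, R (l, ζ) ≤ 2 * m → ζ.re ≤ m := by
  obtain ⟨M₀, hM₀⟩ := hE
  obtain ⟨T, hT⟩ := exists_lower hR M₀
  set m := min M₀ (T / 2 - 1) with hm
  have hm0 : m ≤ M₀ := min_le_left _ _
  have hmT : 2 * m < T := by linarith [min_le_right M₀ (T / 2 - 1)]
  have hlow : ∀ l ∈ sphere (0 : ℂ) 1, ∀ ζ, R (l, ζ) ≤ 2 * m → ζ.re ≤ M₀ := fun l hl ζ h => by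
    by_contra! hc
    linarith [hT l hl ζ hc.le]
  have hconst : ∀ t f, Sol R t f → t ≤ 2 * m → ∀ w ∈ closedBall (0 : ℂ) 1, f w = f 0 := by
    intro t f hf ht
    refine eq_of_re_sphere (a := t / 2) hf.1.1 hf.1.2 fun l hl => ?_
    have h1 := hf.2 l hl
    have h2 := hM₀ l hl (f l) (hlow l hl _ (h1.trans_le ht))
    linarith
  refine ⟨m, fun t f hf z hz hzm w hw => ?_, hconst, fun ζ hζ l hl => hM₀ l hl ζ (hζ.trans hm0),
    fun l hl ζ h => ?_⟩
  · have ht : t ≤ 2 * m := by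
      obtain ⟨l, hl, hl'⟩ := exists_sphere_re_le hf.1.1 hf.1.2 hz
      have h1 := hf.2 l hl
      rw [hM₀ l hl (f l) (by linarith)] at h1
      linarith
    rw [hconst t f hf ht w hw, hconst t f hf ht z hz]
  · have := hM₀ l hl ζ (hlow l hl ζ h)
    linarith

theorem Sol.surjective (hR : LogData R) (hE : StdEnd R) {z₀ : ℂ}
    (hz₀ : z₀ ∈ closedBall (0 : ℂ) 1) (c : ℂ) : ∃ t f, Sol R t f ∧ f z₀ = c := by
  have hcl : IsClopen {c : ℂ | ∃ t f, Sol R t f ∧ f z₀ = c} := by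
    refine ⟨IsSeqClosed.isClosed fun u c hu hlim => ?_, Metric.isOpen_iff.2 ?_⟩
    · choose t f hf hfc using hu
      obtain ⟨B, hB⟩ := hlim.norm.bddAbove_range
      obtain ⟨s, g, φ, hφ, hg, -, hlim'⟩ := Sol.exists_subseq hR hf hz₀ (B := B) fun n => by
        rw [hfc]; exact hB ⟨n, rfl⟩
      refine ⟨s, g, hg, tendsto_nhds_unique (hlim'.tendsto_at hz₀) ?_⟩
      exact (hlim.comp hφ.tendsto_atTop).congr fun n => (hfc (φ n)).symm
    · rintro _ ⟨t, f, hf, rfl⟩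
      obtain ⟨ρ, hρ, h⟩ := (hf.local_bijective hR hE hz₀).1 1 one_pos
      refine ⟨ρ, hρ, fun c hc => ?_⟩
      obtain ⟨t, f, hf, hfc, -⟩ := h c (mem_ball_iff_norm.1 hc)
      exact ⟨t, f, hf, hfc⟩
  obtain ⟨m, -, -, h3, -⟩ := exists_const_level hR hE
  have hne : {c : ℂ | ∃ t f, Sol R t f ∧ f z₀ = c}.Nonempty :=
    ⟨(m : ℂ), 2 * m, fun _ => m, ⟨⟨continuousOn_const, differentiableOn_const _⟩, fun l hl => by
      rw [h3 _ (by simp) l hl, ofReal_re]⟩, rfl⟩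
  exact eq_univ_iff_forall.1 (hcl.eq_univ hne) c

theorem Sol.injective (hR : LogData R) (hE : StdEnd R) {z₀ : ℂ}
    (hz₀ : z₀ ∈ closedBall (0 : ℂ) 1) {t t' : ℝ} {f g : ℂ → ℂ} (hf : Sol R t f) (hg : Sol R t' g)
    (h : f z₀ = g z₀) : ∀ z ∈ closedBall (0 : ℂ) 1, f z = g z := by
  set S : Set ℂ := {c | ∃ t t' f g, Sol R t f ∧ Sol R t' g ∧ f z₀ = c ∧ g z₀ = c ∧
    ∃ z ∈ closedBall (0 : ℂ) 1, f z ≠ g z} with hS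
  have hcl : IsClopen S := by
    refine ⟨IsSeqClosed.isClosed fun u c hu hlim => ?_, Metric.isOpen_iff.2 ?_⟩
    · choose t t' f g hf hg hfc hgc hne using hu
      obtain ⟨B, hB⟩ := hlim.norm.bddAbove_range
      obtain ⟨s, F, φ, hφ, hF, hs, hlimF⟩ := Sol.exists_subseq hR hf hz₀ (B := B) fun n => by
        rw [hfc]; exact hB ⟨n, rfl⟩
      obtain ⟨s', G, ψ, hψ, hG, hs', hlimG⟩ := Sol.exists_subseq hR (fun n => hg (φ n)) hz₀
        (B := B) fun n => by rw [hgc]; exact hB ⟨φ n, rfl⟩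
      have hFc : F z₀ = c := tendsto_nhds_unique (hlimF.tendsto_at hz₀)
        ((hlim.comp hφ.tendsto_atTop).congr fun n => (hfc (φ n)).symm)
      have hGc : G z₀ = c := tendsto_nhds_unique (hlimG.tendsto_at hz₀)
        ((hlim.comp (hφ.comp hψ).tendsto_atTop).congr fun n => (hgc (φ (ψ n))).symm)
      refine ⟨s, s', F, G, hF, hG, hFc, hGc, ?_⟩
      by_contra! hFG
      have hss : s' = s := by
        rw [← hF.2 1 (by simp), ← hG.2 1 (by simp), hFG 1 (by simp)]
      obtain ⟨ε, hε, hloc⟩ := (hF.local_bijective hR hE hz₀).2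
      have e1 := hψ.tendsto_atTop.eventually (Metric.tendsto_nhds.1 hs ε hε)
      have e2 := Metric.tendsto_nhds.1 hs' ε hε
      have e3 := hψ.tendsto_atTop.eventually (Metric.tendstoUniformlyOn_iff.1 hlimF ε hε)
      have e4 := Metric.tendstoUniformlyOn_iff.1 hlimG ε hε
      obtain ⟨n, h1, h2, h3, h4⟩ := (e1.and (e2.and (e3.and e4))).exists
      obtain ⟨z, hz, hzne⟩ := hne (φ (ψ n))
      refine hzne (hloc _ _ _ _ (hf (φ (ψ n))) (hg (φ (ψ n))) h1.le (hss ▸ h2.le)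
        (fun z hz => ?_) (fun z hz => ?_) ((hfc _).trans (hgc _).symm) z hz)
      · rw [← dist_eq_norm, dist_comm]; exact (h3 z hz).le
      · rw [hFG z hz, ← dist_eq_norm, dist_comm]; exact (h4 z hz).le
    · rintro c ⟨t, t', f, g, hf, hg, hfc, hgc, z, hz, hne⟩
      have hη : 0 < ‖f z - g z‖ / 2 := half_pos (norm_pos_iff.2 (sub_ne_zero.2 hne))
      obtain ⟨ρ, hρ, h1⟩ := (hf.local_bijective hR hE hz₀).1 _ hη
      obtain ⟨ρ', hρ', h2⟩ := (hg.local_bijective hR hE hz₀).1 _ hη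
      refine ⟨min ρ ρ', lt_min hρ hρ', fun d hd => ?_⟩
      have hd' := lt_min_iff.1 (mem_ball_iff_norm.1 hd)
      obtain ⟨s, F, hF, hFd, hFn⟩ := h1 d (by rw [hfc]; exact hd'.1)
      obtain ⟨s', G, hG, hGd, hGn⟩ := h2 d (by rw [hgc]; exact hd'.2)
      refine ⟨s, s', F, G, hF, hG, hFd, hGd, z, hz, fun he => ?_⟩
      have e : f z - g z = (G z - g z) - (F z - f z) := by rw [he]; ring
      have := norm_sub_le (G z - g z) (F z - f z)
      rw [← e] at this
      linarith [hFn z hz, hGn z hz]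
  obtain ⟨m, h1, -, -, -⟩ := exists_const_level hR hE
  have hm : (m : ℂ) ∉ S := by
    rintro ⟨t, t', f, g, hf, hg, hfc, hgc, z, hz, hne⟩
    exact hne (by
      rw [h1 t f hf z₀ hz₀ (by rw [hfc, ofReal_re]) z hz,
        h1 t' g hg z₀ hz₀ (by rw [hgc, ofReal_re]) z hz, hfc, hgc])
  by_contra! hc
  obtain ⟨z, hz, hne⟩ := hc
  have hne : S.Nonempty := ⟨f z₀, t, t', f, g, hf, hg, rfl, h.symm, z, hz, hne⟩
  exact hm (hcl.eq_univ hne ▸ mem_univ _)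

theorem exists_solution_family (hR : LogData R) (hE : StdEnd R) :
    ∃ u : ℂ → ℂ → ℂ, (∀ ζ, Sol R (R (1, ζ)) (u ζ)) ∧ (∀ ζ, u ζ 1 = ζ) ∧
      (∀ t f, Sol R t f → ∀ z ∈ closedBall (0 : ℂ) 1, f z = u (f 1) z) ∧
      (∀ z ∈ closedBall (0 : ℂ) 1, ∀ ζ ζ', u ζ z = u ζ' z → ζ = ζ') ∧
      (∀ z ∈ closedBall (0 : ℂ) 1, ∀ c, ∃ ζ, u ζ z = c) ∧
      (∀ z ∈ closedBall (0 : ℂ) 1, ∀ ζ, ∀ k : ℤ,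
        u (ζ + k * (2 * Real.pi * I)) z = u ζ z + k * (2 * Real.pi * I)) ∧
      ContinuousOn (fun p : ℂ × ℂ => u p.1 p.2) (univ ×ˢ closedBall (0 : ℂ) 1) := by
  have h1 : (1 : ℂ) ∈ sphere (0 : ℂ) 1 := by simp
  have h1' : (1 : ℂ) ∈ closedBall (0 : ℂ) 1 := by simp
  choose τ u hu hu1 using Sol.surjective hR hE h1'
  have huniq : ∀ t f, Sol R t f → ∀ z ∈ closedBall (0 : ℂ) 1, f z = u (f 1) z := fun t f hf =>
    Sol.injective hR hE h1' hf (hu (f 1)) (hu1 (f 1)).symm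
  refine ⟨u, fun ζ => ?_, hu1, huniq, fun z hz ζ ζ' h => ?_, fun z hz c => ?_,
    fun z hz ζ k => ?_, ?_⟩
  · have := (hu ζ).2 1 h1
    rw [hu1] at this
    rw [this]
    exact hu ζ
  · rw [← hu1 ζ, ← hu1 ζ']
    exact Sol.injective hR hE hz (hu ζ) (hu ζ') h 1 h1'
  · obtain ⟨t, f, hf, hfc⟩ := Sol.surjective hR hE hz c
    exact ⟨f 1, by rw [← huniq t f hf z hz, hfc]⟩
  · have := huniq _ _ ((hu ζ).add_period hR k) z hz
    rw [hu1] at this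
    exact this.symm
  · rintro ⟨ζ, z⟩ ⟨-, hz⟩
    rw [Metric.continuousWithinAt_iff]
    intro ε hε
    obtain ⟨ρ, hρ, hloc⟩ := ((hu ζ).local_bijective hR hE h1').1 (ε / 2) (half_pos hε)
    obtain ⟨ρ', hρ', hc⟩ := Metric.continuousOn_iff.1 (hu ζ).1.1 z hz (ε / 2) (half_pos hε)
    refine ⟨min ρ ρ', lt_min hρ hρ', fun {x} hx hxd => ?_⟩
    obtain ⟨ζ', z'⟩ := x
    rw [Prod.dist_eq, max_lt_iff, lt_min_iff, lt_min_iff] at hxd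
    obtain ⟨t, f, hf, hf1, hfn⟩ := hloc ζ' (by rw [hu1, ← dist_eq_norm]; exact hxd.1.1)
    have e1 := hfn z' hx.2
    rw [huniq t f hf z' hx.2, hf1, ← dist_eq_norm] at e1
    have e2 := hc z' hx.2 hxd.2.2
    exact (dist_triangle _ _ _).trans_lt (by linarith)

theorem norm_rot (s : ℝ) : ‖exp (s * I)‖ = 1 := norm_exp_ofReal_mul_I s

/-- If `z * p z` is Hölder in the disk and `p` is holomorphic, then `p` is Hölder. -/
theorem HolMem.of_mul_id {α A : ℝ} (hα0 : 0 < α) (hα1 : α ≤ 1) {p : ℂ → ℂ} (hA : 0 ≤ A)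
    (hp : DifferentiableOn ℂ p (ball (0 : ℂ) 1))
    (h : HolBd α A (fun z => z * p z) (ball (0 : ℂ) 1)) :
    ∃ C, HolBd α C p (ball (0 : ℂ) 1) := by
  have hhalf : closedBall (0 : ℂ) (1 / 2) ⊆ ball (0 : ℂ) 1 := closedBall_subset_ball (by norm_num)
  obtain ⟨D, hD0, hD1, hD2⟩ := ((HolMem.id hα0.le hα1).mono
    (hhalf.trans ball_subset_closedBall)).comp (φ := p) hα0 (isCompact_closedBall _ _) fun x hx =>
      ((hp.contDiffOn isOpen_ball).contDiffAt (isOpen_ball.mem_nhds (hhalf hx))).restrict_scalars ℝ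
  have hrp : ∀ z ∈ ball (0 : ℂ) 1, ∀ w ∈ ball (0 : ℂ) 1, ‖z - w‖ ≤ 2 * ‖z - w‖ ^ α := by
    intro z hz w hw
    rw [mem_ball_zero_iff] at hz hw
    exact norm_le_two_mul_rpow hα0.le hα1 (norm_nonneg _) ((norm_sub_le _ _).trans (by linarith))
  have hhb : ∀ z ∈ ball (0 : ℂ) 1, ‖z * p z‖ ≤ A := fun z hz => by
    have h1 := h z hz 0 (by simp)
    simp only [zero_mul, sub_zero] at h1
    refine h1.trans (mul_le_of_le_one_right hA (Real.rpow_le_one (norm_nonneg _) ?_ hα0.le))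
    exact (mem_ball_zero_iff.1 hz).le
  have hb : ∀ z ∈ ball (0 : ℂ) 1, ‖p z‖ ≤ D + 2 * A := fun z hz => by
    rcases le_or_gt ‖z‖ (1 / 2) with h1 | h1
    · linarith [hD2 z (mem_closedBall_zero_iff.2 h1)]
    · have h2 := hhb z hz
      rw [norm_mul] at h2
      nlinarith [norm_nonneg (p z)]
  set B := D + 2 * A with hB
  have hB0 : 0 ≤ B := by positivity
  have key : ∀ z ∈ ball (0 : ℂ) 1, ∀ w ∈ ball (0 : ℂ) 1, 1 / 2 < ‖z‖ →
      ‖p z - p w‖ ≤ (D + (2 * A + 4 * B)) * ‖z - w‖ ^ α := by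
    intro z hz w hw hz2
    have h1 : z * (p z - p w) = (z * p z - w * p w) - (z - w) * p w := by ring
    have h2 : ‖z‖ * ‖p z - p w‖ ≤ A * ‖z - w‖ ^ α + 2 * ‖z - w‖ ^ α * B := by
      rw [← norm_mul, h1]
      refine (norm_sub_le _ _).trans (add_le_add (h z hz w hw) ?_)
      rw [norm_mul]
      exact mul_le_mul (hrp z hz w hw) (hb w hw) (norm_nonneg _) (by positivity)
    have h3 : 0 ≤ ‖z - w‖ ^ α := by positivity
    have h4 : 0 ≤ D * ‖z - w‖ ^ α := by positivity
    nlinarith [norm_nonneg (p z - p w)]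
  refine ⟨D + (2 * A + 4 * B), fun z hz w hw => ?_⟩
  rcases lt_or_ge (1 / 2) ‖z‖ with h1 | h1
  · exact key z hz w hw h1
  rcases lt_or_ge (1 / 2) ‖w‖ with h2 | h2
  · rw [norm_sub_rev, norm_sub_rev z]
    exact key w hw z hz h2
  · refine (hD1 z (mem_closedBall_zero_iff.2 h1) w (mem_closedBall_zero_iff.2 h2)).trans ?_
    gcongr
    linarith [show 0 ≤ 2 * A + 4 * B by positivity]

/-- Difference quotients in the direction of the rotations bound the derivative. -/
theorem HolBd.of_rotation {α A s₀ : ℝ} (hs₀ : 0 < s₀) {f : ℂ → ℂ}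
    (hf : DifferentiableOn ℂ f (ball (0 : ℂ) 1))
    (h : ∀ s : ℝ, |s| ≤ s₀ →
      HolBd α (A * |s|) (fun z => f (exp (s * I) * z) - f z) (ball (0 : ℂ) 1)) :
    HolBd α A (fun z => z * deriv f z) (ball (0 : ℂ) 1) := by
  have hd : ∀ z ∈ ball (0 : ℂ) 1,
      HasDerivAt (fun s : ℝ => f (exp (s * I) * z)) (I * (z * deriv f z)) 0 := by
    intro z hz
    have h1 : HasDerivAt (fun s : ℝ => exp (s * I) * z) (I * z) 0 := by
      have h2 : HasDerivAt (fun s : ℝ => (s : ℂ) * I) (1 * I) 0 :=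
        (ofRealCLM.hasDerivAt (x := (0 : ℝ))).mul_const I
      refine (h2.cexp.mul_const z).congr_deriv ?_
      simp
    have h3 : HasDerivAt f (deriv f z) (exp (((0 : ℝ) : ℂ) * I) * z) := by
      rw [ofReal_zero, zero_mul, exp_zero, one_mul]
      exact (hf.differentiableAt (isOpen_ball.mem_nhds hz)).hasDerivAt
    refine (h3.comp (0 : ℝ) h1).congr_deriv (by ring)
  intro z hz w hw
  have h1 := ((hd z hz).sub (hd w hw)).tendsto_slope_zero_right.norm
  have h2 : ‖I * (z * deriv f z) - I * (w * deriv f w)‖ =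
      ‖z * deriv f z - w * deriv f w‖ := by
    rw [← mul_sub, norm_mul, norm_I, one_mul]
  rw [h2] at h1
  refine le_of_tendsto h1 ?_
  filter_upwards [Ioc_mem_nhdsGT hs₀] with s hs
  have h3 := h s (by rw [abs_of_pos hs.1]; exact hs.2) z hz w hw
  rw [abs_of_pos hs.1] at h3
  rw [norm_smul, norm_inv, Real.norm_of_nonneg hs.1.le, inv_mul_le_iff₀ hs.1]
  simp only [zero_add, ofReal_zero, zero_mul, exp_zero, one_mul, Pi.sub_apply]
  refine le_trans (le_of_eq ?_) (h3.trans_eq (by ring))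
  congr 1
  ring

/-- The boundary defect of a rotated disk is Hölder of size comparable to the rotation angle. -/
theorem rotation_defect (hR : LogData R) (M : ℝ) {α C : ℝ} (hα0 : 0 < α) (hα1 : α ≤ 1)
    (hC : 0 ≤ C) : ∃ A ≥ 0, ∀ t f, Sol R t f → (∀ z ∈ closedBall (0 : ℂ) 1, |(f z).re| ≤ M) →
      HolBd α C f (closedBall (0 : ℂ) 1) → ∀ s : ℝ,
      HolBd α (A * |s|) (fun l => R (l, f (exp (s * I) * l)) - t) (sphere (0 : ℂ) 1) ∧
      ∀ l ∈ sphere (0 : ℂ) 1, |R (l, f (exp (s * I) * l)) - t| ≤ A * |s| := by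
  set W : ℂ × ℂ → ℝ := fun p => fderiv ℝ R p (I * p.1, 0) with hW
  have hWs : ContDiff ℝ 1 W := by
    have h1 : ContDiff ℝ 1 (fderiv ℝ R) := hR.smooth.fderiv_right (by norm_num)
    exact h1.clm_apply ((contDiff_const.mul contDiff_fst).prodMk contDiff_const)
  have hWp : ∀ l ζ, W (l, ζ + 2 * Real.pi * I) = W (l, ζ) := fun l ζ => by
    simp only [hW, fderiv_periodic hR.periodic]
  obtain ⟨K, hK0, hK⟩ := lipschitz_of_periodic hWs hWp M
  obtain ⟨K', hK'0, hK'⟩ := periodic_bound hWs.continuous hWp M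
  have hsc := sphere_subset_closedBall (x := (0 : ℂ)) (ε := 1)
  have hrot : ∀ (s : ℝ), ∀ l ∈ sphere (0 : ℂ) 1, exp (s * I) * l ∈ sphere (0 : ℂ) 1 := by
    intro s l hl
    rw [mem_sphere_zero_iff_norm] at hl ⊢
    rw [norm_mul, norm_rot, hl, one_mul]
  have hder : ∀ (l ζ : ℂ) (r : ℝ), HasDerivAt (fun r : ℝ => R (exp (r * I) * l, ζ))
      (W (exp (r * I) * l, ζ)) r := by
    intro l ζ r
    have h2 : HasDerivAt (fun s : ℝ => (s : ℂ) * I) (1 * I) r :=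
      (ofRealCLM.hasDerivAt (x := r)).mul_const I
    have h3 := (h2.cexp.mul_const l).prodMk (hasDerivAt_const r ζ)
    refine ((hR.hasFDerivAt _).comp_hasDerivAt r h3).congr_deriv ?_
    simp only [hW]
    congr 2
    ring
  refine ⟨K * (2 + C) + K', by positivity, fun t f hf hM hfC s => ⟨fun l hl m hm => ?_,
    fun l hl => ?_⟩⟩
  · have hl' := hsc (hrot s l hl)
    have hm' := hsc (hrot s m hm)
    have hlm : ‖exp (s * I) * l - exp (s * I) * m‖ = ‖l - m‖ := by
      rw [← mul_sub, norm_mul, norm_rot, one_mul]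
    have hfd := hfC _ hl' _ hm'
    rw [hlm] at hfd
    have hlm2 : ‖l - m‖ ≤ 2 * ‖l - m‖ ^ α := by
      rw [mem_sphere_zero_iff_norm] at hl hm
      exact norm_le_two_mul_rpow hα0.le hα1 (norm_nonneg _) ((norm_sub_le _ _).trans (by linarith))
    have hp : 0 ≤ ‖l - m‖ ^ α := by positivity
    have hbd : ∀ r : ℝ, ‖W (exp (r * I) * l, f (exp (s * I) * l)) -
        W (exp (r * I) * m, f (exp (s * I) * m))‖ ≤ K * ((2 + C) * ‖l - m‖ ^ α) := by
      intro r
      refine (hK _ _ (hsc (hrot r l hl)) (hsc (hrot r m hm)) (hM _ hl') (hM _ hm')).trans ?_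
      gcongr
      rw [Prod.mk_sub_mk, Prod.norm_mk, ← mul_sub, norm_mul, norm_rot, one_mul]
      exact max_le (by nlinarith) (by nlinarith)
    have hmv := (convex_univ (𝕜 := ℝ) (E := ℝ)).norm_image_sub_le_of_norm_hasDerivWithin_le
      (f := fun r : ℝ => R (exp (r * I) * l, f (exp (s * I) * l)) -
        R (exp (r * I) * m, f (exp (s * I) * m)))
      (fun r _ => ((hder l (f (exp (s * I) * l)) r).sub
        (hder m (f (exp (s * I) * m)) r)).hasDerivWithinAt)
      (fun r _ => hbd r) (mem_univ s) (mem_univ 0)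
    simp only [ofReal_zero, zero_mul, exp_zero, one_mul, zero_sub, norm_neg] at hmv
    rw [hf.2 _ (hrot s l hl), hf.2 _ (hrot s m hm), sub_self, sub_zero] at hmv
    have e : R (l, f (exp (s * I) * l)) - t - (R (m, f (exp (s * I) * m)) - t) =
      R (l, f (exp (s * I) * l)) - R (m, f (exp (s * I) * m)) := by ring
    beta_reduce
    rw [e]
    refine hmv.trans ?_
    rw [Real.norm_eq_abs]
    have := abs_nonneg s
    have : 0 ≤ K' * |s| * ‖l - m‖ ^ α := by positivity
    nlinarith
  · have hl' := hsc (hrot s l hl)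
    have hmv := (convex_univ (𝕜 := ℝ) (E := ℝ)).norm_image_sub_le_of_norm_hasDerivWithin_le
      (f := fun r : ℝ => R (exp (r * I) * l, f (exp (s * I) * l)))
      (fun r _ => (hder l (f (exp (s * I) * l)) r).hasDerivWithinAt)
      (fun r _ => hK' _ (hsc (hrot r l hl)) _ (hM _ hl')) (mem_univ s) (mem_univ 0)
    simp only [ofReal_zero, zero_mul, exp_zero, one_mul, zero_sub, norm_neg] at hmv
    rw [hf.2 _ (hrot s l hl)] at hmv
    refine hmv.trans ?_
    rw [Real.norm_eq_abs]
    have : 0 ≤ K * (2 + C) * |s| := by positivity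
    nlinarith

theorem Sol.exists_deriv (hR : LogData R) (hE : StdEnd R) {T : ℝ} (hT : 0 ≤ T) :
    ∃ α : ℝ, 0 < α ∧ α < 1 ∧ ∀ t f, |t| ≤ T → Sol R t f → HolMem α f (closedBall (0 : ℂ) 1) ∧
      ∃ f' : ℂ → ℂ, (∀ z ∈ ball (0 : ℂ) 1, HasDerivAt f (f' z) z) ∧
        HolMem α f' (closedBall (0 : ℂ) 1) := by
  obtain ⟨κ, hκ0, hκ1, C, hC0, hC⟩ := uniform_holder hR hT
  refine ⟨κ / 2, half_pos hκ0, by linarith, fun t f ht hf => ?_⟩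
  have hb₀ := hC t f ht hf
  obtain ⟨B, hB0, -, hB⟩ := hb₀.holMem hκ0
  have hfα := hb₀.interpolate hC0 hB
  have hm : HolMem (κ / 2) f (closedBall (0 : ℂ) 1) := hfα.holMem (half_pos hκ0)
  refine ⟨hm, ?_⟩
  have hz0 : (0 : ℂ) ∈ closedBall (0 : ℂ) 1 := by simp
  obtain ⟨δ, hδ, C', hC', -, h2⟩ := local_structure hR hE (half_pos hκ0) (by linarith) hf hm hz0
  obtain ⟨A, hA, hdef⟩ := rotation_defect hR B (half_pos hκ0) (by linarith)
    (Real.sqrt_nonneg (2 * B * C))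
  have hdef := hdef t f hf (fun z hz => (abs_re_le_norm _).trans (hB z hz)) hfα
  have hrot : ∀ (s : ℝ), ∀ l ∈ closedBall (0 : ℂ) 1, exp (s * I) * l ∈ closedBall (0 : ℂ) 1 := by
    intro s l hl
    rw [mem_closedBall_zero_iff] at hl ⊢
    rwa [norm_mul, norm_rot, one_mul]
  set ε := min δ (δ ^ 2 / (4 * C + 1)) with hε
  have hε0 : 0 < ε := lt_min hδ (by positivity)
  have hεC : √(2 * ε * (C + C)) ≤ δ := by
    refine Real.sqrt_le_iff.2 ⟨hδ.le, ?_⟩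
    have : ε ≤ δ ^ 2 / (4 * C + 1) := min_le_right _ _
    rw [le_div_iff₀ (by positivity)] at this
    linarith
  obtain ⟨s₀, hs₀, hs₀'⟩ : ∃ s₀ > 0, ∀ s : ℝ, |s| ≤ s₀ → C * ‖exp (s * I) - 1‖ ^ κ ≤ ε := by
    have hc : Continuous fun s : ℝ => C * ‖exp (s * I) - 1‖ ^ κ :=
      continuous_const.mul (Continuous.rpow_const (by fun_prop) fun _ => Or.inr hκ0.le)
    have hl := hc.tendsto 0
    simp only [ofReal_zero, zero_mul, exp_zero, sub_self, norm_zero, Real.zero_rpow hκ0.ne',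
      mul_zero] at hl
    obtain ⟨s₀, hs₀, h⟩ := Metric.eventually_nhds_iff.1 (hl.eventually_lt_const hε0)
    refine ⟨s₀ / 2, half_pos hs₀, fun s hs => (h (y := s) ?_).le⟩
    rw [Real.dist_eq, sub_zero]
    linarith
  have hfs : ∀ s : ℝ, |s| ≤ s₀ →
      HolBd (κ / 2) (C' * A * |s|) (fun z => f (exp (s * I) * z) - f z)
        (Metric.closedBall (0 : ℂ) 1) := by
    intro s hs
    have hsup : ∀ z ∈ closedBall (0 : ℂ) 1, ‖f (exp (s * I) * z) - f z‖ ≤ ε := by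
      intro z hz
      refine (hb₀ _ (hrot s z hz) z hz).trans (le_trans ?_ (hs₀' s hs))
      gcongr
      have : exp (s * I) * z - z = (exp (s * I) - 1) * z := by ring
      rw [this, norm_mul]
      exact mul_le_of_le_one_right (norm_nonneg _) (mem_closedBall_zero_iff.1 hz)
    have hd : HolBd κ (C + C) (fun z =>
        f (exp (s * I) * z) - f z) (Metric.closedBall (0 : ℂ) 1) := by
      intro x hx y hy
      have e : f (exp (s * I) * x) - f x - (f (exp (s * I) * y) - f y) =
        (f (exp (s * I) * x) - f (exp (s * I) * y)) - (f x - f y) := by ring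
      have h1 := hb₀ _ (hrot s x hx) _ (hrot s y hy)
      rw [← mul_sub, norm_mul, norm_rot, one_mul] at h1
      beta_reduce
      rw [e, add_mul]
      exact (norm_sub_le _ _).trans (add_le_add h1 (hb₀ x hx y hy))
    have hdiff : DifferentiableOn ℂ (fun z => f (exp (s * I) * z)) (ball (0 : ℂ) 1) :=
      hf.1.2.comp (differentiableOn_const _ |>.mul differentiableOn_id) fun z hz => by
        rw [mem_ball_zero_iff] at hz ⊢
        change ‖exp (s * I) * z‖ < 1
        rwa [norm_mul, norm_rot, one_mul]
    have hzero : HolBd (κ / 2) δ (fun z => f z - f z) (closedBall (0 : ℂ) 1) := fun x _ y _ => by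
      simp only [sub_self, norm_zero]
      positivity
    have := (h2 t t (fun z => f (exp (s * I) * z)) f hdiff hf.1.2
      ((hd.interpolate (by positivity) hsup).mono hεC) (fun z hz =>
          (hsup z hz).trans (min_le_left _ _))
      (by simpa using hδ.le) hzero (fun z _ => by simpa using hδ.le) (by simpa using hδ.le)
      (A * |s|) (by positivity)
      (fun l hl m hm => by simpa [hf.2 l hl, hf.2 m hm] using (hdef s).1 l hl m hm)
      (fun l hl => by simpa [hf.2 l hl] using (hdef s).2 l hl)
      (by simpa using by positivity)).2.1
    rwa [← mul_assoc] at this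
  have hzf := HolBd.of_rotation hs₀ hf.1.2 fun s hs x hx y hy =>
    hfs s hs x (ball_subset_closedBall hx) y (ball_subset_closedBall hy)
  obtain ⟨D, hD⟩ := HolMem.of_mul_id (half_pos hκ0) (by linarith) (by positivity)
    (hf.1.2.deriv isOpen_ball) hzf
  obtain ⟨g, hg, hgD⟩ := hD.exists_extension (half_pos hκ0)
  refine ⟨g, fun z hz => ?_, hgD.holMem (half_pos hκ0)⟩
  rw [hg hz]
  exact (hf.1.2.differentiableAt (isOpen_ball.mem_nhds hz)).hasDerivAt

theorem c1AlphaOnDisk_exp {α : ℝ} (hα : 0 < α) {f f' : ℂ → ℂ}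
    (hf : HolMem α f (closedBall (0 : ℂ) 1))
    (hd : ∀ z ∈ ball (0 : ℂ) 1, HasDerivAt f (f' z) z)
    (hf' : HolMem α f' (closedBall (0 : ℂ) 1)) :
    ∃ g' : ℂ → ℂ, (∀ z ∈ ball (0 : ℂ) 1, HasDerivAt (fun z => exp (f z)) (g' z) z) ∧
      ContinuousOn g' (closedBall (0 : ℂ) 1) ∧
      ∃ A : ℝ, ∀ x ∈ closedBall (0 : ℂ) 1, ∀ y ∈ closedBall (0 : ℂ) 1,
        ‖g' x - g' y‖ ≤ A * ‖x - y‖ ^ α := by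
  have h := (hf.exp hα (isCompact_closedBall _ _)).mul hf'
  obtain ⟨A, -, hA, -⟩ := id h
  exact ⟨fun z => exp (f z) * f' z, fun z hz => (hd z hz).cexp, h.continuousOn hα, A, hA⟩

variable {F : ℂ → ℂ → ℝ}

/-- The defining function `log F(λ, e^ζ)`, extended smoothly from the circle to `ℂ`. -/
def logDefining (F : ℂ → ℂ → ℝ) (p : ℂ × ℂ) : ℝ :=
  Real.smoothTransition (4 * normSq p.1 - 1) * Real.log (F (p.1 / ‖p.1‖) (exp p.2))

theorem logDefining_of_sphere {l : ℂ} (hl : l ∈ sphere (0 : ℂ) 1) (ζ : ℂ) :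
    logDefining F (l, ζ) = Real.log (F l (exp ζ)) := by
  have h1 : ‖l‖ = 1 := by simpa using hl
  have h2 : normSq l = 1 := by rw [normSq_eq_norm_sq, h1]; norm_num
  simp only [logDefining, h1, h2, ofReal_one, div_one]
  rw [Real.smoothTransition.one_of_one_le (by norm_num), one_mul]

theorem div_norm_mem_sphere {l : ℂ} (hl : l ≠ 0) : l / ‖l‖ ∈ sphere (0 : ℂ) 1 := by
  simp [hl]

theorem contDiff_logDefining (hF : IsSmoothTorusFamily F) : ContDiff ℝ 3 (logDefining F) := by
  obtain ⟨h1, -, -, hpos, -, -⟩ := hF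
  rw [contDiff_iff_contDiffAt]
  rintro ⟨l, ζ⟩
  by_cases hl : l = 0
  · have : logDefining F =ᶠ[nhds (l, ζ)] fun _ => 0 := by
      have hc : Continuous fun p : ℂ × ℂ => 4 * normSq p.1 - 1 := by
        have := continuous_normSq
        fun_prop
      have ho : IsOpen {p : ℂ × ℂ | 4 * normSq p.1 - 1 < 0} :=
        isOpen_lt hc continuous_const
      filter_upwards [ho.mem_nhds (x := (l, ζ)) (by simp [hl])] with p hp
      have hp' : 4 * normSq p.1 - 1 < 0 := hp
      rw [logDefining, Real.smoothTransition.zero_of_nonpos hp'.le, zero_mul]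
    exact contDiffAt_const.congr_of_eventuallyEq this
  · have ho : IsOpen {p : ℂ × ℂ | p.1 ≠ 0} := isOpen_ne_fun continuous_fst continuous_const
    have hn : ContDiffOn ℝ 3 (fun p : ℂ × ℂ => (p.1 / ‖p.1‖, exp p.2)) {p | p.1 ≠ 0} := by
      intro p hp
      have hp' : p.1 ≠ 0 := hp
      have hnp : ContDiffAt ℝ 3 (fun p : ℂ × ℂ => ‖p.1‖) p :=
        contDiffAt_fst.norm ℝ hp'
      have hnp' : ContDiffAt ℝ 3 (fun p : ℂ × ℂ => ((‖p.1‖ : ℝ) : ℂ)) p :=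
        ofRealCLM.contDiff.contDiffAt.comp p hnp
      have he : ContDiffAt ℝ 3 (fun p : ℂ × ℂ => exp p.2) p := contDiffAt_snd.cexp
      have hd : ContDiffAt ℝ 3 (fun p : ℂ × ℂ => p.1 / ‖p.1‖) p := by
        simp only [div_eq_mul_inv]
        exact contDiffAt_fst.mul (hnp'.inv (by simpa using hp'))
      exact (hd.prodMk he).contDiffWithinAt
    have hcomp := (h1.of_le (m := 3)
        (WithTop.coe_le_coe.2 (le_top (a := (3 : ℕ∞))))).comp hn (fun p hp => by
      exact ⟨div_norm_mem_sphere hp, mem_univ _⟩)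
    have hG := hcomp.contDiffAt (ho.mem_nhds (x := (l, ζ)) hl)
    have hne : F (l / ‖l‖) (exp ζ) ≠ 0 :=
      (hpos _ (div_norm_mem_sphere hl) _ (exp_ne_zero _)).ne'
    have hlog := hG.log hne
    have hχ : ContDiffAt ℝ 3 (fun p : ℂ × ℂ => Real.smoothTransition (4 * normSq p.1 - 1))
        (l, ζ) := by
      have hns : ContDiff ℝ 3 (fun p : ℂ × ℂ => 4 * normSq p.1 - 1) := by
        have e : (fun p : ℂ × ℂ => 4 * normSq p.1 - 1) = fun p => 4 * ‖p.1‖ ^ 2 - 1 := by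
          ext p; rw [normSq_eq_norm_sq]
        rw [e]
        exact (contDiff_const.mul (contDiff_fst.norm_sq ℝ)).sub contDiff_const
      exact (Real.smoothTransition.contDiff.comp hns).contDiffAt
    exact hχ.mul hlog

theorem gradN_logDefining_ne_zero (hF : IsSmoothTorusFamily F) {l : ℂ}
    (hl : l ∈ sphere (0 : ℂ) 1) (ζ : ℂ) : gradN (logDefining F) (l, ζ) ≠ 0 := by
  have hd : HasFDerivAt (logDefining F) (fderiv ℝ (logDefining F) (l, ζ)) (l, ζ) :=
    ((contDiff_logDefining hF).differentiable (by norm_num) _).hasFDerivAt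
  obtain ⟨-, h2, -, hpos, hw, -⟩ := hF
  have hFl : HasFDerivAt (F l) (fderiv ℝ (F l) (exp ζ)) (exp ζ) :=
    ((h2 l hl).differentiable (by simp) _).hasFDerivAt
  have hp := hpos l hl _ (exp_ne_zero ζ)
  have hslice : HasFDerivAt (fun z : ℂ => (l, z)) (ContinuousLinearMap.inr ℝ ℂ ℂ) ζ :=
    hasFDerivAt_prodMk_right l ζ
  have e1 := hd.comp ζ hslice
  have hexp : HasFDerivAt exp
      (((ContinuousLinearMap.toSpanSingleton ℂ (exp ζ)).restrictScalars ℝ)) ζ :=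
    (hasDerivAt_exp ζ).hasFDerivAt.restrictScalars ℝ
  have e2 := (hFl.comp ζ hexp).log hp.ne'
  have e3 : (logDefining F ∘ fun z : ℂ => (l, z)) = fun z => Real.log ((F l ∘ exp) z) := by
    ext z
    exact logDefining_of_sphere hl z
  rw [e3] at e1
  have e4 := e1.unique e2
  intro h0
  have key : ∀ h : ℂ, fderiv ℝ (F l) (exp ζ) h = 0 := by
    intro h
    have := congrArg (fun A : ℂ →L[ℝ] ℝ => A (h / exp ζ)) e4
    simp only [ContinuousLinearMap.comp_apply, ContinuousLinearMap.inr_apply, fderiv_snd_eq, h0,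
      zero_mul, zero_re, Function.comp_apply, smul_apply, smul_eq_mul,
      ContinuousLinearMap.coe_restrictScalars', ContinuousLinearMap.toSpanSingleton_apply,
      div_mul_cancel₀ h (exp_ne_zero ζ)] at this
    rcases mul_eq_zero.1 this.symm with h | h
    · exact absurd h (inv_ne_zero hp.ne')
    · exact h
  refine hw l hl _ (exp_ne_zero ζ) ?_
  simp [wirt, key]

theorem norm_lt_of_range {c : ℝ → ℂ} (hc : Continuous c) {r : ℝ} (hr : ∀ s, ‖c s‖ ≠ r) {s₀ : ℝ}
    (h0 : ‖c s₀‖ < r) (s : ℝ) : ‖c s‖ < r := by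
  by_contra! h
  obtain ⟨x, -, hx⟩ := (isPreconnected_univ (α := ℝ)).intermediate_value (mem_univ s₀) (mem_univ s)
    hc.norm.continuousOn ⟨h0.le, h⟩
  exact hr x hx

theorem IsSmoothTorusFamily.exists_level_bound_nhds (hF : IsSmoothTorusFamily F) {l₀ : ℂ}
    (hl₀ : l₀ ∈ sphere (0 : ℂ) 1) {t₀ : ℝ} (ht₀ : 0 < t₀) :
    ∃ M : ℝ, ∃ δ > 0, ∀ l ∈ sphere (0 : ℂ) 1, ∀ t, dist l l₀ < δ → |t - t₀| < δ →
      ∀ w, F l w = t → ‖w‖ < M := by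
  obtain ⟨h1, h2, -, hpos, hw, hc⟩ := hF
  have hcont : ContinuousOn (fun p : ℂ × ℂ => F p.1 p.2) (sphere (0 : ℂ) 1 ×ˢ univ) :=
    h1.continuousOn
  obtain ⟨c, ⟨hsm, hper, -, -⟩, hc0, -, hrange⟩ := hc l₀ hl₀ t₀ ht₀
  have hcc : Continuous c := hsm.continuous
  obtain ⟨M, hM⟩ : ∃ M, ∀ s, ‖c s‖ < M := by
    have hp : Function.Periodic c (2 * Real.pi) := hper
    obtain ⟨B, hB⟩ := isCompact_Icc.exists_bound_of_continuousOn
      (hcc.continuousOn (s := Icc 0 (0 + 2 * Real.pi)))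
    refine ⟨B + 1, fun s => ?_⟩
    obtain ⟨y, hy, e⟩ := hp.exists_mem_Ico₀ Real.two_pi_pos s
    rw [e]
    have := hB y ⟨hy.1, by linarith [hy.2]⟩
    linarith
  have hlev : ∀ w, F l₀ w = t₀ → ‖w‖ < M := by
    intro w hw'
    have : w ∈ range c := by rw [hrange]; exact hw'
    obtain ⟨s, rfl⟩ := this
    exact hM s
  have hc00 : F l₀ (c 0) = t₀ := by
    have : c 0 ∈ range c := mem_range_self 0
    rw [hrange] at this
    exact this
  have hgrad : fderiv ℝ (F l₀) (c 0) ≠ 0 := by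
    intro h
    exact hw l₀ hl₀ _ (hc0 0) (by simp [wirt, h])
  have hball : ball (0 : ℂ) M ∈ nhds (c 0) :=
    isOpen_ball.mem_nhds (x := c 0) (by simpa using hM 0)
  obtain ⟨w₁, hw₁, hlt⟩ : ∃ w ∈ ball (0 : ℂ) M, F l₀ w < t₀ := by
    by_contra! h
    have : IsLocalMin (F l₀) (c 0) := by
      filter_upwards [hball] with w hw'
      rw [hc00]
      exact h w hw'
    exact hgrad this.fderiv_eq_zero
  obtain ⟨w₂, hw₂, hgt⟩ : ∃ w ∈ ball (0 : ℂ) M, t₀ < F l₀ w := by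
    by_contra! h
    have : IsLocalMax (F l₀) (c 0) := by
      filter_upwards [hball] with w hw'
      rw [hc00]
      exact h w hw'
    exact hgrad this.fderiv_eq_zero
  have hslice : ∀ w, ContinuousOn (fun l => F l w) (sphere (0 : ℂ) 1) := fun w =>
    hcont.comp (f := fun l => (l, w)) (by fun_prop) (fun l hl => ⟨hl, mem_univ _⟩)
  have hfib : ∀ l ∈ sphere (0 : ℂ) 1, Continuous (F l) := fun l hl => (h2 l hl).continuous
  have near : ∀ w, ∀ η > 0, ∃ δ > 0, ∀ l ∈ sphere (0 : ℂ) 1, dist l l₀ < δ →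
      |F l w - F l₀ w| < η := by
    intro w η hη
    obtain ⟨δ, hδ, h⟩ := Metric.continuousOn_iff.1 (hslice w) l₀ hl₀ η hη
    exact ⟨δ, hδ, fun l hl hd => by simpa [Real.dist_eq] using h l hl hd⟩
  obtain ⟨δ₁, hδ₁, n₁⟩ := near w₁ ((t₀ - F l₀ w₁) / 2) (by linarith)
  obtain ⟨δ₂, hδ₂, n₂⟩ := near w₂ ((F l₀ w₂ - t₀) / 2) (by linarith)
  obtain ⟨δ₃, hδ₃, n₃⟩ : ∃ δ > 0, ∀ l ∈ sphere (0 : ℂ) 1, ∀ t, dist l l₀ < δ → |t - t₀| < δ →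
      ∀ w ∈ sphere (0 : ℂ) M, F l w ≠ t := by
    have hcomp : IsCompact (sphere (0 : ℂ) 1 ×ˢ sphere (0 : ℂ) M) :=
      (isCompact_sphere 0 1).prod (isCompact_sphere 0 M)
    have huc := hcomp.uniformContinuousOn_of_continuous
      (hcont.mono (prod_mono Subset.rfl (subset_univ _)))
    obtain ⟨η, hη, hη'⟩ : ∃ η > 0, ∀ w ∈ sphere (0 : ℂ) M, η ≤ |F l₀ w - t₀| := by
      rcases (sphere (0 : ℂ) M).eq_empty_or_nonempty with he | hne
      · exact ⟨1, one_pos, fun w hw' => by rw [he] at hw'; exact hw'.elim⟩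
      · have hco : ContinuousOn (fun w => |F l₀ w - t₀|) (sphere (0 : ℂ) M) :=
          (((hfib l₀ hl₀).sub continuous_const).abs).continuousOn
        obtain ⟨w, hw', hmin⟩ := (isCompact_sphere (0 : ℂ) M).exists_isMinOn hne hco
        refine ⟨|F l₀ w - t₀|, ?_, fun v hv => hmin hv⟩
        refine abs_pos.2 (sub_ne_zero.2 fun h => ?_)
        have := hlev w h
        have hw'' : ‖w‖ = M := by simpa using hw'
        linarith
    obtain ⟨δ, hδ, h⟩ := Metric.uniformContinuousOn_iff.1 huc (η / 2) (by linarith)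
    refine ⟨min δ (η / 2), by positivity, fun l hl t hd ht w hw' e => ?_⟩
    have h3 := h (l, w) ⟨hl, hw'⟩ (l₀, w) ⟨hl₀, hw'⟩ (by
      rw [Prod.dist_eq]
      simp only [dist_self]
      exact max_lt (hd.trans_le (min_le_left _ _)) hδ)
    simp only [Real.dist_eq, e] at h3
    have h4 := hη' w hw'
    have h5 := ht.trans_le (min_le_right _ _)
    rw [abs_lt] at h3 h5
    rcases le_abs.1 h4 with h6 | h6 <;> linarith
  refine ⟨M, min (min δ₁ δ₂) (min δ₃ (min (min ((t₀ - F l₀ w₁) / 2) ((F l₀ w₂ - t₀) / 2)) t₀)),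
    ?_, fun l hl t hd ht w hw' => ?_⟩
  · have h3 : 0 < (t₀ - F l₀ w₁) / 2 := by linarith
    have h4 : 0 < (F l₀ w₂ - t₀) / 2 := by linarith
    positivity
  · simp only [lt_min_iff] at hd ht
    obtain ⟨⟨hd1, hd2⟩, hd3, -⟩ := hd
    obtain ⟨-, ht3, ⟨ht4, ht5⟩, ht6⟩ := ht
    have hn1 := n₁ l hl hd1
    have hn2 := n₂ l hl hd2
    have hn3 := n₃ l hl t hd3 ht3
    rw [abs_lt] at hn1 hn2 ht4 ht5 ht6
    obtain ⟨v, hv, hvt⟩ := (convex_ball (0 : ℂ) M).isPreconnected.intermediate_value hw₁ hw₂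
      (hfib l hl).continuousOn (show t ∈ Icc (F l w₁) (F l w₂) from ⟨by linarith, by linarith⟩)
    obtain ⟨c', ⟨hsm', -, -, -⟩, -, -, hrange'⟩ := hc l hl t (by linarith)
    obtain ⟨s₀, rfl⟩ : v ∈ range c' := by rw [hrange']; exact hvt
    obtain ⟨s, rfl⟩ : w ∈ range c' := by rw [hrange']; exact hw'
    refine norm_lt_of_range hsm'.continuous (fun s hs => ?_) (by simpa using hv) s
    refine hn3 (c' s) (by simpa using hs) ?_
    have : c' s ∈ range c' := mem_range_self s
    rw [hrange'] at this
    exact this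

theorem IsSmoothTorusFamily.exists_bound (hF : IsSmoothTorusFamily F) (T : ℝ) :
    ∃ M, ∀ l ∈ sphere (0 : ℂ) 1, ∀ w, F l w ≤ T → ‖w‖ ≤ M := by
  have hF' := hF
  obtain ⟨-, -, ⟨ε, hε, hstd⟩, hpos, -, hc⟩ := hF'
  have hcomp : IsCompact (sphere (0 : ℂ) 1 ×ˢ Icc (ε / 2) T) :=
    (isCompact_sphere 0 1).prod isCompact_Icc
  obtain ⟨M, hM⟩ : ∃ M, ∀ p ∈ sphere (0 : ℂ) 1 ×ˢ Icc (ε / 2) T, ∀ w, F p.1 w = p.2 → ‖w‖ ≤ M := by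
    refine hcomp.induction_on (p := fun s => ∃ M, ∀ p ∈ s, p.1 ∈ sphere (0 : ℂ) 1 → ∀ w,
      F p.1 w = p.2 → ‖w‖ ≤ M) ?_ ?_ ?_ ?_ |>.imp fun M hM p hp => hM p hp hp.1
    · exact ⟨0, fun p hp => hp.elim⟩
    · rintro s t hst ⟨M, hM⟩
      exact ⟨M, fun p hp => hM p (hst hp)⟩
    · rintro s t ⟨M, hM⟩ ⟨N, hN⟩
      refine ⟨max M N, fun p hp hp1 w hw => ?_⟩
      rcases hp with hp | hp
      · exact (hM p hp hp1 w hw).trans (le_max_left _ _)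
      · exact (hN p hp hp1 w hw).trans (le_max_right _ _)
    · rintro ⟨l₀, t₀⟩ ⟨hl₀, ht₀⟩
      obtain ⟨M, δ, hδ, h⟩ := hF.exists_level_bound_nhds hl₀ (t₀ := t₀) (by linarith [ht₀.1])
      refine ⟨ball (l₀, t₀) δ, mem_nhdsWithin_of_mem_nhds (ball_mem_nhds _ hδ), M,
        fun p hp hp1 w hw => ?_⟩
      rw [mem_ball, Prod.dist_eq] at hp
      exact (h p.1 hp1 p.2 ((le_max_left _ _).trans_lt hp)
        (by rw [← Real.dist_eq]; exact (le_max_right _ _).trans_lt hp) w hw).le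
  refine ⟨max M (Real.sqrt ε), fun l hl w hw => ?_⟩
  by_cases hlarge : ε / 2 ≤ F l w
  · exact (hM (l, F l w) ⟨hl, hlarge, hw⟩ w rfl).trans (le_max_left _ _)
  refine le_trans ?_ (le_max_right _ _)
  rcases eq_or_ne w 0 with rfl | hw0
  · simp
  push Not at hlarge
  have ht := hpos l hl w hw0
  obtain ⟨c, ⟨hsm, -, -, -⟩, -, -, hrange⟩ := hc l hl (F l w) ht
  have hmem : ∀ s, F l (c s) = F l w := fun s => by
    have : c s ∈ range c := mem_range_self s
    rw [hrange] at this
    exact this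
  have hsq : ∀ r : ℝ, 0 ≤ r → normSq ((r.sqrt : ℝ) : ℂ) = r := fun r hr => by
    rw [normSq_ofReal, Real.mul_self_sqrt hr]
  obtain ⟨s₀, hs₀⟩ : (((F l w).sqrt : ℝ) : ℂ) ∈ range c := by
    rw [hrange]
    change F l _ = F l w
    rw [hstd l hl _ (by rw [hsq _ ht.le]; linarith), hsq _ ht.le]
  obtain ⟨s, hs⟩ : w ∈ range c := by rw [hrange]; exact rfl
  have hlt := norm_lt_of_range hsm.continuous (r := Real.sqrt (3 * ε / 4)) (fun s' hs' => ?_)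
    (s₀ := s₀) ?_ s
  · rw [hs] at hlt
    exact hlt.le.trans (Real.sqrt_le_sqrt (by linarith))
  · have e : normSq (c s') = 3 * ε / 4 := by
      rw [normSq_eq_norm_sq, hs', Real.sq_sqrt (by linarith)]
    have := hstd l hl (c s') (by linarith)
    rw [hmem, e] at this
    linarith
  · rw [hs₀, norm_real, Real.norm_of_nonneg (Real.sqrt_nonneg _)]
    exact Real.sqrt_lt_sqrt ht.le (by linarith)

theorem stdEnd_logDefining (hF : IsSmoothTorusFamily F) : StdEnd (logDefining F) := by
  obtain ⟨-, -, ⟨ε, hε, hstd⟩, -, -, -⟩ := hF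
  refine ⟨Real.log (ε / 2) / 2, fun l hl ζ hζ => ?_⟩
  have e : normSq (exp ζ) = Real.exp (2 * ζ.re) := by
    rw [normSq_eq_norm_sq, norm_exp, ← Real.exp_nat_mul]
    norm_num
  have hlt : normSq (exp ζ) < ε := by
    rw [e]
    calc Real.exp (2 * ζ.re) ≤ Real.exp (Real.log (ε / 2)) := Real.exp_le_exp.2 (by linarith)
      _ = ε / 2 := Real.exp_log (by linarith)
      _ < ε := by linarith
  rw [logDefining_of_sphere hl, hstd l hl _ hlt, e, Real.log_exp]

theorem logData_logDefining (hF : IsSmoothTorusFamily F) : LogData (logDefining F) where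
  smooth := contDiff_logDefining hF
  periodic l ζ := by simp only [logDefining]; rw [exp_periodic ζ]
  grad l hl ζ := gradN_logDefining_ne_zero hF hl ζ
  top T := by
    obtain ⟨M, hM⟩ := hF.exists_bound (Real.exp T)
    refine ⟨Real.log (|M| + 1), fun l hl ζ hζ => ?_⟩
    rw [logDefining_of_sphere hl]
    have hp := hF.2.2.2.1 l hl _ (exp_ne_zero ζ)
    rw [Real.lt_log_iff_exp_lt hp]
    by_contra! h
    have h1 := hM l hl _ h
    rw [norm_exp] at h1
    have h2 := Real.exp_le_exp.2 hζ
    rw [Real.exp_log (by positivity)] at h2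
    linarith [le_abs_self M]
  bot T := by
    obtain ⟨M₀, hM₀⟩ := stdEnd_logDefining hF
    refine ⟨max (-M₀) (-(T / 2) + 1), fun l hl ζ hζ => ?_⟩
    have h1 := le_max_left (-M₀) (-(T / 2) + 1)
    have h2 := le_max_right (-M₀) (-(T / 2) + 1)
    rw [hM₀ l hl ζ (by linarith)]
    linarith

/-- A continuous nonvanishing function on the closed disk, holomorphic in the interior, has a
logarithm with the same properties. -/
theorem HolDisk.exists_log {h : ℂ → ℂ} (hh : HolDisk h)
    (h0 : ∀ z ∈ closedBall (0 : ℂ) 1, h z ≠ 0) :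
    ∃ f : ℂ → ℂ, HolDisk f ∧ ∀ z ∈ closedBall (0 : ℂ) 1, exp (f z) = h z := by
  obtain ⟨μ, hμ, hμh⟩ : ∃ μ > 0, ∀ z ∈ closedBall (0 : ℂ) 1, μ ≤ ‖h z‖ := by
    obtain ⟨z, hz, hmin⟩ := (isCompact_closedBall (0 : ℂ) 1).exists_isMinOn ⟨0, by simp⟩
      hh.1.norm
    exact ⟨‖h z‖, norm_pos_iff.2 (h0 z hz), fun w hw => hmin hw⟩
  obtain ⟨δ, hδ, huc⟩ := Metric.uniformContinuousOn_iff.1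
    ((isCompact_closedBall (0 : ℂ) 1).uniformContinuousOn_of_continuous hh.1) μ hμ
  obtain ⟨n, hn⟩ := exists_nat_gt (1 / δ)
  have hn0 : (0 : ℝ) < n := (by positivity : 0 < 1 / δ).trans hn
  have hscale : ∀ k : ℕ, k ≤ n → ∀ z ∈ closedBall (0 : ℂ) 1,
      ((k / n : ℝ) : ℂ) * z ∈ closedBall (0 : ℂ) 1 := fun k hk z hz => by
    rw [mem_closedBall_zero_iff] at hz ⊢
    rw [norm_mul, norm_real, Real.norm_of_nonneg (by positivity)]
    have : (k / n : ℝ) ≤ 1 := (div_le_one hn0).2 (by exact_mod_cast hk)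
    exact mul_le_one₀ this (norm_nonneg _) hz
  have hscale' : ∀ k : ℕ, k ≤ n → ∀ z ∈ ball (0 : ℂ) 1,
      ((k / n : ℝ) : ℂ) * z ∈ ball (0 : ℂ) 1 := fun k hk z hz => by
    rw [mem_ball_zero_iff] at hz ⊢
    rw [norm_mul, norm_real, Real.norm_of_nonneg (by positivity)]
    have : (k / n : ℝ) ≤ 1 := (div_le_one hn0).2 (by exact_mod_cast hk)
    exact (mul_le_of_le_one_left (norm_nonneg _) this).trans_lt hz
  have hc : ∀ k : ℕ, k ≤ n →
      ContinuousOn (fun z => h (((k / n : ℝ) : ℂ) * z)) (closedBall (0 : ℂ) 1) := fun k hk =>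
    hh.1.comp (f := fun z => ((k / n : ℝ) : ℂ) * z) (by fun_prop) (hscale k hk)
  have hd : ∀ k : ℕ, k ≤ n →
      DifferentiableOn ℂ (fun z => h (((k / n : ℝ) : ℂ) * z)) (ball (0 : ℂ) 1) := fun k hk =>
    hh.2.comp (f := fun z => ((k / n : ℝ) : ℂ) * z) (by fun_prop) (hscale' k hk)
  have key : ∀ k : ℕ, k ≤ n → ∃ f : ℂ → ℂ, HolDisk f ∧
      ∀ z ∈ closedBall (0 : ℂ) 1, exp (f z) = h (((k / n : ℝ) : ℂ) * z) := by
    intro k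
    induction k with
    | zero =>
      intro _
      refine ⟨fun _ => log (h 0), ⟨continuousOn_const, differentiableOn_const _⟩, fun z _ => ?_⟩
      rw [exp_log (h0 0 (by simp))]
      simp
    | succ k ih =>
      intro hk
      obtain ⟨f, hf, hfe⟩ := ih (by omega)
      have hk' : k ≤ n := by omega
      have hne : ∀ z ∈ closedBall (0 : ℂ) 1, h (((k / n : ℝ) : ℂ) * z) ≠ 0 := fun z hz =>
        h0 _ (hscale k hk' z hz)
      have hslit : ∀ z ∈ closedBall (0 : ℂ) 1,
          h ((((k + 1 : ℕ) / n : ℝ) : ℂ) * z) / h (((k / n : ℝ) : ℂ) * z) ∈ slitPlane := by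
        intro z hz
        refine ball_one_subset_slitPlane ?_
        have h1 := huc _ (hscale (k + 1) hk z hz) _ (hscale k hk' z hz) (by
          rw [dist_eq_norm, ← sub_mul, ← ofReal_sub, norm_mul, norm_real, ← sub_div]
          push_cast
          rw [add_sub_cancel_left, Real.norm_of_nonneg (by positivity)]
          have hz' : ‖z‖ ≤ 1 := by simpa using hz
          calc 1 / (n : ℝ) * ‖z‖ ≤ 1 / n * 1 := by gcongr
            _ < δ := by
              rw [mul_one]
              exact (one_div_lt hδ hn0).1 hn)
        rw [mem_ball, dist_eq_norm, div_sub_one (hne z hz), norm_div,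
          div_lt_one (norm_pos_iff.2 (hne z hz))]
        rw [dist_eq_norm] at h1
        exact h1.trans_le (hμh _ (hscale k hk' z hz))
      refine ⟨fun z => f z + log (h ((((k + 1 : ℕ) / n : ℝ) : ℂ) * z) / h (((k / n : ℝ) : ℂ) * z)),
        ⟨hf.1.add (((hc (k + 1) hk).div (hc k hk') hne).clog hslit),
          hf.2.add (((hd (k + 1) hk).div (hd k hk') fun z hz =>
            hne z (ball_subset_closedBall hz)).clog fun z hz =>
              hslit z (ball_subset_closedBall hz))⟩, fun z hz => ?_⟩
      rw [exp_add, hfe z hz, exp_log (slitPlane_ne_zero (hslit z hz)), mul_div_cancel₀ _ (hne z hz)]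
  obtain ⟨f, hf, hfe⟩ := key n le_rfl
  refine ⟨f, hf, fun z hz => ?_⟩
  rw [hfe z hz, div_self hn0.ne', ofReal_one, one_mul]

/-- The solutions, parametrized by a purely imaginary coordinate `ζ` and the level `s`. -/
theorem exists_log_foliation (hR : LogData R) (hE : StdEnd R) :
    ∃ L : ℂ → ℝ → ℂ → ℂ, (∀ ζ s, Sol R s (L ζ s)) ∧
      ContinuousOn (fun p : (ℂ × ℝ) × ℂ => L p.1.1 p.1.2 p.2) (univ ×ˢ closedBall (0 : ℂ) 1) ∧
      (∀ z ∈ closedBall (0 : ℂ) 1, ∀ ζ s, ∀ k : ℤ,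
        L (ζ + k * (2 * Real.pi * I)) s z = L ζ s z + k * (2 * Real.pi * I)) ∧
      (∀ z ∈ closedBall (0 : ℂ) 1, ∀ ζ ζ' s s', ζ.re = 0 → ζ'.re = 0 → L ζ s z = L ζ' s' z →
        ζ = ζ' ∧ s = s') ∧
      (∀ z ∈ closedBall (0 : ℂ) 1, ∀ c, ∃ ζ s, ζ.re = 0 ∧ L ζ s z = c) ∧
      (∀ s f, Sol R s f → ∃ ζ, ζ.re = 0 ∧ ∀ z ∈ closedBall (0 : ℂ) 1, f z = L ζ s z) ∧
      ∃ s₀, ∀ s ≤ s₀, ∀ ζ, ∀ z ∈ closedBall (0 : ℂ) 1, (L ζ s z).re = s / 2 := by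
  have h1 : (1 : ℂ) ∈ sphere (0 : ℂ) 1 := by simp
  have h1' : (1 : ℂ) ∈ closedBall (0 : ℂ) 1 := by simp
  obtain ⟨m, -, hconst, hstd, hlow⟩ := exists_const_level hR hE
  obtain ⟨Φ, hΦc, hΦ0, hΦline, hΦΦ, hΦper⟩ := exists_flow hR h1
  obtain ⟨u, hu, hu1, huniq, huinj, husurj, huper, huc⟩ := exists_solution_family hR hE
  have hlevel : ∀ ζ s, R (1, Φ ζ s) = s := fun ζ s => (hΦline ζ s (mem_univ _)).2
  have hsection : ∀ ζ : ℂ, ζ.re = 0 → R (1, m + ζ) = 2 * m := fun ζ hζ => by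
    rw [hstd _ (by simp [hζ]) 1 h1]
    simp [hζ]
  have hfoot : ∀ ζ, (Φ ζ (2 * m) - m).re = 0 := fun ζ => by
    have e := hlevel ζ (2 * m)
    have h2 := hstd _ (hlow 1 h1 _ e.le) 1 h1
    rw [e] at h2
    simp
    linarith
  have hback : ∀ ζ, Φ (m + (Φ ζ (2 * m) - m)) (R (1, ζ)) = ζ := fun ζ => by
    rw [add_sub_cancel, hΦΦ, hΦ0]
  have hΦint : ∀ (k : ℤ) ζ s, Φ (ζ + k * (2 * Real.pi * I)) s = Φ ζ s + k * (2 * Real.pi * I) := by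
    intro k ζ s
    have h2 := periodic_int (g := fun ζ => Φ ζ s - ζ) (fun ζ => by rw [hΦper]; ring) k ζ
    beta_reduce at h2
    linear_combination h2
  refine ⟨fun ζ s => u (Φ (m + ζ) s), fun ζ s => ?_, ?_, fun z hz ζ s k => ?_,
    fun z hz ζ ζ' s s' h0 h0' h => ?_, fun z hz c => ?_, fun s f hf => ?_, 2 * m,
    fun s hs ζ z hz => ?_⟩
  · have := hu (Φ (m + ζ) s)
    rwa [hlevel] at this
  · refine huc.comp (f := fun p : (ℂ × ℝ) × ℂ => (Φ (m + p.1.1) p.1.2, p.2)) ?_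
      fun p hp => ⟨mem_univ _, hp.2⟩
    have : Continuous fun p : (ℂ × ℝ) × ℂ => Φ (m + p.1.1) p.1.2 :=
      hΦc.comp (f := fun p : (ℂ × ℝ) × ℂ => ((m : ℂ) + p.1.1, p.1.2)) (by fun_prop)
    exact (this.prodMk continuous_snd).continuousOn
  · beta_reduce
    rw [← add_assoc, hΦint, huper z hz]
  · have e := huinj z hz _ _ h
    have hs : s = s' := by rw [← hlevel (m + ζ) s, e, hlevel]
    refine ⟨?_, hs⟩
    have e2 := congrArg (fun x => Φ x (2 * m)) e
    beta_reduce at e2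
    rw [hΦΦ, hΦΦ] at e2
    conv_lhs at e2 => rw [← hsection ζ h0, hΦ0]
    conv_rhs at e2 => rw [← hsection ζ' h0', hΦ0]
    exact add_left_cancel e2
  · obtain ⟨ζ, hζ⟩ := husurj z hz c
    exact ⟨Φ ζ (2 * m) - m, R (1, ζ), hfoot ζ, by beta_reduce; rw [hback, hζ]⟩
  · refine ⟨Φ (f 1) (2 * m) - m, hfoot _, fun z hz => ?_⟩
    rw [huniq s f hf z hz]
    conv_lhs => rw [← hback (f 1), hf.2 1 h1]
  · have hsol := hu (Φ (m + ζ) s)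
    rw [hlevel] at hsol
    have hc := hconst s _ hsol hs
    beta_reduce
    rw [hc z hz, ← hc 1 h1', hu1]
    have e := hlevel (m + ζ) s
    have h2 := hstd _ (hlow 1 h1 _ (e.trans_le hs)) 1 h1
    rw [e] at h2
    linarith

theorem sol_logDefining_iff (hF : IsSmoothTorusFamily F) {t : ℝ} (ht : 0 < t) {f : ℂ → ℂ}
    (hf : HolDisk f) : Sol (logDefining F) (Real.log t) f ↔
      DiskTraceIn (fun l => exp (f l)) (TorusOf F t) := by
  constructor
  · intro h l hl
    refine ⟨hl, ?_⟩
    have h2 := h.2 l hl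
    rw [logDefining_of_sphere hl] at h2
    exact Real.log_injOn_pos (hF.2.2.2.1 l hl _ (exp_ne_zero _)) ht h2
  · intro h
    refine ⟨hf, fun l hl => ?_⟩
    rw [logDefining_of_sphere hl]
    exact congrArg Real.log (h l hl).2

theorem IsSmoothTorusFamily.ne_zero (hF : IsSmoothTorusFamily F) {t : ℝ} (ht : 0 < t) {p : ℂ × ℂ}
    (hp : p ∈ TorusOf F t) : p.2 ≠ 0 := by
  obtain ⟨-, -, ⟨ε, hε, hstd⟩, -⟩ := hF
  intro h0
  have h1 : F p.1 p.2 = t := hp.2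
  rw [h0, hstd p.1 hp.1 0 (by simpa using hε), map_zero] at h1
  exact ht.ne h1

theorem log_re_eq_zero {ξ : ℂ} (hξ : ξ ∈ sphere (0 : ℂ) 1) : (log ξ).re = 0 := by
  rw [log_re, (by simpa using hξ : ‖ξ‖ = 1), Real.log_one]

theorem exp_mem_sphere {ζ : ℂ} (hζ : ζ.re = 0) : exp ζ ∈ sphere (0 : ℂ) 1 := by
  rw [mem_sphere_zero_iff_norm, norm_exp, hζ, Real.exp_zero]

theorem IsSmoothTorusFamily.exists_filling (hF : IsSmoothTorusFamily F) :
    ∃ g : ℂ → ℂ → ℝ → ℂ,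
      ContinuousOn (fun q : (ℂ × ℂ) × ℝ => g q.1.1 q.1.2 q.2)
        ((closedBall (0 : ℂ) 1 ×ˢ sphere (0 : ℂ) 1) ×ˢ Ici (0 : ℝ)) ∧
      (∀ l ξ, g l ξ 0 = 0) ∧
      (∀ t, 0 < t → ∀ ξ ∈ sphere (0 : ℂ) 1, ∃ f, Sol (logDefining F) (Real.log t) f ∧
        ∀ l, g l ξ t = exp (f l)) ∧
      (∀ t₁ t₂ : ℝ, 0 < t₁ → 0 < t₂ → ∀ ξ₁ ∈ sphere (0 : ℂ) 1, ∀ ξ₂ ∈ sphere (0 : ℂ) 1,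
        ∀ l ∈ closedBall (0 : ℂ) 1, g l ξ₁ t₁ = g l ξ₂ t₂ → t₁ = t₂ ∧ ξ₁ = ξ₂) ∧
      (∀ l ∈ closedBall (0 : ℂ) 1, ∀ w ≠ 0, ∃ ξ ∈ sphere (0 : ℂ) 1, ∃ t, 0 < t ∧ g l ξ t = w) ∧
      (∀ t, 0 < t → ∀ f, Sol (logDefining F) (Real.log t) f → ∃ ξ ∈ sphere (0 : ℂ) 1,
        ∀ l ∈ closedBall (0 : ℂ) 1, exp (f l) = g l ξ t) := by
  obtain ⟨L, hsol, hcont, hper, hinj, hsurj, huniq, s₀, hbound⟩ :=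
    exists_log_foliation (logData_logDefining hF) (stdEnd_logDefining hF)
  have hexp : ∀ z ∈ closedBall (0 : ℂ) 1, ∀ ζ ζ' s, exp ζ = exp ζ' →
      exp (L ζ s z) = exp (L ζ' s z) := by
    intro z hz ζ ζ' s h
    obtain ⟨k, rfl⟩ := exp_eq_exp_iff_exists_int.1 h
    rw [hper z hz]
    exact exp_eq_exp_iff_exists_int.2 ⟨k, rfl⟩
  have hinj' : ∀ z ∈ closedBall (0 : ℂ) 1, ∀ ζ ζ' s s', ζ.re = 0 → ζ'.re = 0 →
      exp (L ζ s z) = exp (L ζ' s' z) → s = s' ∧ exp ζ = exp ζ' := by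
    intro z hz ζ ζ' s s' h0 h0' h
    obtain ⟨k, hk⟩ := exp_eq_exp_iff_exists_int.1 h
    rw [← hper z hz] at hk
    obtain ⟨h1, h2⟩ := hinj z hz _ _ _ _ h0 (by simpa using h0') hk
    exact ⟨h2, exp_eq_exp_iff_exists_int.2 ⟨k, h1⟩⟩
  set g : ℂ → ℂ → ℝ → ℂ := fun l ξ t => if 0 < t then exp (L (log ξ) (Real.log t) l) else 0 with hg
  have hgpos : ∀ {t : ℝ}, 0 < t → ∀ l ξ, g l ξ t = exp (L (log ξ) (Real.log t) l) :=
    fun ht l ξ => if_pos ht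
  have hne : ∀ {ξ : ℂ}, ξ ∈ sphere (0 : ℂ) 1 → ξ ≠ 0 := fun h => ne_of_mem_sphere h one_ne_zero
  have hsmall : ∀ t : ℝ, 0 ≤ t → t ≤ Real.exp s₀ → ∀ ξ, ∀ l ∈ closedBall (0 : ℂ) 1,
      ‖g l ξ t‖ ≤ Real.sqrt t := by
    intro t ht ht' ξ l hl
    rcases ht.eq_or_lt with rfl | ht
    · simp [hg]
    rw [hgpos ht, norm_exp, hbound _ ((Real.log_le_iff_le_exp ht).2 ht') _ l hl,
      ← Real.log_sqrt ht.le, Real.exp_log (Real.sqrt_pos.2 ht)]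
  refine ⟨g, ?_, fun l ξ => if_neg (lt_irrefl 0), fun t ht ξ _ =>
    ⟨L (log ξ) (Real.log t), hsol _ _, fun l => hgpos ht l ξ⟩, ?_, ?_, ?_⟩
  · rintro ⟨⟨l₀, ξ₀⟩, t₀⟩ ⟨⟨hl₀, hξ₀⟩, ht₀⟩
    rcases (show 0 ≤ t₀ from ht₀).eq_or_lt with rfl | ht₀
    · have e0 : g l₀ ξ₀ 0 = 0 := if_neg (lt_irrefl 0)
      rw [ContinuousWithinAt]
      simp only [e0]
      refine squeeze_zero_norm' (a := fun q : (ℂ × ℂ) × ℝ => Real.sqrt q.2) ?_ ?_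
      · have ho : IsOpen {q : (ℂ × ℂ) × ℝ | q.2 < Real.exp s₀} :=
          isOpen_lt continuous_snd continuous_const
        filter_upwards [mem_nhdsWithin_of_mem_nhds
          (ho.mem_nhds (x := ((l₀, ξ₀), 0)) (Real.exp_pos s₀)), self_mem_nhdsWithin] with q hq hq'
        exact hsmall q.2 hq'.2 (le_of_lt hq) _ _ hq'.1.1
      · have : Continuous fun q : (ℂ × ℂ) × ℝ => Real.sqrt q.2 := continuous_snd.sqrt
        have h2 := this.tendsto ((l₀, ξ₀), (0 : ℝ))
        simp only [Real.sqrt_zero] at h2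
        exact h2.mono_left nhdsWithin_le_nhds
    · have hslit : ξ₀ / ξ₀ ∈ slitPlane := by rw [div_self (hne hξ₀)]; exact one_mem_slitPlane
      have hdiv : ContinuousAt (fun q : (ℂ × ℂ) × ℝ => q.1.2 / ξ₀) ((l₀, ξ₀), t₀) := by fun_prop
      obtain ⟨φ, hφ⟩ : ∃ φ : (ℂ × ℂ) × ℝ → (ℂ × ℝ) × ℂ, ∀ q,
          φ q = ((log ξ₀ + log (q.1.2 / ξ₀), Real.log q.2), q.1.1) := ⟨_, fun _ => rfl⟩
      have hlog : ContinuousAt φ ((l₀, ξ₀), t₀) := by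
        rw [funext hφ]
        refine ((continuousAt_const.add (hdiv.clog hslit)).prodMk
          (ContinuousAt.log ?_ ht₀.ne')).prodMk ?_ <;> fun_prop
      have hmaps : MapsTo φ ((closedBall (0 : ℂ) 1 ×ˢ sphere (0 : ℂ) 1) ×ˢ Ici (0 : ℝ))
          (univ ×ˢ closedBall (0 : ℂ) 1) := fun q hq => by
        rw [hφ]
        exact ⟨mem_univ _, hq.1.1⟩
      have hmain := (hcont _ (hmaps ⟨⟨hl₀, hξ₀⟩, ht₀.le⟩)).comp hlog.continuousWithinAt hmaps
      have ho : IsOpen {q : (ℂ × ℂ) × ℝ | 0 < q.2} := isOpen_lt continuous_const continuous_snd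
      refine hmain.cexp.congr_of_eventuallyEq_of_mem ?_ ⟨⟨hl₀, hξ₀⟩, ht₀.le⟩
      filter_upwards [mem_nhdsWithin_of_mem_nhds (ho.mem_nhds (x := ((l₀, ξ₀), t₀)) ht₀),
        self_mem_nhdsWithin] with q hq hq'
      rw [hgpos hq, Function.comp_apply, hφ]
      refine hexp _ hq'.1.1 _ _ _ ?_
      rw [exp_add, exp_log (hne hξ₀), exp_log (hne hq'.1.2),
        exp_log (div_ne_zero (hne hq'.1.2) (hne hξ₀)), mul_div_cancel₀ _ (hne hξ₀)]
  · intro t₁ t₂ ht₁ ht₂ ξ₁ hξ₁ ξ₂ hξ₂ l hl h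
    rw [hgpos ht₁, hgpos ht₂] at h
    obtain ⟨h1, h2⟩ := hinj' l hl _ _ _ _ (log_re_eq_zero hξ₁) (log_re_eq_zero hξ₂) h
    rw [exp_log (hne hξ₁), exp_log (hne hξ₂)] at h2
    exact ⟨Real.log_injOn_pos ht₁ ht₂ h1, h2⟩
  · intro l hl w hw
    obtain ⟨ζ, s, hζ, h⟩ := hsurj l hl (log w)
    refine ⟨exp ζ, exp_mem_sphere hζ, Real.exp s, Real.exp_pos s, ?_⟩
    rw [hgpos (Real.exp_pos s), Real.log_exp, ← exp_log hw, ← h]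
    exact hexp l hl _ _ _ (exp_log (exp_ne_zero ζ))
  · intro t ht f hf
    obtain ⟨ζ, hζ, h⟩ := huniq _ f hf
    refine ⟨exp ζ, exp_mem_sphere hζ, fun l hl => ?_⟩
    rw [hgpos ht, h l hl]
    exact hexp l hl _ _ _ (exp_log (exp_ne_zero ζ)).symm

end

/-- **Filling Theorem′.** For a smooth family of graphical tori `Γ^t`, there is a
`g : Δ̄ × S¹ × [0,∞) → ℂ` defining a holomorphic transverse foliation of each torus `Γ^t`
(`t > 0`), with disks belonging to different tori pairwise disjoint, and unique in the
strong sense: every nonvanishing holomorphic disk with trace in some `Γ^t` is a leaf. -/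
theorem filling_theorem' (F : ℂ → ℂ → ℝ) (hF : IsSmoothTorusFamily F) :
    ∃ g : ℂ → ℂ → ℝ → ℂ,
      ContinuousOn (fun q : (ℂ × ℂ) × ℝ => g q.1.1 q.1.2 q.2)
        ((closedBall (0 : ℂ) 1 ×ˢ sphere (0 : ℂ) 1) ×ˢ Ici (0 : ℝ)) ∧
      (∀ l ∈ closedBall (0 : ℂ) 1, ∀ ξ ∈ sphere (0 : ℂ) 1, g l ξ 0 = 0) ∧
      (∀ t : ℝ, 0 < t → IsHolTransFoliation (TorusOf F t) (fun l ξ => g l ξ t)) ∧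
      (∀ t₁ t₂ : ℝ, 0 < t₁ → 0 < t₂ → t₁ ≠ t₂ → ∀ ξ₁ ∈ sphere (0 : ℂ) 1,
        ∀ ξ₂ ∈ sphere (0 : ℂ) 1, ∀ l ∈ ball (0 : ℂ) 1, g l ξ₁ t₁ ≠ g l ξ₂ t₂) ∧
      (∀ t : ℝ, 0 < t → ∀ h : ℂ → ℂ, HolDisk h → DiskTraceIn h (TorusOf F t) →
        (∀ l ∈ ball (0 : ℂ) 1, h l ≠ 0) →
        ∃ ξ ∈ sphere (0 : ℂ) 1, ∀ l ∈ closedBall (0 : ℂ) 1, h l = g l ξ t) := by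
  obtain ⟨g, hcont, hzero, hsol, hinj, hsurj, huniq⟩ := hF.exists_filling
  have htrace : ∀ t, 0 < t → ∀ ξ ∈ sphere (0 : ℂ) 1, HolDisk (fun l => g l ξ t) ∧
      DiskTraceIn (fun l => g l ξ t) (TorusOf F t) ∧ ∀ l, g l ξ t ≠ 0 := by
    intro t ht ξ hξ
    obtain ⟨f, hf, hgf⟩ := hsol t ht ξ hξ
    simp only [hgf]
    exact ⟨⟨hf.1.1.cexp, hf.1.2.cexp⟩, (sol_logDefining_iff hF ht hf.1).1 hf,
      fun l => exp_ne_zero _⟩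
  refine ⟨g, hcont, fun l _ ξ _ => hzero l ξ, fun t ht => ⟨?_, ?_, fun ξ hξ => (htrace t ht ξ hξ).1,
    fun ξ hξ => (htrace t ht ξ hξ).2.1, fun ξ hξ l _ => (htrace t ht ξ hξ).2.2 l,
    fun ξ hξ η hη hne l hl h =>
      hne (hinj t t ht ht ξ hξ η hη l (ball_subset_closedBall hl) h).2, ?_⟩,
    fun t₁ t₂ ht₁ ht₂ hne ξ₁ hξ₁ ξ₂ hξ₂ l hl h =>
      hne (hinj t₁ t₂ ht₁ ht₂ ξ₁ hξ₁ ξ₂ hξ₂ l (ball_subset_closedBall hl) h).1, ?_⟩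
  · exact hcont.comp (f := fun q : ℂ × ℂ => (q, t)) (by fun_prop) fun q hq => ⟨hq, ht.le⟩
  · obtain ⟨α, hα0, hα1, hα⟩ := Sol.exists_deriv (logData_logDefining hF) (stdEnd_logDefining hF)
      (abs_nonneg (Real.log t))
    refine ⟨α, hα0, hα1, fun ξ hξ => ?_⟩
    obtain ⟨f, hf, hgf⟩ := hsol t ht ξ hξ
    obtain ⟨hfα, f', hd, hf'⟩ := hα _ f le_rfl hf
    simp only [hgf]
    exact c1AlphaOnDisk_exp hα0 hfα hd hf'
  · intro p hp
    have hp1 := sphere_subset_closedBall hp.1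
    obtain ⟨ξ, hξ, s, hs, h⟩ := hsurj p.1 hp1 p.2 (hF.ne_zero ht hp)
    have e1 : F p.1 (g p.1 ξ s) = s := ((htrace s hs ξ hξ).2.1 p.1 hp.1).2
    have e2 : F p.1 p.2 = t := hp.2
    obtain rfl : s = t := by rw [← e1, h, e2]
    refine ⟨ξ, ⟨hξ, h⟩, fun η hη => ?_⟩
    exact (hinj s s hs hs η hη.1 ξ hξ p.1 hp1 (hη.2.trans h.symm)).2
  · intro t ht h hh htr hne
    have h0 : ∀ z ∈ closedBall (0 : ℂ) 1, h z ≠ 0 := by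
      intro z hz
      rw [← ball_union_sphere] at hz
      exact hz.elim (hne z) fun hz => hF.ne_zero ht (htr z hz)
    obtain ⟨f, hf, hfh⟩ := hh.exists_log h0
    obtain ⟨ξ, hξ, hg⟩ := huniq t ht f ((sol_logDefining_iff hF ht hf).2 fun l hl => by
      beta_reduce
      rw [hfh l (sphere_subset_closedBall hl)]
      exact htr l hl)
    exact ⟨ξ, hξ, fun l hl => by rw [← hfh l hl, hg l hl]⟩
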